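/- Let F_n be the free non-unital nonassociative ℚ-algebra on n generators x₁, …, xₙ (the magma algebra over ℚ of the free magma on n generators), and let I be the two-sided ideal of F_n generated by all elements (ab)c + (ac)b − a(bc) − a(cb) and (ab)c + (ba)c − a(bc) − b(ac) with a, b, c ∈ F_n. In the quotient F_n/I, let M_n be the ℚ-subspace spanned by the images of all multilinear monomials in x₁, …, xₙ (all products, in all bracketings, of x_{σ(1)}, …, x_{σ(n)} over all permutations σ). Then dim M₄ = 32, dim M₅ = 175, and dim M₆ = 1080. -/

import Mathlib

/-- The multiset of variables (with multiplicity) occurring in an element of a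
free magma. -/
def FreeMagma.vars {α : Type*} : FreeMagma α → Multiset α
  | .of a => {a}
  | .mul a b => a.vars + b.vars

/-- The smallest `R`-submodule of `F` containing `S` and closed under left and
right multiplication by arbitrary elements of `F`: the two-sided ideal of the
(possibly nonassociative, non-unital) algebra `F` generated by `S`, viewed as a
submodule. -/
def idealClosure (R F : Type*) [CommRing R] [AddCommGroup F] [Mul F] [Module R F]
    (S : Set F) : Submodule R F :=
  sInf {p : Submodule R F | S ⊆ p ∧ ∀ a : F, ∀ x ∈ p, a * x ∈ p ∧ x * a ∈ p}

/-- The free non-unital nonassociative `ℚ`-algebra on `n` generators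
(the magma algebra of the free magma on `n` generators). -/
abbrev FreeNA (n : ℕ) : Type := MonoidAlgebra ℚ (FreeMagma (Fin n))

/-- The two-sided ideal of `FreeNA n` generated by the linearized right- and
left-alternative relations. -/
noncomputable def altIdeal (n : ℕ) : Submodule ℚ (FreeNA n) :=
  idealClosure ℚ (FreeNA n)
    ({w | ∃ a b c : FreeNA n, w = (a*b)*c + (a*c)*b - a*(b*c) - a*(c*b)} ∪
     {w | ∃ a b c : FreeNA n, w = (a*b)*c + (b*a)*c - a*(b*c) - b*(a*c)})

/-- The subspace of the quotient of `FreeNA n` by the alternative ideal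
spanned by the images of all multilinear monomials in the `n` generators:
the arity-`n` component `Alt(n)` of the alternative operad. -/
noncomputable def altMultilinSpace (n : ℕ) : Submodule ℚ (FreeNA n ⧸ altIdeal n) :=
  Submodule.span ℚ ((altIdeal n).mkQ ''
    {v | ∃ w : FreeMagma (Fin n),
      w.vars = (Finset.univ.val : Multiset (Fin n)) ∧ v = MonoidAlgebra.single w 1})

namespace Alt

section Identities

variable {V : Type*} [AddCommGroup V] [Module ℚ V] (μ : V →ₗ[ℚ] V →ₗ[ℚ] V)

/-- The associator of the bilinear product `μ`. -/
def asc (a b c : V) : V := μ (μ a b) c - μ a (μ b c)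

/-- The product `μ` is alternative (linearized form). -/
structure IsAlternative : Prop where
  right : ∀ a b c, asc μ a b c + asc μ a c b = 0
  left : ∀ a b c, asc μ a b c + asc μ b a c = 0

/-- The operator `m ↦ a m + m a` (for `true`) or `m ↦ a m - m a` (for `false`). -/
def op (k : Bool) (a m : V) : V := if k then μ a m + μ m a else μ a m - μ m a

variable {μ}

lemma op_add (k : Bool) (a m m' : V) : op μ k a (m + m') = op μ k a m + op μ k a m' := by
  cases k <;> simp [op] <;> abel

lemma op_smul (k : Bool) (a m : V) (c : ℚ) : op μ k a (c • m) = c • op μ k a m := by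
  cases k <;> simp [op, smul_sub]

lemma mul_eq_op (a m : V) : μ a m = (1 / 2 : ℚ) • (op μ true a m + op μ false a m) := by
  simp only [op, if_true, Bool.false_eq_true, if_false]; module

lemma mul_eq_op' (a m : V) : μ m a = (1 / 2 : ℚ) • (op μ true a m - op μ false a m) := by
  simp only [op, if_true, Bool.false_eq_true, if_false]; module

namespace IsAlternative

lemma swap₁₂ (h : IsAlternative μ) (a b c : V) : asc μ a b c = -asc μ b a c := eq_neg_of_add_eq_zero_left (h.left a b c)

lemma swap₂₃ (h : IsAlternative μ) (a b c : V) : asc μ a b c = -asc μ a c b := eq_neg_of_add_eq_zero_left (h.right a b c)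

lemma rotate (h : IsAlternative μ) (a b c : V) : asc μ a b c = asc μ b c a := by
  rw [h.swap₁₂, h.swap₂₃, neg_neg]

/-- Right-normed form of all products of three elements. -/
lemma mul_mul (h : IsAlternative μ) (a b m : V) :
    μ (μ a b) m = μ a (μ b m) + asc μ a b m ∧ μ (μ b a) m = μ b (μ a m) - asc μ a b m ∧
    μ (μ a m) b = μ a (μ m b) - asc μ a b m ∧ μ (μ b m) a = μ b (μ m a) + asc μ a b m ∧
    μ (μ m a) b = μ m (μ a b) + asc μ a b m ∧ μ (μ m b) a = μ m (μ b a) - asc μ a b m := by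
  have e1 := h.swap₁₂ b a m
  have e2 := h.swap₂₃ a m b
  have e3 := h.rotate b m a
  have e4 := h.rotate m a b
  have e5 := h.rotate m b a
  have e6 := h.swap₂₃ a m b
  have e7 := h.swap₁₂ m a b
  have e8 := h.swap₂₃ b m a
  refine ⟨?_, ?_, ?_, ?_, ?_, ?_⟩
  · simp [asc]
  · rw [← sub_eq_zero, ← sub_eq_zero.2 e1]; simp only [asc]; abel
  · rw [← sub_eq_zero, ← sub_eq_zero.2 e2]; simp only [asc]; abel
  · rw [h.rotate a b m]; simp only [asc]; abel
  · rw [← e4]; simp only [asc]; abel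
  · rw [← neg_eq_iff_eq_neg.2 e1, ← e5]; simp only [asc]; abel

lemma op_dot (h : IsAlternative μ) (a b m : V) :
    (6 : ℚ) • op μ true (μ a b + μ b a) m = (3 : ℚ) • op μ true a (op μ true b m)
      + (3 : ℚ) • op μ true b (op μ true a m) + (3 : ℚ) • op μ false a (op μ false b m)
      + (3 : ℚ) • op μ false b (op μ false a m) := by
  obtain ⟨h1, h2, h3, h4, h5, h6⟩ := h.mul_mul a b m
  simp only [op, if_true, Bool.false_eq_true, if_false, map_add, map_sub, LinearMap.add_apply,
    LinearMap.sub_apply, h1, h2, h3, h4, h5, h6]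
  module

lemma op_dot' (h : IsAlternative μ) (a b m : V) :
    (6 : ℚ) • op μ false (μ a b + μ b a) m = (3 : ℚ) • op μ true a (op μ false b m)
      + (3 : ℚ) • op μ false a (op μ true b m) + (3 : ℚ) • op μ true b (op μ false a m)
      + (3 : ℚ) • op μ false b (op μ true a m) := by
  obtain ⟨h1, h2, h3, h4, h5, h6⟩ := h.mul_mul a b m
  simp only [op, if_true, Bool.false_eq_true, if_false, map_add, map_sub, LinearMap.add_apply,
    LinearMap.sub_apply, h1, h2, h3, h4, h5, h6]
  module

lemma op_brk (h : IsAlternative μ) (a b m : V) :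
    (6 : ℚ) • op μ true (μ a b - μ b a) m =
      (6 : ℚ) • op μ true a (op μ false b m) - (6 : ℚ) • op μ false b (op μ true a m) := by
  obtain ⟨h1, h2, h3, h4, h5, h6⟩ := h.mul_mul a b m
  simp only [op, if_true, Bool.false_eq_true, if_false, map_add, map_sub, LinearMap.add_apply,
    LinearMap.sub_apply, h1, h2, h3, h4, h5, h6]
  module

lemma op_brk' (h : IsAlternative μ) (a b m : V) :
    (6 : ℚ) • op μ false (μ a b - μ b a) m = (9 : ℚ) • op μ true a (op μ true b m)
      - (9 : ℚ) • op μ true b (op μ true a m) - (3 : ℚ) • op μ false a (op μ false b m)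
      + (3 : ℚ) • op μ false b (op μ false a m) := by
  obtain ⟨h1, h2, h3, h4, h5, h6⟩ := h.mul_mul a b m
  simp only [op, if_true, Bool.false_eq_true, if_false, map_add, map_sub, LinearMap.add_apply,
    LinearMap.sub_apply, h1, h2, h3, h4, h5, h6]
  module

lemma teichmuller (h : IsAlternative μ) (w x y z : V) :
    asc μ (μ w x) y z + asc μ (μ x y) w z + asc μ (μ y z) w x
      - μ w (asc μ x y z) - μ (asc μ w x y) z = 0 := by
  rw [h.swap₁₂ (μ x y), h.rotate (μ y z)]
  simp only [asc, map_sub, LinearMap.sub_apply]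
  abel

lemma perms (h : IsAlternative μ) (a b c : V) : asc μ b a c = -asc μ a b c ∧ asc μ a c b = -asc μ a b c ∧
    asc μ c b a = -asc μ a b c ∧ asc μ b c a = asc μ a b c ∧ asc μ c a b = asc μ a b c :=
  ⟨h.swap₁₂ b a c, h.swap₂₃ a c b, by rw [h.swap₁₂, ← h.rotate], (h.rotate a b c).symm,
    h.rotate c a b⟩

lemma asc_dot (h : IsAlternative μ) (w x y z : V) :
    (6 : ℚ) • asc μ (μ w x + μ x w) y z =
      (6 : ℚ) • op μ true w (asc μ x y z) + (6 : ℚ) • op μ true x (asc μ w y z) := by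
  have T := h.teichmuller
  obtain ⟨a1, a2, a3, a4, a5⟩ := h.perms w x y
  obtain ⟨b1, b2, b3, b4, b5⟩ := h.perms w x z
  obtain ⟨c1, c2, c3, c4, c5⟩ := h.perms w y z
  obtain ⟨d1, d2, d3, d4, d5⟩ := h.perms x y z
  have e1 := fun p q => h.swap₂₃ (μ p q) x w
  have e3 := fun p q => h.swap₂₃ (μ p q) z w
  have e4 := fun p q => h.swap₂₃ (μ p q) y x
  have e5 := fun p q => h.swap₂₃ (μ p q) z x
  have e6 := fun p q => h.swap₂₃ (μ p q) z y
  have hs : asc μ (μ w x + μ x w) y z = asc μ (μ w x) y z + asc μ (μ x w) y z := by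
    simp only [asc, map_add, LinearMap.add_apply]; abel
  have t1 := T w x y z
  have t2 := T w x z y
  have t3 := T w y x z
  have t4 := T w y z x
  have t5 := T w z x y
  have t6 := T w z y x
  have t7 := T x w y z
  have t8 := T x y z w
  have t9 := T x z w y
  simp only [hs, a1, a2, b2, b4, c2, c4, c5, d1, d2, d3, d4, d5,
    e1, e3, e4, e5, e6, op, if_true, map_neg, LinearMap.neg_apply] at t1 t2 t3 t4 t5 t6 t7 t8 t9 ⊢
  linear_combination (norm := module) (9 : ℚ) • t1 + (3 : ℚ) • t2 + (3 : ℚ) • t3 + (3 : ℚ) • t4 - (3 : ℚ) • t5 - (3 : ℚ) • t6 + (6 : ℚ) • t7 + (6 : ℚ) • t8 - (6 : ℚ) • t9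

lemma asc_brk (h : IsAlternative μ) (w x y z : V) :
    (6 : ℚ) • asc μ (μ w x - μ x w) y z =
      (-2 : ℚ) • op μ false w (asc μ x y z) + (2 : ℚ) • op μ false x (asc μ w y z)
        + (4 : ℚ) • op μ false y (asc μ w x z) - (4 : ℚ) • op μ false z (asc μ w x y) := by
  have T := h.teichmuller
  obtain ⟨a1, a2, a3, a4, a5⟩ := h.perms w x y
  obtain ⟨b1, b2, b3, b4, b5⟩ := h.perms w x z
  obtain ⟨c1, c2, c3, c4, c5⟩ := h.perms w y z
  obtain ⟨d1, d2, d3, d4, d5⟩ := h.perms x y z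
  have e1 := fun p q => h.swap₂₃ (μ p q) x w
  have e2 := fun p q => h.swap₂₃ (μ p q) y w
  have e3 := fun p q => h.swap₂₃ (μ p q) z w
  have e4 := fun p q => h.swap₂₃ (μ p q) y x
  have e5 := fun p q => h.swap₂₃ (μ p q) z x
  have e6 := fun p q => h.swap₂₃ (μ p q) z y
  have hs : asc μ (μ w x - μ x w) y z = asc μ (μ w x) y z - asc μ (μ x w) y z := by
    simp only [asc, map_sub, LinearMap.sub_apply]; abel
  have t1 := T w x y z
  have t2 := T w x z y
  have t3 := T w y x z
  have t4 := T w y z x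
  have t5 := T w z x y
  have t6 := T w z y x
  have t7 := T x w y z
  have t8 := T x y w z
  have t9 := T x y z w
  have t10 := T x z w y
  have t11 := T y w x z
  have t12 := T z w x y
  simp only [hs, a1, a2, a4, a5, b2, b4, b5, c1, c2, c4, c5, d1, d2, d3, d4, d5,
    e1, e2, e3, e4, e5, e6, op, Bool.false_eq_true, if_false, map_neg, LinearMap.neg_apply] at t1 t2 t3 t4 t5 t6 t7 t8 t9 t10 t11 t12 ⊢
  linear_combination (norm := module) -(1 : ℚ) • t1 + (1 : ℚ) • t2 + (1 : ℚ) • t3 - (3 : ℚ) • t4 + (3 : ℚ) • t5 - (1 : ℚ) • t6 - (6 : ℚ) • t7 - (4 : ℚ) • t8 + (2 : ℚ) • t9 + (2 : ℚ) • t10 + (4 : ℚ) • t11 - (4 : ℚ) • t12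

end IsAlternative
end Identities
end Alt

namespace Alt

/-- Trees of dot products `xy + yx` (`true`) and brackets `xy - yx` (`false`). -/
inductive Tr
  | leaf (i : ℕ)
  | nd (k : Bool) (a b : Tr)

/-- A multiple of a word of operators applied to an associator. -/
structure Term where
  c : ℤ
  ops : List (Bool × Tr)
  x : Tr
  y : Tr
  z : Tr

/-- Rewriting of an operator `op k` at a product. -/
def opRule (k q : Bool) (a b : Tr) : List (ℤ × List (Bool × Tr)) :=
  match q, k with
  | true, k => [(3, [(true, a), (k, b)]), (3, [(false, a), (!k, b)]),
      (3, [(true, b), (k, a)]), (3, [(false, b), (!k, a)])]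
  | false, true => [(6, [(true, a), (false, b)]), (-6, [(false, b), (true, a)])]
  | false, false => [(9, [(true, a), (true, b)]), (-9, [(true, b), (true, a)]),
      (-3, [(false, a), (false, b)]), (3, [(false, b), (false, a)])]

/-- Rewriting of the first composite letter of an operator word. -/
def stepOps : List (Bool × Tr) → List (ℤ × List (Bool × Tr))
  | [] => []
  | (k, .leaf i) :: l => (stepOps l).map fun p => (p.1, (k, .leaf i) :: p.2)
  | (k, .nd q a b) :: l => (opRule k q a b).map fun p => (p.1, p.2 ++ l)

/-- Rewriting of an associator with a composite first entry. -/
def ascRule (c : ℤ) (ops : List (Bool × Tr)) (q : Bool) (w x y z : Tr) : List Term :=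
  match q with
  | true => [⟨6 * c, ops ++ [(true, w)], x, y, z⟩, ⟨6 * c, ops ++ [(true, x)], w, y, z⟩]
  | false => [⟨-2 * c, ops ++ [(false, w)], x, y, z⟩, ⟨2 * c, ops ++ [(false, x)], w, y, z⟩,
      ⟨4 * c, ops ++ [(false, y)], w, x, z⟩, ⟨-4 * c, ops ++ [(false, z)], w, x, y⟩]

/-- One rewriting step; it multiplies the value by `6`. -/
def Term.step (t : Term) : List Term :=
  match stepOps t.ops with
  | p :: l => (p :: l).map fun p => ⟨p.1 * t.c, p.2, t.x, t.y, t.z⟩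
  | [] => match t.x, t.y, t.z with
    | .nd q a b, y, z => ascRule t.c t.ops q a b y z
    | x, .nd q a b, z => ascRule (-t.c) t.ops q a b x z
    | x, y, .nd q a b => ascRule t.c t.ops q a b x y
    | x, y, z => [⟨6 * t.c, t.ops, x, y, z⟩]

/-- Iterated rewriting. -/
def expand : ℕ → List Term → List Term
  | 0, l => l
  | k + 1, l => expand k (l.flatMap Term.step)

section Ev
variable {V : Type*} [AddCommGroup V] [Module ℚ V] (μ : V →ₗ[ℚ] V →ₗ[ℚ] V) (g : ℕ → V)

/-- The value of a tree. -/
def Tr.ev : Tr → V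
  | .leaf i => g i
  | .nd k a b => op μ k a.ev b.ev

/-- The value of an operator word. -/
def opsEv (l : List (Bool × Tr)) (m : V) : V := l.foldr (fun p m => op μ p.1 (p.2.ev μ g) m) m

/-- The value of a term. -/
def Term.ev (t : Term) : V :=
  t.c • opsEv μ g t.ops (asc μ (t.x.ev μ g) (t.y.ev μ g) (t.z.ev μ g))

variable {μ g}

lemma opsEv_cons (p : Bool × Tr) (l : List (Bool × Tr)) (m : V) :
    opsEv μ g (p :: l) m = op μ p.1 (p.2.ev μ g) (opsEv μ g l m) := rfl

lemma opsEv_append (l l' : List (Bool × Tr)) (m : V) :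
    opsEv μ g (l ++ l') m = opsEv μ g l (opsEv μ g l' m) := by
  simp [opsEv, List.foldr_append]

lemma opsEv_add (l : List (Bool × Tr)) (m m' : V) :
    opsEv μ g l (m + m') = opsEv μ g l m + opsEv μ g l m' := by
  induction l with
  | nil => rfl
  | cons p l ih => simp only [opsEv_cons, ih, op_add]

lemma opsEv_smul (l : List (Bool × Tr)) (c : ℚ) (m : V) :
    opsEv μ g l (c • m) = c • opsEv μ g l m := by
  induction l with
  | nil => rfl
  | cons p l ih => simp only [opsEv_cons, ih, op_smul]

lemma opRule_ev (h : IsAlternative μ) (k q : Bool) (a b : Tr) (m : V) :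
    (6 : ℚ) • op μ k ((Tr.nd q a b).ev μ g) m =
      ((opRule k q a b).map fun p => (p.1 : ℚ) • opsEv μ g p.2 m).sum := by
  cases q <;> cases k
  · simp only [Tr.ev, opRule]
    refine (h.op_brk' (a.ev μ g) (b.ev μ g) m).trans ?_
    simp [opsEv]
    module
  · simp only [Tr.ev, opRule]
    refine (h.op_brk (a.ev μ g) (b.ev μ g) m).trans ?_
    simp [opsEv]
    module
  · simp only [Tr.ev, opRule]
    refine (h.op_dot' (a.ev μ g) (b.ev μ g) m).trans ?_
    simp [opsEv]
    module
  · simp only [Tr.ev, opRule]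
    refine (h.op_dot (a.ev μ g) (b.ev μ g) m).trans ?_
    simp [opsEv]
    module

lemma op_list_sum {ι : Type*} (k : Bool) (a : V) (l : List ι) (f : ι → V) :
    op μ k a (l.map f).sum = (l.map fun i => op μ k a (f i)).sum := by
  induction l with
  | nil => cases k <;> simp [op]
  | cons i l ih => simp [op_add, ih]

lemma stepOps_ev (h : IsAlternative μ) (l : List (Bool × Tr)) (m : V) : stepOps l = [] ∨
    (6 : ℚ) • opsEv μ g l m = ((stepOps l).map fun p => (p.1 : ℚ) • opsEv μ g p.2 m).sum := by
  induction l with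
  | nil => exact .inl rfl
  | cons p l ih =>
    obtain ⟨k, i | ⟨q, a, b⟩⟩ := p
    · rcases ih with ih | ih
      · left; simp [stepOps, ih]
      · right
        rw [opsEv_cons, ← op_smul, ih, op_list_sum]
        simp [stepOps, Function.comp_def, opsEv_cons, op_smul]
    · right
      rw [opsEv_cons, opRule_ev h]
      simp [stepOps, Function.comp_def, opsEv_append]

lemma ascRule_ev (h : IsAlternative μ) (c : ℤ) (ops : List (Bool × Tr)) (q : Bool) (w x y z : Tr) :
    ((ascRule c ops q w x y z).map (Term.ev μ g)).sum =
      (6 : ℚ) • Term.ev μ g ⟨c, ops, .nd q w x, y, z⟩ := by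
  simp only [Term.ev, ← Int.cast_smul_eq_zsmul ℚ]
  rw [smul_comm, ← opsEv_smul]
  cases q
  on_goal 1 => rw [show (6 : ℚ) • asc μ ((Tr.nd false w x).ev μ g) (y.ev μ g) (z.ev μ g) = _ from
    h.asc_brk (w.ev μ g) (x.ev μ g) (y.ev μ g) (z.ev μ g)]
  on_goal 2 => rw [show (6 : ℚ) • asc μ ((Tr.nd true w x).ev μ g) (y.ev μ g) (z.ev μ g) = _ from
    h.asc_dot (w.ev μ g) (x.ev μ g) (y.ev μ g) (z.ev μ g)]
  all_goals
    simp only [ascRule, List.map_cons, List.map_nil, List.sum_cons, List.sum_nil, Term.ev,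
      opsEv_add, opsEv_smul, opsEv_append, opsEv_cons, sub_eq_add_neg, ← neg_smul,
      ← Int.cast_smul_eq_zsmul ℚ, show ∀ m, opsEv μ g [] m = m from fun _ => rfl]
    push_cast
    module

lemma Term.step_ev (h : IsAlternative μ) (t : Term) : (t.step.map (Term.ev μ g)).sum = (6 : ℚ) • t.ev μ g := by
  obtain ⟨c, ops, x, y, z⟩ := t
  rcases hs : stepOps ops with _ | ⟨p, l⟩
  · rcases x with i | ⟨q, a, b⟩
    · rcases y with j | ⟨q, a, b⟩
      · rcases z with k | ⟨q, a, b⟩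
        · simp only [Term.step, hs, Term.ev, ← Int.cast_smul_eq_zsmul ℚ]
          simp [mul_smul, Term.ev, ← Int.cast_smul_eq_zsmul ℚ]
        · simp only [Term.step, hs, ascRule_ev h]
          simp only [Term.ev]
          rw [h.rotate ((Tr.nd q a b).ev μ g)]
      · simp only [Term.step, hs, ascRule_ev h]
        simp only [Term.ev, ← Int.cast_smul_eq_zsmul ℚ]
        rw [h.swap₁₂ ((Tr.nd q a b).ev μ g), ← neg_one_smul ℚ (asc μ _ _ _), opsEv_smul]
        push_cast
        module
    · simp only [Term.step, hs, ascRule_ev h]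
  · rcases stepOps_ev (g := g) h ops (asc μ (x.ev μ g) (y.ev μ g) (z.ev μ g)) with e | e
    · simp [hs] at e
    · have hstep : Term.step ⟨c, ops, x, y, z⟩ =
          (stepOps ops).map fun p => ⟨p.1 * c, p.2, x, y, z⟩ := by
        simp [Term.step, hs]
      rw [hstep]
      simp only [Term.ev, ← Int.cast_smul_eq_zsmul ℚ]
      rw [smul_comm, e, List.smul_sum]
      simp [Function.comp_def, Term.ev, ← Int.cast_smul_eq_zsmul ℚ, smul_smul, mul_comm]

lemma expand_ev (h : IsAlternative μ) (k : ℕ) (l : List Term) : ((expand k l).map (Term.ev μ g)).sum =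
    (6 : ℚ) ^ k • (l.map (Term.ev μ g)).sum := by
  induction k generalizing l with
  | zero => simp [expand]
  | succ k ih =>
    rw [expand, ih, pow_succ, mul_smul]
    congr 1
    induction l with
    | nil => simp
    | cons t l ih => simp [Term.step_ev h, ih]

end Ev
end Alt

namespace Alt

/-- An operator word in letters, applied to the associator of three letters. -/
structure Word where
  ops : List (Bool × ℕ)
  x : ℕ
  y : ℕ
  z : ℕ

def Tr.toNat : Tr → ℕ
  | .leaf i => i
  | _ => 0

def Term.word (t : Term) : Word := ⟨t.ops.map fun p => (p.1, p.2.toNat), t.x.toNat, t.y.toNat, t.z.toNat⟩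

/-- Evaluate a natural number before passing it on. -/
def force {α : Type} (n : ℕ) (f : ℕ → α) : α := Nat.rec (f 0) (fun k _ => f (Nat.succ k)) n

def sgn (x y z : ℕ) : ℕ :=
  cond (Nat.ble x y) (cond (Nat.ble y z) 1 (cond (Nat.ble x z) 4 1))
    (cond (Nat.ble y z) (cond (Nat.ble x z) 4 1) 4)

def lt (π i : ℕ) : ℕ := Nat.mod (Nat.shiftRight π (Nat.mul 4 i)) 16

def key (π : ℕ) : List (Bool × ℕ) → ℕ → ℕ
  | [], h => Nat.mod h 751
  | (k, a) :: l, h => key π l (Nat.add (Nat.mul h 12) (Nat.add (Nat.mul 2 (lt π a)) (cond k 1 0)))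

def forceOps {α : Type} : List (Bool × ℕ) → (List (Bool × ℕ) → α) → α
  | [], k => k []
  | (b, a) :: l, k => force a fun a' => Bool.rec (forceOps l fun l' => k ((false, a') :: l'))
      (forceOps l fun l' => k ((true, a') :: l')) b

def forceTerms {α : Type} : List (ℕ × Word) → (List (ℕ × Word) → α) → α
  | [], k => k []
  | (c, w) :: l, k => force c fun c' => force w.x fun x' => force w.y fun y' => force w.z fun z' =>
      forceOps w.ops fun o' => forceTerms l fun l' => k ((c', ⟨o', x', y', z'⟩) :: l')

def rowOf {α : Type} (π : ℕ) (k : ℕ → α) : List (ℕ × Word) → ℕ → α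
  | [], r => k r
  | (c, w) :: l, r => force (Nat.add r (Nat.shiftLeft (Nat.mul c (sgn (lt π w.x) (lt π w.y) (lt π w.z))) (Nat.mul 16 (key π w.ops 0)))) (rowOf π k l)

def rowsOf (W : ℕ) (T : List (ℕ × Word)) (k : ℕ → Bool) : List ℕ → ℕ → Bool
  | [], r => k r
  | p :: l, r => rowOf p (fun u => force (Nat.add (Nat.shiftLeft r W) u) (rowsOf W T k l)) T 0

def mask (w b : ℕ) : ℕ → ℕ
  | 0 => 0
  | n + 1 => Nat.add (Nat.shiftLeft (mask w b n) w) b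

structure Masks where
  m3 : ℕ
  m14 : ℕ
  mE : ℕ
  mQ : ℕ
  r3 : ℕ
  r16 : ℕ

def withMasks (W n k : ℕ) (f : Masks → Bool) : Bool :=
  force (mask 16 7 (Nat.add n n)) fun a => force (mask 16 8191 (Nat.add n n)) fun b => force (mask 32 65535 n) fun c =>
  force (mask 32 16383 n) fun d => force (mask W 7 k) fun e => force (mask W 65535 k) fun g => f ⟨a,b,c,d,e,g⟩

def norm5 (M : Masks) (v : ℕ) (k : ℕ → Bool) : Bool :=
  force (Nat.land (Nat.lor (Nat.land (Nat.shiftRight (Nat.mul (Nat.land v M.mE) 52429) 18) M.mQ)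
    (Nat.shiftLeft (Nat.land (Nat.shiftRight (Nat.mul (Nat.land (Nat.shiftRight v 16) M.mE) 52429) 18) M.mQ) 16)) M.m14) fun q =>
  force (Nat.land (Nat.sub v (Nat.mul 5 q)) M.m3) fun u =>
  cond (Nat.beq (Nat.add u (Nat.mul 5 q)) v) (k u) false

def norm5' (M : Masks) (v : ℕ) (k : ℕ → Bool) : Bool :=
  force (Nat.land (Nat.shiftRight (Nat.mul v 52429) 18) M.r16) fun q =>
  force (Nat.land (Nat.sub v (Nat.mul 5 q)) M.r3) fun u =>
  cond (Nat.beq (Nat.add u (Nat.mul 5 q)) v) (k u) false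

def indep (M : Masks) (W : ℕ) : List ℕ → ℕ → Bool
  | [], _ => true
  | s :: ss, A => norm5 M (Nat.mod A (Nat.shiftLeft 1 W)) fun u =>
      force (Nat.land (Nat.shiftRight u (Nat.mul 16 s)) 7) fun d =>
      force (Nat.mod (Nat.mul 4 (Nat.mul (Nat.mul d d) d)) 5) fun e =>
      cond (Nat.beq (Nat.mod (Nat.mul e d) 5) 4) (force (Nat.shiftRight A W) fun A' =>
        norm5' M (Nat.mul e (Nat.land (Nat.shiftRight A' (Nat.mul 16 s)) M.r16)) fun D =>
        force (Nat.add A' (Nat.mul D u)) (indep M W ss)) false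

def prep (l : List Term) : List (ℕ × Word) := l.map fun t => (Int.toNat (t.c % 5), t.word)

def rows (W : ℕ) (k : ℕ → Bool) : List (List Term × List ℕ) → ℕ → Bool
  | [], r => k r
  | (l, ps) :: m, r => forceTerms (prep (expand 3 l)) fun T => rowsOf W T (rows W k m) ps r

abbrev dot := Tr.nd true
abbrev brk := Tr.nd false
abbrev x0 := Tr.leaf 0
abbrev x1 := Tr.leaf 1
abbrev x2 := Tr.leaf 2
abbrev x3 := Tr.leaf 3
abbrev x4 := Tr.leaf 4
abbrev x5 := Tr.leaf 5
def sw (ops : List (Bool × Tr)) (u v w : Tr) : List Term := [⟨1, ops, u, v, w⟩, ⟨1, ops, v, u, w⟩]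
def jb (l : List (Bool × Tr)) (u v : Tr) (r : List (Bool × Tr)) (x y z : Tr) : List Term :=
  [⟨1, l ++ (true, .nd false u v) :: r, x, y, z⟩, ⟨1, l ++ (true, .nd false v u) :: r, x, y, z⟩]
def jac (k : Bool) (a b c x y z : Tr) (e : ℤ) : List Term :=
  [⟨e, [(k, brk (brk a b) c)], x, y, z⟩, ⟨e, [(k, brk (brk b c) a)], x, y, z⟩,
   ⟨e, [(k, brk (brk c a) b)], x, y, z⟩]

def instances₅ : List (List Term × List ℕ) :=
  [(jb [] x0 x1 [] x2 x3 x4,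
    [274960, 274720, 270640, 205120, 274465, 270385, 204865, 266290, 200770, 135235]),
   (sw [] (dot x0 x1) (dot x2 x3) x4,
    [274960, 213520, 274720, 213280, 147760]),
   (sw [] (dot x0 x1) (brk x2 x3) x4,
    [274960, 213520, 274720, 213280, 270640]),
   (sw [] (brk x0 x1) (brk x2 x3) x4,
    [274960, 213520, 148240, 82720, 17185])]

def instances₆ : List (List Term × List ℕ) :=
  [(jac true x0 x1 x2 x3 x4 x5 1 ++ jac true x3 x4 x5 x0 x1 x2 (-1),
    [5517840, 4534800, 5514000, 4530960, 5448720, 3482640, 4400400, 3417360, 5517600, 5509920,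
      4526880, 5444640, 3478560, 4396320, 3413280, 5513520, 5509680, 5379120, 2430000, 4330800,
      2364720, 5448000, 5444160, 5378880, 3282240, 2299200, 4399440, 4395600, 4330320, 3282000]),
   (jac false x0 x1 x2 x3 x4 x5 1 ++ jac false x3 x4 x5 x0 x1 x2 1,
    [5517840, 4534800, 5514000, 4530960, 5448720, 3482640, 4400400, 3417360, 5517600, 5509920,
      4526880, 5444640, 3478560, 4396320, 3413280, 5513520, 5509680, 5379120, 2430000, 4330800,
      2364720, 5448000, 5444160, 5378880, 3282240, 2299200, 4399440, 4395600, 4330320, 3282000]),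
   (jb [(true, x5)] x0 x1 [] x2 x3 x4,
    [5517840, 4534800, 3490320, 2442000, 5517600, 4534560, 3490080, 1393440, 5513520, 4530480,
      2441520, 1393200, 5448000, 3481920, 2437440, 1389120, 4399440, 3416400, 2371920, 1323600,
      5517345, 4534305, 3489825, 344865, 5513265, 4530225, 2441265, 344625, 5447745, 3481665,
      2437185, 340545, 4399185, 3416145, 2371665, 275025, 5509170, 4526130, 1392690, 344370,
      5443650, 3477570, 1388610, 340290, 4395090, 3412050, 1323090, 274770, 5378115, 2428995,
      1384515, 336195, 4329555, 2363475, 1318995, 270675, 3280980, 2297940, 1253460, 205140]),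
   (jb [] x0 x1 [(true, x5)] x2 x3 x4,
    [5517840, 4534800, 3490320, 2442000, 5517600, 4534560, 3490080, 1393440, 5513520, 4530480,
      2441520, 1393200, 5448000, 3481920, 2437440, 1389120, 4399440, 3416400, 2371920, 1323600,
      5517345, 4534305, 3489825, 5513265, 4530225, 2441265, 5447745, 3481665, 2437185, 4399185,
      3416145, 2371665, 5509170, 4526130, 5443650, 3477570, 4395090, 3412050, 5378115, 4329555]),
   (jb [(false, x5)] x0 x1 [] x2 x3 x4,
    [5517840, 4534800, 3490320, 2442000, 5517600, 4534560, 3490080, 1393440, 5513520, 4530480,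
      2441520, 1393200, 5448000, 3481920, 2437440, 1389120, 4399440, 3416400, 2371920, 1323600,
      5517345, 4534305, 3489825, 344865, 5513265, 4530225, 2441265, 344625, 5447745, 3481665,
      2437185, 340545, 4399185, 3416145, 2371665, 275025, 5509170, 4526130, 1392690, 344370,
      5443650, 3477570, 1388610, 340290, 4395090, 3412050, 1323090, 274770, 5378115, 2428995,
      1384515, 336195, 4329555, 2363475, 1318995, 270675, 3280980, 2297940, 1253460, 205140]),
   (jb [] x0 x1 [(false, x5)] x2 x3 x4,
    [5517840, 4534800, 3490320, 2442000, 5517600, 4534560, 3490080, 1393440, 5513520, 4530480,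
      2441520, 1393200, 5448000, 3481920, 2437440, 1389120, 4399440, 3416400, 2371920, 1323600,
      5517345, 4534305, 3489825, 5513265, 4530225, 2441265, 5447745, 3481665, 2437185, 4399185,
      3416145, 2371665, 5509170, 4526130, 5443650, 3477570, 4395090, 3412050, 5378115, 4329555]),
   (sw [(true, x5)] (dot x0 x1) (dot x2 x3) x4,
    [5517840, 4534800, 5456400, 3490320, 4411920, 3428880, 2442000, 2380560, 5517600, 4534560,
      5456160, 3490080, 4411680, 3428640, 1393440, 1332000, 5390640, 2441520, 4346160, 2380080,
      1393200, 1331760, 3297600, 2314560, 1266240, 344865, 283425, 344625, 283185, 217665]),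
   (sw [(true, x5)] (dot x0 x1) (brk x2 x3) x4,
    [5517840, 4534800, 5456400, 3490320, 4411920, 3428880, 2442000, 2380560, 5517600, 4534560,
      5456160, 3490080, 4411680, 3428640, 1393440, 1332000, 5513520, 4530480, 2441520, 2380080,
      1393200, 1331760, 3481920, 2437440, 1389120, 344865, 283425, 344625, 283185, 340545]),
   (sw [(true, x5)] (brk x0 x1) (brk x2 x3) x4,
    [5517840, 4534800, 5456400, 3490320, 4411920, 3428880, 5391120, 2442000, 4346640, 2380560,
      3298320, 2315280, 5325600, 1393440, 4281120, 1332000, 3232800, 1266720, 2184240, 1201200,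
      5260065, 344865, 4215585, 283425, 3167265, 218145, 2118705, 152625, 1070130, 87090]),
   (sw [(false, x5)] (dot x0 x1) (dot x2 x3) x4,
    [5517840, 4534800, 5456400, 3490320, 4411920, 3428880, 2442000, 2380560, 5517600, 4534560,
      5456160, 3490080, 4411680, 3428640, 1393440, 1332000, 5390640, 2441520, 4346160, 2380080,
      1393200, 1331760, 3297600, 2314560, 1266240, 344865, 283425, 344625, 283185, 217665]),
   (sw [(false, x5)] (dot x0 x1) (brk x2 x3) x4,
    [5517840, 4534800, 5456400, 3490320, 4411920, 3428880, 2442000, 2380560, 5517600, 4534560,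
      5456160, 3490080, 4411680, 3428640, 1393440, 1332000, 5513520, 4530480, 2441520, 2380080,
      1393200, 1331760, 3481920, 2437440, 1389120, 344865, 283425, 344625, 283185, 340545]),
   (sw [(false, x5)] (brk x0 x1) (brk x2 x3) x4,
    [5517840, 4534800, 5456400, 3490320, 4411920, 3428880, 5391120, 2442000, 4346640, 2380560,
      3298320, 2315280, 5325600, 1393440, 4281120, 1332000, 3232800, 1266720, 2184240, 1201200,
      5260065, 344865, 4215585, 283425, 3167265, 218145, 2118705, 152625, 1070130, 87090]),
   (jb [] (dot x0 x1) x2 [] x3 x4 x5,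
    [5517840, 5514000, 5448720, 4400400, 5517600, 5509920, 5444640, 4396320, 5513520, 5509680,
      5379120, 4330800, 5448000, 5444160, 5378880, 3282240, 4399440, 4395600, 4330320, 3282000,
      5505825, 5440545, 4392225, 5505585, 5375025, 4326705, 5440065, 5374785, 3278145, 4391505,
      4326225, 3277905, 5309490, 4261170, 5309250, 3212610, 4260690, 3212370, 2164035, 2163795]),
   (sw [] (dot (dot x0 x1) x2) (dot x3 x4) x5,
    [5517840, 4534800, 5514000, 4530960, 3482640, 5517600, 4534560, 5509920, 4526880, 3478560,
      5513520, 4530480, 5509680, 4526640, 2430000, 5448000, 3481920, 5444160, 3478080, 2429760,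
      4399440, 3416400, 4395600, 3412560, 2364240, 5517345, 4534305, 5505825, 4522785, 3474465,
      5513265, 4530225, 5505585, 4522545, 2425905, 5447745, 3481665, 5440065, 3473985, 2425665,
      4399185, 3416145, 4391505, 5509170, 4526130, 5443650, 3477570, 4395090, 3412050, 2428995,
      2363475]),
   (sw [] (dot (dot x0 x1) x2) (brk x3 x4) x5,
    [5517840, 4534800, 5514000, 4530960, 5448720, 5517600, 4534560, 5509920, 4526880, 5444640,
      5513520, 4530480, 5509680, 4526640, 5379120, 5448000, 3481920, 5444160, 3478080, 5378880,
      4399440, 3416400, 4395600, 3412560, 4330320, 5517345, 4534305, 5505825, 5513265, 4530225,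
      5505585, 5447745, 3481665, 5440065, 4391505]),
   (sw [] (dot (brk x0 x1) x2) (brk x3 x4) x5,
    [5517840, 4534800, 3490320, 5514000, 4530960, 2442000, 5448720, 3482640, 4400400, 5517600,
      4534560, 3490080, 5509920, 4526880, 1393440, 3478560, 5513520, 4530480, 2441520, 5509680,
      2430000, 5448000, 3481920, 4399440, 5517345, 4534305, 5505825, 344865, 5513265]),
   (sw [] (brk (brk x0 x1) x2) (brk x3 x4) x5,
    [5517840, 4534800, 3490320, 2442000, 5517600])]

def pivots₅ : List ℕ :=
  [115, 98, 100, 113, 102, 103, 101, 77, 99, 75, 109, 96, 89, 111, 87, 114, 112, 88, 110, 86, 62,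
    108, 84, 60, 36]

def pivots₆ : List ℕ :=
  [750, 745, 743, 717, 739, 731, 740, 620, 709, 612, 707, 733, 673, 703, 749, 729, 649, 573, 741,
    738, 596, 737, 735, 594, 725, 716, 714, 694, 682, 670, 451, 744, 742, 728, 730, 734, 710, 687,
    732, 708, 663, 721, 726, 706, 705, 722, 704, 697, 695, 696, 713, 719, 702, 685, 691, 727, 597,
    715, 661, 711, 651, 621, 723, 698, 693, 674, 650, 669, 622, 684, 640, 746, 699, 683, 679, 659,
    657, 720, 718, 692, 592, 376, 588, 680, 326, 632, 527, 630, 690, 608, 616, 611, 634, 607, 609,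
    681, 586, 678, 686, 583, 568, 667, 571, 606, 564, 534, 525, 619, 562, 600, 587, 551, 601, 569,
    547, 672, 545, 582, 521, 517, 675, 639, 677, 671, 665, 658, 656, 648, 668, 595, 627, 590, 579,
    581, 580, 631, 524, 623, 617, 615, 666, 618, 593, 591, 572, 563, 585, 559, 488, 629, 584, 516,
    613, 605, 599, 578, 486, 576, 450, 567, 141, 429, 124, 633, 126, 254, 139, 540, 128, 610, 412,
    628, 414, 235, 427, 523, 416, 598, 604, 237, 574, 504, 570, 560, 250, 538, 241, 558, 503, 556,
    129, 127, 103, 125, 101, 417, 603, 242, 415, 391, 662, 660, 528, 565, 413, 389, 238, 526, 214,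
    553, 478, 552, 550, 548, 236, 522, 212, 546, 476, 541, 135, 122, 115, 137, 113, 421, 536, 246,
    408, 403, 535, 515, 561, 532, 425, 401, 233, 501, 226, 502, 490, 512, 557, 533, 248, 529, 224,
    514, 464, 520, 285, 509, 268, 499, 270, 398, 283, 555, 272, 197, 508, 483, 505, 379, 500, 575,
    498, 180, 496, 381, 471, 549, 475, 182, 394, 544, 385, 195, 495, 184, 273, 271, 247, 269, 245,
    513, 493, 386, 492, 491, 489, 455, 539, 185, 487, 485, 382, 484, 358, 183, 481, 159, 444, 96,
    380, 480, 356, 181, 477, 157, 279, 266, 259, 281, 257, 474, 468, 390, 473, 449, 110, 472, 443,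
    191, 463, 436, 377, 467, 370, 178, 432, 171, 392, 108, 368, 462, 328, 193, 320, 169, 366, 460,
    459, 537, 461, 456, 454, 452, 453, 448, 447, 442, 441, 440, 439, 438, 437, 435, 430, 431, 428,
    426, 424, 255, 423, 420, 419, 418, 244, 261, 265, 267, 411, 409, 407, 378, 406, 405, 404, 400,
    140, 397, 402, 253, 138, 396, 393, 388, 114, 395, 384, 52, 136, 383, 249, 375, 112, 373, 225,
    372, 88, 365, 371, 369, 134, 367, 243, 364, 104, 363, 223, 361, 86, 359, 360, 355, 62, 175,
    357, 354, 353, 347, 234, 349, 348, 344, 221, 346, 342, 345, 343, 336, 337, 173, 327, 325, 319,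
    149, 318, 304, 317, 315, 316, 314, 313, 311, 309, 310, 307, 305, 303, 308, 302, 301, 306, 299,
    298, 297, 294, 295, 296, 232, 219, 262, 293, 292, 291, 290, 260, 258, 222, 231, 286, 289, 284,
    282, 280, 277, 278, 274, 263, 239, 109, 251, 230, 256, 107, 227, 220, 218, 83, 196, 215, 213,
    211, 209, 207, 210, 206, 194, 203, 202, 201, 170, 200, 99, 199, 198, 192, 79, 190, 188, 189,
    55, 187, 168, 186, 179, 177, 144, 176, 172, 174, 167, 164, 163, 166, 162, 160, 161, 156, 158,
    155, 153, 154, 142, 98, 151, 150, 118, 148, 147, 146, 133, 145, 143, 132, 131, 130, 123, 121,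
    119, 117, 116, 111, 106, 97, 100, 95, 102, 93, 94, 92, 90, 89, 87, 91, 85, 84, 82, 81, 80, 78,
    77, 76, 74, 75, 72, 71, 70, 69, 68, 67, 64, 65, 66, 63, 61, 59, 58, 57, 56, 53, 54, 51, 50, 49,
    47, 48, 46]

end Alt

namespace Alt

/-- The `i`-th digit of `n` in base `2 ^ w`. -/
def dg (w n i : ℕ) : ℕ := n / (2 ^ w) ^ i % 2 ^ w

lemma dg_zero (w n : ℕ) : dg w n 0 = n % 2 ^ w := by simp [dg]

lemma dg_succ (w n i : ℕ) : dg w n (i + 1) = dg w (n / 2 ^ w) i := by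
  rw [dg, dg, pow_succ', Nat.div_div_eq_div_mul]

lemma dg_lt (w n i : ℕ) : dg w n i < 2 ^ w := Nat.mod_lt _ (by positivity)

lemma dg_eq (w n i : ℕ) : dg w n i = (n >>> (w * i)) % 2 ^ w := by
  rw [dg, Nat.shiftRight_eq_div_pow, pow_mul]

lemma dg_of_zero (w i : ℕ) : dg w 0 i = 0 := by simp [dg]

lemma dg_add {w : ℕ} {a b : ℕ} (h : ∀ i, dg w a i + dg w b i < 2 ^ w) (i : ℕ) :
    dg w (a + b) i = dg w a i + dg w b i := by
  induction i generalizing a b with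
  | zero =>
    have := h 0
    simp only [dg_zero] at *
    rw [Nat.add_mod, Nat.mod_eq_of_lt this]
  | succ i ih =>
    have h0 := h 0
    simp only [dg_zero] at h0
    simp only [dg_succ]
    rw [← ih fun i => by simpa only [dg_succ] using h (i + 1), Nat.add_div (by positivity),
      if_neg (by omega), add_zero]

lemma dg_mul {w c a : ℕ} (h : ∀ i, c * dg w a i < 2 ^ w) (i : ℕ) :
    dg w (c * a) i = c * dg w a i := by
  induction c with
  | zero => simp [dg_of_zero]
  | succ c ih =>
    have h' : ∀ i, c * dg w a i < 2 ^ w := fun i => by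
      have := h i; rw [Nat.succ_mul] at this; omega
    have ih' : ∀ i, dg w (c * a) i = c * dg w a i := by
      intro i
      clear ih
      induction i generalizing a with
      | zero =>
        have := h' 0
        simp only [dg_zero] at *
        rw [Nat.mul_mod, Nat.mod_mul_mod, ← Nat.mod_eq_of_lt this]
        simp [Nat.mul_mod]
      | succ i ihi =>
        have h0 := h' 0
        simp only [dg_zero] at h0
        simp only [dg_succ]
        rw [← ihi (fun i => by simpa only [dg_succ] using h (i + 1))
          (fun i => by simpa only [dg_succ] using h' (i + 1))]
        congr 1
        conv_lhs => rw [← Nat.mod_add_div a (2 ^ w), mul_add, mul_left_comm]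
        rw [Nat.add_mul_div_left _ _ (by positivity), Nat.div_eq_of_lt h0, zero_add]
    rw [Nat.succ_mul, dg_add (fun i => by rw [ih' i, ← Nat.succ_mul]; exact h i), ih' i,
      ← Nat.succ_mul]

lemma dg_and (w a b i : ℕ) : dg w (a &&& b) i = dg w a i &&& dg w b i := by
  simp only [dg_eq]
  apply Nat.eq_of_testBit_eq
  intro j
  simp only [Nat.testBit_and, Nat.testBit_mod_two_pow, Nat.testBit_shiftRight]
  cases decide (j < w) <;> simp

lemma lt_of_dg {w K a b : ℕ} (ha : a < (2 ^ w) ^ K) (hb : b < (2 ^ w) ^ K)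
    (h : ∀ i, dg w a i + dg w b i < 2 ^ w) : a + b < (2 ^ w) ^ K := by
  induction K generalizing a b with
  | zero => simp at *; omega
  | succ K ih =>
    have h0 := h 0
    simp only [dg_zero] at h0
    rw [pow_succ'] at *
    have := ih (a := a / 2 ^ w) (b := b / 2 ^ w) (Nat.div_lt_of_lt_mul ha)
      (Nat.div_lt_of_lt_mul hb) fun i => by simpa only [dg_succ] using h (i + 1)
    rw [← Nat.mod_add_div a (2 ^ w), ← Nat.mod_add_div b (2 ^ w)]
    calc _ = (a % 2 ^ w + b % 2 ^ w) + 2 ^ w * (a / 2 ^ w + b / 2 ^ w) := by ring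
      _ < 2 ^ w + 2 ^ w * (a / 2 ^ w + b / 2 ^ w) := by omega
      _ = 2 ^ w * (a / 2 ^ w + b / 2 ^ w + 1) := by ring
      _ ≤ _ := Nat.mul_le_mul_left _ this

lemma mul_lt_of_dg {w K c a : ℕ} (ha : a < (2 ^ w) ^ K)
    (h : ∀ i, c * dg w a i < 2 ^ w) : c * a < (2 ^ w) ^ K := by
  induction K generalizing a with
  | zero => simp at *; simp [ha]
  | succ K ih =>
    have h0 := h 0
    simp only [dg_zero] at h0
    rw [pow_succ'] at *
    have := ih (a := a / 2 ^ w) (Nat.div_lt_of_lt_mul ha)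
      (fun i => by simpa only [dg_succ] using h (i + 1))
    rw [← Nat.mod_add_div a (2 ^ w)]
    calc _ = c * (a % 2 ^ w) + 2 ^ w * (c * (a / 2 ^ w)) := by ring
      _ < 2 ^ w + 2 ^ w * (c * (a / 2 ^ w)) := by omega
      _ = 2 ^ w * (c * (a / 2 ^ w) + 1) := by ring
      _ ≤ _ := Nat.mul_le_mul_left _ this

lemma dg_mask {w b : ℕ} (hb : b < 2 ^ w) (n i : ℕ) :
    dg w (mask w b n) i = if i < n then b else 0 := by
  induction n generalizing i with
  | zero => simp [mask, dg_of_zero]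
  | succ n ih =>
    have e : mask w b (n + 1) = b + 2 ^ w * mask w b n := by
      rw [mask]; change mask w b n <<< w + b = _; rw [Nat.shiftLeft_eq]; ring
    cases i with
    | zero => rw [dg_zero, e, Nat.add_mul_mod_self_left, Nat.mod_eq_of_lt hb]; simp
    | succ i =>
      rw [dg_succ, e, Nat.add_mul_div_left _ _ (by positivity), Nat.div_eq_of_lt hb, zero_add, ih]
      simp

lemma dg_and_mask_le {w b : ℕ} (hb : b < 2 ^ w) (a n i : ℕ) : dg w (a &&& mask w b n) i ≤ b := by
  rw [dg_and, dg_mask hb]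
  exact Nat.and_le_right.trans (by split <;> omega)

lemma dg_dg {w K : ℕ} (n r : ℕ) {i : ℕ} (hi : i < K) :
    dg w (dg (w * K) n r) i = (n >>> (w * i)) >>> (w * K * r) % 2 ^ w := by
  simp only [dg_eq]
  apply Nat.eq_of_testBit_eq
  intro j
  simp only [Nat.testBit_mod_two_pow, Nat.testBit_shiftRight]
  have : j < w → w * i + j < w * K := fun hj => by
    calc w * i + j < w * (i + 1) := by rw [mul_add]; omega
      _ ≤ _ := Nat.mul_le_mul_left _ hi
  by_cases hj : j < w
  · simp only [hj, this hj, decide_true, Bool.true_and]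
    congr 1; omega
  · simp [hj]

/-- Digitwise reduction modulo `5`, from a candidate quotient. -/
lemma dg_reduce {w m u q v : ℕ} (huv : u + 5 * q = v) (hu : ∀ i, dg w u i ≤ 7)
    (hq : ∀ i, dg w q i ≤ m) (hm : 5 * m + 7 < 2 ^ w) (i : ℕ) :
    dg w v i = dg w u i + 5 * dg w q i := by
  have h5 : ∀ i, dg w (5 * q) i = 5 * dg w q i :=
    dg_mul fun i => by have := hq i; omega
  rw [← huv, dg_add (fun i => ?_), h5]
  rw [h5]; have := hq i; have := hu i; omega

end Alt

namespace Alt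
lemma force_eq {α : Type} (n : ℕ) (f : ℕ → α) : force n f = f n := by
  cases n <;> rfl

lemma linearIndependent_of_eliminate {k V : Type*} [Field k] [AddCommGroup V] [Module k V] {n : ℕ}
    {v : Fin (n + 1) → V} (ρ : V →ₗ[k] V) (h0 : ρ (v 0) = 0) (hne : v 0 ≠ 0)
    (h : LinearIndependent k fun i : Fin n => ρ (v i.succ)) : LinearIndependent k v := by
  rw [Fintype.linearIndependent_iff] at h ⊢
  intro c hc
  rw [Fin.sum_univ_succ] at hc
  have h1 : ∀ i, c (Fin.succ i) = 0 := h (fun i => c i.succ) (by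
    simpa [map_sum, h0] using congrArg ρ hc)
  have h2 : c 0 = 0 := by simpa [h1, hne] using hc
  exact fun i => Fin.cases h2 h1 i

/-- The row `r` modulo `5` of a matrix packed in a natural number. -/
def row (W A r : ℕ) : ℕ → ZMod 5 := fun c => (dg 16 (dg W A r) c : ZMod 5)

structure Masks.Valid (M : Masks) (K k : ℕ) : Prop where
  m3 : M.m3 = mask 16 7 K
  m14 : M.m14 = mask 16 8191 K
  r3 : M.r3 = mask (16 * K) 7 k
  r16 : M.r16 = mask (16 * K) 65535 k

lemma norm5_spec {M : Masks} {v : ℕ} {f : ℕ → Bool} (h : norm5 M v f = true) :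
    ∃ x y, (x &&& M.m3) + 5 * (y &&& M.m14) = v ∧ f (x &&& M.m3) = true := by
  simp only [norm5, force_eq, cond_eq_ite] at h
  split at h
  · rename_i h'
    exact ⟨_, _, Nat.eq_of_beq_eq_true h', h⟩
  · cases h

lemma norm5'_spec {M : Masks} {v : ℕ} {f : ℕ → Bool} (h : norm5' M v f = true) :
    ∃ x y, (x &&& M.r3) + 5 * (y &&& M.r16) = v ∧ f (x &&& M.r3) = true := by
  simp only [norm5', force_eq, cond_eq_ite] at h
  split at h
  · rename_i h'
    exact ⟨_, _, Nat.eq_of_beq_eq_true h', h⟩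
  · cases h

lemma lt_pow_of_dg {w K a : ℕ} (hw : 0 < w) (h : ∀ i, K ≤ i → dg w a i = 0) : a < (2 ^ w) ^ K := by
  induction K generalizing a with
  | zero =>
    have : ∀ j, a.testBit j = false := fun j => by
      have h1 := congrArg (fun n => n.testBit (j % w)) (h (j / w) (Nat.zero_le _))
      simpa [dg_eq, Nat.testBit_mod_two_pow, Nat.testBit_shiftRight, Nat.mod_lt _ hw,
        Nat.div_add_mod] using h1
    simp [Nat.eq_of_testBit_eq (x := a) (y := 0) fun j => by simpa using this j]
  | succ K ih =>
    rw [pow_succ', ]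
    refine (Nat.div_lt_iff_lt_mul (by positivity)).1 ?_ |>.trans_eq (mul_comm _ _)
    exact ih fun i hi => by simpa only [dg_succ] using h (i + 1) (by omega)

theorem linearIndependent_of_indep {M : Masks} {K k m : ℕ} (hM : M.Valid K k) (hK : 2 ≤ K) (ss : List ℕ) :
    ∀ A, indep M (16 * K) ss A = true → ss.length ≤ k →
    (∀ r c, dg 16 (dg (16 * K) A r) c + 49 * ss.length ≤ m) → m < 2 ^ 16 →
    LinearIndependent (ZMod 5) fun r : Fin ss.length => row (16 * K) A r := by
  have : Fact (Nat.Prime 5) := ⟨by norm_num⟩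
  have hW : 2 ^ 32 ≤ 2 ^ (16 * K) := Nat.pow_le_pow_right (by norm_num) (by omega)
  have hpow : 2 ^ (16 * K) = (2 ^ 16) ^ K := pow_mul _ _ _
  induction ss generalizing m with
  | nil =>
    intro A _ _ _ _
    have : IsEmpty (Fin ([] : List ℕ).length) := Fin.isEmpty
    exact linearIndependent_empty_type
  | cons s ss ih =>
    intro A h hk hb hm
    rw [List.length_cons] at hk
    rw [indep] at h
    obtain ⟨x, y, hxy, h⟩ := norm5_spec h
    generalize hu : x &&& M.m3 = u at *
    rw [hM.m3] at hu
    rw [hM.m14] at hxy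
    have hu7 : ∀ i, dg 16 u i ≤ 7 := fun i => hu ▸ dg_and_mask_le (by norm_num) _ _ _
    have huK : ∀ i, K ≤ i → dg 16 u i = 0 := fun i hi => by
      rw [← hu, dg_and, dg_mask (by norm_num), if_neg (by omega), Nat.and_zero]
    have hA0 : A.mod (Nat.shiftLeft 1 (16 * K)) = dg (16 * K) A 0 := by
      rw [dg_zero]
      exact congrArg (A % ·) (Nat.one_shiftLeft _)
    rw [hA0] at hxy
    have hrow0 : row (16 * K) A 0 = fun c => (dg 16 u c : ZMod 5) := by
      funext c
      rw [row, dg_reduce (w := 16) hxy hu7 (fun i => dg_and_mask_le (by norm_num) _ _ _) (by norm_num)]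
      push_cast
      rw [show (5 : ZMod 5) = 0 from rfl, zero_mul, add_zero]
    simp only [force_eq, cond_eq_ite] at h
    split at h
    swap; · cases h
    rename_i hed
    set d := Nat.land (u.shiftRight (Nat.mul 16 s)) 7 with hd
    set e := ((Nat.mul 4 (Nat.mul (d.mul d) d)).mod 5) with he
    have he5 : e < 5 := Nat.mod_lt _ (by norm_num)
    have hds : d = dg 16 u s := by
      have h1 : d = (u >>> (16 * s)) % 8 := Nat.and_two_pow_sub_one_eq_mod _ 3
      have h2 := hu7 s
      rw [dg_eq] at h2 ⊢
      omega
    have hed' : (e : ZMod 5) * (d : ZMod 5) = -1 := by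
      have : e * d % 5 = 4 := Nat.eq_of_beq_eq_true hed
      have := congrArg (Nat.cast (R := ZMod 5)) this
      rw [ZMod.natCast_mod] at this
      push_cast at this
      rw [this]; rfl
    have hsK : s < K := by
      by_contra hs
      rw [hds, huK s (by omega)] at hed'
      revert hed'; simp
    obtain ⟨x', y', hxy', h⟩ := norm5'_spec h
    generalize hD : x' &&& M.r3 = D at *
    rw [hM.r3] at hD
    rw [hM.r16] at hxy'
    change D + 5 * (y' &&& mask (16 * K) 65535 k) =
      e * (((A >>> (16 * K)) >>> (16 * s)) &&& mask (16 * K) 65535 k) at hxy'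
    change indep M (16 * K) ss ((A >>> (16 * K)) + D * u) = true at h
    have hA' : ∀ r, dg (16 * K) (A >>> (16 * K)) r = dg (16 * K) A (r + 1) := fun r => by
      rw [Nat.shiftRight_eq_div_pow, ← dg_succ]
    generalize A >>> (16 * K) = A' at *
    have hD7 : ∀ i, dg (16 * K) D i ≤ 7 := fun i => hD ▸ dg_and_mask_le (by omega) _ _ _
    have hmul : ∀ i, dg (16 * K) (e * (A' >>> (16 * s) &&& mask (16 * K) 65535 k)) i =
        e * dg (16 * K) (A' >>> (16 * s) &&& mask (16 * K) 65535 k) i :=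
      dg_mul fun i => by
        have := dg_and_mask_le (w := 16 * K) (b := 65535) (by omega) (A' >>> (16 * s)) k i
        calc _ ≤ 5 * 65535 := Nat.mul_le_mul he5.le this
          _ < _ := by omega
    have hDr : ∀ r, r < k → (dg (16 * K) D r : ZMod 5) = e * row (16 * K) A (r + 1) s := by
      intro r hr
      have h1 := dg_reduce hxy' hD7 (fun i => dg_and_mask_le (by omega) _ _ _) (by omega) r
      rw [hmul, dg_and, dg_mask (by omega), if_pos hr] at h1
      have h2 : dg (16 * K) (A' >>> (16 * s)) r &&& 65535 = dg 16 (dg (16 * K) A (r + 1)) s := by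
        rw [← hA', dg_dg _ _ hsK, show 65535 = 2 ^ 16 - 1 by norm_num, Nat.and_two_pow_sub_one_eq_mod,
          dg_eq, Nat.mod_mod_of_dvd]
        exact pow_dvd_pow _ (by omega)
      rw [h2] at h1
      have h3 := congrArg (Nat.cast (R := ZMod 5)) h1
      push_cast at h3
      rw [show (5 : ZMod 5) = 0 from rfl, zero_mul, add_zero] at h3
      exact h3.symm
    have hcu : ∀ r i, dg 16 (dg (16 * K) D r * u) i = dg (16 * K) D r * dg 16 u i := fun r =>
      dg_mul fun i => by
        calc _ ≤ 7 * 7 := Nat.mul_le_mul (hD7 r) (hu7 i)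
          _ < _ := by norm_num
    have hDu : ∀ r, dg (16 * K) (D * u) r = dg (16 * K) D r * u := fun r => by
      rw [mul_comm D, mul_comm _ u]
      refine dg_mul (fun r => ?_) r
      rw [mul_comm, hpow]
      refine mul_lt_of_dg (lt_pow_of_dg (by norm_num) huK) fun i => ?_
      calc _ ≤ 7 * 7 := Nat.mul_le_mul (hD7 r) (hu7 i)
          _ < _ := by norm_num
    have hb' : ∀ r i, dg 16 (dg (16 * K) A' r) i + dg 16 (dg (16 * K) D r * u) i + 49 * ss.length ≤ m :=
      fun r i => by
        have := hb (r + 1) i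
        have h2 := Nat.mul_le_mul (hD7 r) (hu7 i)
        rw [hA', hcu]
        rw [List.length_cons] at this
        omega
    have hsum : ∀ r, dg (16 * K) (A' + D * u) r = dg (16 * K) A' r + dg (16 * K) D r * u := fun r => by
      rw [dg_add (fun r => ?_), hDu]
      rw [hDu, hpow]
      refine lt_of_dg (by rw [← hpow]; exact dg_lt _ _ _)
        (mul_lt_of_dg (lt_pow_of_dg (by norm_num) huK) fun i => ?_) fun i => ?_
      · calc _ ≤ 7 * 7 := Nat.mul_le_mul (hD7 r) (hu7 i)
          _ < _ := by norm_num
      · have := hb' r i; omega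
    have hent : ∀ r i, dg 16 (dg (16 * K) (A' + D * u) r) i =
        dg 16 (dg (16 * K) A (r + 1)) i + dg (16 * K) D r * dg 16 u i := fun r i => by
      rw [hsum, dg_add (fun i => ?_), hcu, hA']
      have := hb' r i; omega
    have key := ih (m := m) _ h (by omega) (fun r i => by
      have := hb' r i
      rw [hent, ← hcu, ← hA']; omega) hm
    refine linearIndependent_of_eliminate
      (LinearMap.id + (e : ZMod 5) • (LinearMap.proj s).smulRight (row (16 * K) A 0)) ?_ ?_ ?_
    · ext c
      have : (e : ZMod 5) * row (16 * K) A 0 s = -1 := by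
        rw [hrow0]; simp only; rw [← hds, hed']
      simp [← mul_assoc, this]
    · intro h0
      have := congrFun h0 s
      simp only [Fin.val_zero, hrow0, ← hds] at this
      rw [Pi.zero_apply] at this
      rw [this] at hed'
      revert hed'; simp
    · have key' : ∀ v : Fin ss.length → ℕ → ZMod 5,
          v = (fun r : Fin ss.length => row (16 * K) (A' + D * u) r) → LinearIndependent (ZMod 5) v := by
        rintro _ rfl; exact key
      refine key' _ (funext fun r => ?_)
      ext c
      simp only [row, hent]
      push_cast
      rw [hDr _ (by omega)]
      simp [hrow0, row, mul_assoc]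
end Alt

namespace Alt

lemma forceOps_eq {α : Type} (l : List (Bool × ℕ)) (f : List (Bool × ℕ) → α) :
    forceOps l f = f l := by
  induction l generalizing f with
  | nil => rfl
  | cons p l ih =>
    obtain ⟨b, a⟩ := p
    cases b <;> simp [forceOps, force_eq, ih]

lemma forceTerms_eq {α : Type} (l : List (ℕ × Word)) (f : List (ℕ × Word) → α) :
    forceTerms l f = f l := by
  induction l generalizing f with
  | nil => rfl
  | cons p l ih => simp [forceTerms, force_eq, forceOps_eq, ih]

/-- The contribution of a term to a row. -/
def entry (π : ℕ) (p : ℕ × Word) : ℕ :=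
  (p.1 * sgn (lt π p.2.x) (lt π p.2.y) (lt π p.2.z)) <<< (16 * key π p.2.ops 0)

def rowNat (π : ℕ) (T : List (ℕ × Word)) : ℕ := (T.map (entry π)).sum

lemma rowOf_eq {α : Type} (π : ℕ) (f : ℕ → α) (T : List (ℕ × Word)) (r : ℕ) :
    rowOf π f T r = f (r + rowNat π T) := by
  induction T generalizing r with
  | nil => rfl
  | cons p T ih =>
    rw [rowOf, force_eq, ih, rowNat, rowNat, List.map_cons, List.sum_cons, ← add_assoc]
    rfl

/-- The matrix with the given rows. -/
def pack (W : ℕ) : List ℕ → ℕ → ℕ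
  | [], r => r
  | u :: l, r => pack W l (r <<< W + u)

lemma pack_append (W : ℕ) (l l' : List ℕ) (r : ℕ) :
    pack W (l ++ l') r = pack W l' (pack W l r) := by
  induction l generalizing r with
  | nil => rfl
  | cons u l ih => exact ih _

lemma dg_pack {W : ℕ} (l : List ℕ) (hl : ∀ u ∈ l, u < 2 ^ W) (r : ℕ) :
    ∀ i, dg W (pack W l r) i =
      if h : i < l.length then l.reverse[i]'(by simpa) else dg W r (i - l.length) := by
  induction l generalizing r with
  | nil => simp [pack]
  | cons u l ih =>
    intro i
    rw [pack, ih (fun u hu => hl u (.tail _ hu))]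
    have hu := hl u (.head _)
    by_cases h : i < l.length
    · rw [dif_pos h, dif_pos (by rw [List.length_cons]; omega)]
      simp [List.getElem_append_left, h]
    · rw [dif_neg h]
      obtain ⟨j, rfl⟩ := Nat.exists_eq_add_of_le (not_lt.1 h)
      have e : r <<< W + u = u + 2 ^ W * r := by rw [Nat.shiftLeft_eq]; ring
      cases j with
      | zero =>
        rw [dif_pos (by simp)]
        simp [dg_zero, e, Nat.mod_eq_of_lt hu]
      | succ j =>
        rw [dif_neg (by simp), show l.length + (j + 1) - l.length = j + 1 by omega, dg_succ, e,
          Nat.add_mul_div_left _ _ (by positivity), Nat.div_eq_of_lt hu, zero_add]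
        congr 1
        rw [List.length_cons]; omega

lemma rowsOf_eq (W : ℕ) (T : List (ℕ × Word)) (f : ℕ → Bool) (ps : List ℕ) (r : ℕ) :
    rowsOf W T f ps r = f (pack W (ps.map fun π => rowNat π T) r) := by
  induction ps generalizing r with
  | nil => rfl
  | cons p ps ih =>
    rw [rowsOf, rowOf_eq, force_eq, ih, zero_add]
    rfl

/-- All instances of a list of relations. -/
def flat (inst : List (List Term × List ℕ)) : List (List Term × ℕ) :=
  inst.flatMap fun p => p.2.map fun π => (p.1, π)

lemma rows_eq (W : ℕ) (f : ℕ → Bool) (inst : List (List Term × List ℕ)) (r : ℕ) :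
    rows W f inst r =
      f (pack W ((flat inst).map fun p => rowNat p.2 (prep (expand 3 p.1))) r) := by
  induction inst generalizing r with
  | nil => rfl
  | cons p inst ih =>
    rw [rows, forceTerms_eq, rowsOf_eq, ih]
    simp [flat, pack_append, Function.comp_def]

lemma key_lt (π : ℕ) (l : List (Bool × ℕ)) (h : ℕ) : key π l h < 751 := by
  induction l generalizing h with
  | nil => exact Nat.mod_lt _ (by norm_num)
  | cons p l ih => exact ih _

lemma sgn_le (x y z : ℕ) : sgn x y z ≤ 4 := by
  unfold sgn
  cases Nat.ble x y <;> cases Nat.ble y z <;> cases Nat.ble x z <;> simp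

lemma dg_shiftLeft {w c : ℕ} (hc : c < 2 ^ w) (k i : ℕ) :
    dg w (c <<< (w * k)) i = if k = i then c else 0 := by
  rw [Nat.shiftLeft_eq, pow_mul]
  induction k generalizing i with
  | zero =>
    cases i with
    | zero => simp [dg_zero, Nat.mod_eq_of_lt hc]
    | succ i => simp [dg_succ, Nat.div_eq_of_lt hc, dg_of_zero]
  | succ k ih =>
    rw [pow_succ, ← mul_assoc]
    cases i with
    | zero => simp [dg_zero]
    | succ i => rw [dg_succ, Nat.mul_div_cancel _ (by positivity), ih]; simp

lemma dg_rowNat (π : ℕ) (T : List (ℕ × Word)) (hc : ∀ p ∈ T, p.1 ≤ 4) (hT : T.length ≤ 4000) (i : ℕ) :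
    dg 16 (rowNat π T) i = (T.map fun p => if key π p.2.ops 0 = i then
      p.1 * sgn (lt π p.2.x) (lt π p.2.y) (lt π p.2.z) else 0).sum ∧
      dg 16 (rowNat π T) i ≤ 16 * T.length := by
  induction T generalizing i with
  | nil => simp [rowNat, dg_of_zero]
  | cons p T ih =>
    rw [List.length_cons] at hT ⊢
    have ih' := ih (fun p hp => hc p (.tail _ hp)) (by omega)
    have h1 : p.1 * sgn (lt π p.2.x) (lt π p.2.y) (lt π p.2.z) ≤ 4 * 4 :=
      Nat.mul_le_mul (hc p (.head _)) (sgn_le _ _ _)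
    have h2 := dg_shiftLeft (w := 16) (h1.trans_lt (by norm_num)) (key π p.2.ops 0)
    have h3 : ∀ i, dg 16 (entry π p) i ≤ 16 := fun i => by
      rw [entry, h2]; split <;> omega
    have h4 : dg 16 (rowNat π (p :: T)) i = dg 16 (entry π p) i + dg 16 (rowNat π T) i := by
      rw [rowNat, List.map_cons, List.sum_cons]
      refine dg_add (fun i => ?_) i
      have := h3 i
      have := (ih' i).2
      unfold rowNat at this
      omega
    have := h3 i
    have h5 := ih' i
    rw [h4]
    refine ⟨?_, by omega⟩
    rw [List.map_cons, List.sum_cons, h5.1, entry, h2]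

/-- The column vector modulo `5` of an instance of a relation. -/
def colVec (l : List Term) (π : ℕ) : ℕ → ZMod 5 := fun i =>
  ((expand 3 l).map fun t => if key π t.word.ops 0 = i then
    (t.c : ZMod 5) * (sgn (lt π t.word.x) (lt π t.word.y) (lt π t.word.z) : ℕ) else 0).sum

lemma prep_le (l : List Term) : ∀ p ∈ prep l, p.1 ≤ 4 := by
  simp only [prep, List.mem_map]
  rintro _ ⟨t, -, rfl⟩
  have := Int.emod_lt_of_pos t.c (show (0 : ℤ) < 5 by norm_num)
  have := Int.emod_nonneg t.c (show (5 : ℤ) ≠ 0 by norm_num)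
  simp only
  omega

lemma withMasks_spec {K k : ℕ} {W n : ℕ} (hn : K = n + n) (hW : W = 16 * K) {f : Masks → Bool}
    (h : withMasks W n k f = true) : ∃ M, M.Valid K k ∧ f M = true := by
  subst hn hW
  simp only [withMasks, force_eq] at h
  exact ⟨_, ⟨rfl, rfl, rfl, rfl⟩, h⟩

theorem linearIndependent_colVec {k n K W : ℕ} {ss : List ℕ} {inst : List (List Term × List ℕ)}
    (hn : K = n + n) (hW : W = 16 * K) (hK : 751 ≤ K)
    (h : (withMasks W n k fun M => rows W (indep M W ss) inst 0) = true)
    (hss : ss.length = (flat inst).length) (hk : ss.length ≤ k) (hk' : k ≤ 600)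
    (hl : ∀ p ∈ inst, (expand 3 p.1).length ≤ 500) :
    LinearIndependent (ZMod 5) fun i : Fin (flat inst).length =>
      colVec ((flat inst).reverse[i]'(by simp)).1 ((flat inst).reverse[i]'(by simp)).2 := by
  obtain ⟨M, hM, h⟩ := withMasks_spec hn hW h
  subst hW
  rw [rows_eq] at h
  set R := (flat inst).map fun p => rowNat p.2 (prep (expand 3 p.1)) with hR
  have hlen : ∀ p ∈ flat inst, (prep (expand 3 p.1)).length ≤ 500 := by
    simp only [flat, List.mem_flatMap, List.mem_map]
    rintro _ ⟨q, hq, π, -, rfl⟩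
    simpa [prep] using hl q hq
  have hlt : ∀ u ∈ R, u < 2 ^ (16 * K) := by
    simp only [hR, List.mem_map]
    rintro _ ⟨p, hp, rfl⟩
    rw [pow_mul]
    refine lt_pow_of_dg (by norm_num) fun i hi => ?_
    rw [(dg_rowNat _ _ (prep_le _) ((hlen p hp).trans (by norm_num)) i).1]
    refine List.sum_eq_zero fun x hx => ?_
    obtain ⟨q, -, rfl⟩ := List.mem_map.1 hx
    rw [if_neg]
    have := key_lt p.2 q.2.ops 0
    omega
  have hdg := dg_pack R hlt 0
  have hRl : R.length = (flat inst).length := by simp [hR]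
  have hrow : ∀ i (hi : i < (flat inst).length), dg (16 * K) (pack (16 * K) R 0) i =
      rowNat ((flat inst).reverse[i]'(by simpa)).2 (prep (expand 3 ((flat inst).reverse[i]'(by simpa)).1)) := by
    intro i hi
    rw [hdg, dif_pos (by rwa [hRl])]
    simp [hR]
  have key := linearIndependent_of_indep (m := 40000) hM (by omega) ss _ h hk (fun r c => by
    have h1 : dg 16 (dg (16 * K) (pack (16 * K) R 0) r) c ≤ 16 * 500 := by
      by_cases hr : r < (flat inst).length
      · rw [hrow r hr]
        have h0 := hlen _ (List.mem_reverse.1 (List.getElem_mem (l := (flat inst).reverse) (n := r) (by simpa)))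
        exact (dg_rowNat _ _ (prep_le _) (h0.trans (by norm_num)) c).2.trans
          (Nat.mul_le_mul_left _ h0)
      · rw [hdg, dif_neg (by rwa [hRl]), dg_of_zero, dg_of_zero]
        norm_num
    omega) (by norm_num)
  rw [hss] at key
  have hfin : ∀ v : Fin (flat inst).length → ℕ → ZMod 5,
      v = (fun r : Fin (flat inst).length => row (16 * K) (pack (16 * K) R 0) r) →
        LinearIndependent (ZMod 5) v := by
    rintro _ rfl; exact key
  refine hfin _ (funext fun i => funext fun c => ?_)
  have h0 := hlen _ (List.mem_reverse.1 (List.getElem_mem (l := (flat inst).reverse) (n := i) (by simp)))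
  rw [row, hrow i i.2,
    (dg_rowNat _ _ (prep_le _) (h0.trans (by norm_num)) c).1, colVec, prep]
  rw [Nat.cast_list_sum, List.map_map, List.map_map]
  congr 1
  refine List.map_congr_left fun t _ => ?_
  simp only [Function.comp, Fin.getElem_fin]
  split
  · push_cast
    congr 1
    have := Int.emod_nonneg t.c (show (5 : ℤ) ≠ 0 by norm_num)
    have e : ((t.c % 5).toNat : ℤ) = t.c % 5 := Int.toNat_of_nonneg this
    rw [← Int.cast_natCast, e]
    exact (ZMod.intCast_mod t.c 5).symm
  · simp
end Alt

namespace Alt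

/-- Integer vectors independent modulo a prime are rationally independent. -/
lemma linearIndependent_rat_of_zmod {p : ℕ} [Fact p.Prime] {ι κ : Type*} [Fintype ι] (r : ι → κ → ℤ)
    (h : LinearIndependent (ZMod p) fun i k => (r i k : ZMod p)) :
    LinearIndependent ℚ fun i k => (r i k : ℚ) := by
  have hp : (1 : ℤ) < p := by exact_mod_cast (Fact.out : p.Prime).one_lt
  rw [← LinearIndependent.iff_fractionRing ℤ ℚ, Fintype.linearIndependent_iff]
  intro c hc
  have hc' : ∀ k, ∑ i, c i * r i k = 0 := fun k => by
    have := congrFun hc k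
    simp only [Finset.sum_apply, zsmul_eq_mul, Pi.zero_apply, Pi.mul_apply, Pi.intCast_apply] at this
    exact_mod_cast this
  have hdvd : ∀ m : ℕ, ∀ c : ι → ℤ, (∀ k, ∑ i, c i * r i k = 0) → ∀ i, (p : ℤ) ^ m ∣ c i := by
    intro m
    induction m with
    | zero => simp
    | succ m ih =>
      intro c hc i
      have h1 : ∀ i, (p : ℤ) ∣ c i := fun i => by
        rw [← ZMod.intCast_zmod_eq_zero_iff_dvd]
        refine Fintype.linearIndependent_iff.1 h (fun i => (c i : ZMod p)) (funext fun k => ?_) i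
        have := congrArg (Int.cast (R := ZMod p)) (hc k)
        push_cast at this
        simpa using this
      choose d hd using h1
      have h2 := ih d (fun k => by
        have := hc k
        simp only [hd, mul_assoc, ← Finset.mul_sum] at this
        exact (mul_eq_zero.1 this).resolve_left (by omega)) i
      rw [hd, pow_succ']
      exact mul_dvd_mul_left _ h2
  intro i
  by_contra hne
  obtain ⟨m, hm⟩ := pow_unbounded_of_one_lt |c i| hp
  exact (Int.le_of_dvd (abs_pos.2 hne) ((dvd_abs _ _).2 (hdvd m c hc' i))).not_gt hm

section
variable {V : Type*} [AddCommGroup V] [Module ℚ V]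

/-- Independent relations between finitely many vectors bound the dimension of their span. -/
lemma finrank_span_add_le {κ : Type*} (S : Finset κ) (v : κ → V) {k : ℕ} (r : Fin k → S → ℚ)
    (hr : LinearIndependent ℚ r) (h0 : ∀ i, ∑ w : S, r i w • v w = 0) :
    Module.finrank ℚ (Submodule.span ℚ (v '' S)) + k ≤ S.card := by
  have h1 := (Fintype.linearCombination ℚ fun w : S => v w).finrank_range_add_finrank_ker
  have h2 : LinearMap.range (Fintype.linearCombination ℚ fun w : S => v w) =
      Submodule.span ℚ (v '' S) := by
    rw [Fintype.range_linearCombination]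
    congr 1
    ext; simp
  have h3 : k ≤ Module.finrank ℚ (LinearMap.ker (Fintype.linearCombination ℚ fun w : S => v w)) := by
    have h4 : LinearIndependent ℚ fun i : Fin k => (⟨r i, by
        rw [LinearMap.mem_ker, Fintype.linearCombination_apply]; exact h0 i⟩ :
        LinearMap.ker (Fintype.linearCombination ℚ fun w : S => v w)) :=
      LinearIndependent.of_comp (Submodule.subtype _) hr
    simpa using h4.fintype_card_le_finrank
  rw [h2, Module.finrank_fintype_fun_eq_card, Fintype.card_coe] at h1
  omega

variable (μ : V →ₗ[ℚ] V →ₗ[ℚ] V) (g : ℕ → V)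

/-- The value of an operator word in letters. -/
def lopsEv (l : List (Bool × ℕ)) (m : V) : V := l.foldr (fun p m => op μ p.1 (g p.2) m) m

lemma lopsEv_smul (l : List (Bool × ℕ)) (c : ℚ) (m : V) :
    lopsEv μ g l (c • m) = c • lopsEv μ g l m := by
  induction l with
  | nil => rfl
  | cons p l ih => simp only [lopsEv, List.foldr_cons] at *; rw [ih, op_smul]

/-- The associator of the three letters below `n` missing from a list. -/
def compl (n : ℕ) (l : List ℕ) : V :=
  match (List.range n).filter (· ∉ l) with
  | [a, b, c] => asc μ (g a) (g b) (g c)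
  | _ => 0

/-- The value of an operator word applied to the associator of the missing letters. -/
def wordEv (n : ℕ) (l : List (Bool × ℕ)) : V := lopsEv μ g l (compl μ g n (l.map Prod.snd))

def isgn (x y z : ℕ) : ℤ := if sgn x y z = 1 then 1 else -1

lemma isgn_cast (x y z : ℕ) : (isgn x y z : ZMod 5) = (sgn x y z : ℕ) := by
  unfold isgn sgn
  cases Nat.ble x y <;> cases Nat.ble y z <;> cases Nat.ble x z <;> simp <;> rfl

variable {μ}

lemma compl_eq {n a b c : ℕ} {l : List ℕ} (hab : a < b) (hbc : b < c)
    (hl : (l ++ [a, b, c]).Perm (List.range n)) : compl μ g n l = asc μ (g a) (g b) (g c) := by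
  have hnd : (l ++ [a, b, c]).Nodup := hl.nodup_iff.2 List.nodup_range
  have : (List.range n).filter (· ∉ l) = [a, b, c] := by
    refine List.Perm.eq_of_pairwise (le := (· < ·)) (fun a b _ _ h h' => absurd h h'.asymm)
      (List.Pairwise.filter _ List.pairwise_lt_range) (by simp; omega) ?_
    rw [List.perm_ext_iff_of_nodup (List.nodup_range.filter _) (List.nodup_append.1 hnd).2.1]
    intro i
    rw [List.mem_filter, ← hl.mem_iff, List.mem_append, decide_eq_true_iff]
    have := fun h : i ∈ l => fun h' : i ∈ [a, b, c] => (List.nodup_append.1 hnd).2.2 i h i h' rfl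
    tauto
  rw [compl, this]

lemma wordEv_eq (h : IsAlternative μ) {n x y z : ℕ} {l : List (Bool × ℕ)}
    (hl : (l.map Prod.snd ++ [x, y, z]).Perm (List.range n)) :
    lopsEv μ g l (asc μ (g x) (g y) (g z)) = (isgn x y z : ℚ) • wordEv μ g n l := by
  suffices e : asc μ (g x) (g y) (g z) = (isgn x y z : ℚ) • compl μ g n (l.map Prod.snd) by
    rw [e, lopsEv_smul]; rfl
  have hnd := (List.nodup_append.1 (hl.nodup_iff.2 List.nodup_range)).2.1
  simp only [List.nodup_cons, List.mem_cons, not_or, List.not_mem_nil, not_false_eq_true, and_true,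
    List.nodup_nil] at hnd
  obtain ⟨⟨hxy, hxz⟩, hyz⟩ := hnd
  obtain ⟨h1, h2, h3, h4, h5⟩ := h.perms (g x) (g y) (g z)
  have P : ∀ a b c, [x, y, z].Perm [a, b, c] →
      (l.map Prod.snd ++ [a, b, c]).Perm (List.range n) := fun a b c hp =>
    (List.Perm.append_left _ hp).symm.trans hl
  have key : ∀ b : ℕ, b = 0 ∨ 0 < b := Nat.eq_zero_or_pos
  have hb : ∀ a b : ℕ, Nat.ble a b = decide (a ≤ b) := fun a b => by
    rw [Bool.eq_iff_iff, Nat.ble_eq, decide_eq_true_iff]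
  have pa : [x, y, z].Perm [y, x, z] := .swap ..
  have pb : [x, y, z].Perm [x, z, y] := .cons _ (.swap ..)
  unfold isgn sgn
  simp only [hb]
  rcases lt_or_gt_of_ne hxy with hxy | hxy <;> rcases lt_or_gt_of_ne hyz with hyz | hyz
  · rw [compl_eq g hxy hyz hl]; simp [hxy.le, hyz.le]
  · rcases lt_or_gt_of_ne hxz with hxz | hxz
    · rw [compl_eq g hxz hyz (P _ _ _ pb), h2]; simp [hxy.le, hyz.not_ge, hxz.le]
    · rw [compl_eq g hxz hxy (P _ _ _ (pb.trans (.swap ..))), h5]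
      simp [hxy.le, hyz.not_ge, hxz.not_ge]
  · rcases lt_or_gt_of_ne hxz with hxz | hxz
    · rw [compl_eq g hxy hxz (P _ _ _ pa), h1]; simp [hxy.not_ge, hyz.le, hxz.le]
    · rw [compl_eq g hyz hxz (P _ _ _ (pa.trans (.cons _ (.swap ..)))), h4]
      simp [hxy.not_ge, hyz.le, hxz.not_ge]
  · rw [compl_eq g hyz hxy (P _ _ _ (pa.trans ((List.Perm.cons _ (.swap ..)).trans (.swap ..)))), h3]
    simp [hxy.not_ge, hyz.not_ge]

end
end Alt

namespace Alt

/-- Operator words of a given length in distinct letters. -/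
def opWords : ℕ → Finset ℕ → Finset (List (Bool × ℕ))
  | 0, _ => {[]}
  | m + 1, s => s.biUnion fun a => Finset.univ.biUnion fun k : Bool =>
      (opWords m (s.erase a)).image ((k, a) :: ·)

lemma card_opWords_le (m : ℕ) (s : Finset ℕ) :
    (opWords m s).card ≤ 2 ^ m * s.card.descFactorial m := by
  induction m generalizing s with
  | zero => simp [opWords]
  | succ m ih =>
    have key : ∀ a ∈ s, (Finset.univ.biUnion fun k : Bool =>
        (opWords m (s.erase a)).image ((k, a) :: ·)).card ≤
          2 * (2 ^ m * (s.card - 1).descFactorial m) := fun a ha => by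
      refine (Finset.card_biUnion_le_card_mul _ _ _ fun k _ => Finset.card_image_le.trans
        ((ih _).trans_eq ?_)).trans_eq (by rw [Finset.card_univ, Fintype.card_bool])
      rw [Finset.card_erase_of_mem ha]
    refine (Finset.card_biUnion_le_card_mul _ _ _ key).trans_eq ?_
    cases s.card with
    | zero => simp
    | succ c => rw [Nat.succ_descFactorial_succ, Nat.add_sub_cancel]; ring

lemma mem_opWords {l : List (Bool × ℕ)} {s : Finset ℕ} (hl : (l.map Prod.snd).Nodup)
    (hs : ∀ a ∈ l.map Prod.snd, a ∈ s) : l ∈ opWords l.length s := by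
  induction l generalizing s with
  | nil => simp [opWords]
  | cons p l ih =>
    obtain ⟨k, a⟩ := p
    simp only [List.map_cons, List.nodup_cons] at hl
    simp only [List.length_cons, opWords, Finset.mem_biUnion, Finset.mem_univ, true_and,
      Finset.mem_image]
    refine ⟨a, hs _ (by simp), k, l, ih hl.2 fun b hb => Finset.mem_erase.2 ⟨?_, hs _ (by simp at hb ⊢; tauto)⟩, rfl⟩
    rintro rfl
    exact hl.1 hb

/-- Rename the letters of an operator word. -/
def renOps (π : ℕ) (l : List (Bool × ℕ)) : List (Bool × ℕ) := l.map fun p => (p.1, lt π p.2)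

def Tr.isLeaf : Tr → Bool
  | .leaf _ => true
  | _ => false

def Term.letters (t : Term) : List ℕ := t.word.ops.map Prod.snd ++ [t.word.x, t.word.y, t.word.z]

/-- The term is a word in the letters below `n`. -/
def Term.ok (n : ℕ) (t : Term) : Bool :=
  t.ops.all (fun p => p.2.isLeaf) && t.x.isLeaf && t.y.isLeaf && t.z.isLeaf &&
    decide (t.letters.Perm (List.range n))

/-- The expansions consist of words, and the renamings are permutations. -/
def instOk (n : ℕ) (inst : List (List Term × List ℕ)) : Bool :=
  inst.all fun p => (expand 3 p.1).all (Term.ok n) && (decide ((expand 3 p.1).length ≤ 500) &&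
    p.2.all fun π => decide (((List.range n).map (lt π)).Perm (List.range n)))

/-- The coefficient of an operator word in an instance of a relation. -/
def coef (l : List Term) (π : ℕ) (w : List (Bool × ℕ)) : ℤ :=
  ((expand 3 l).map fun t => if renOps π t.word.ops = w then
    t.c * isgn (lt π t.word.x) (lt π t.word.y) (lt π t.word.z) else 0).sum

/-- The column of an operator word. -/
def column : List (Bool × ℕ) → ℕ → ℕ
  | [], h => h % 751
  | (k, a) :: l, h => column l (h * 12 + (2 * a + cond k 1 0))

lemma column_renOps (π : ℕ) (l : List (Bool × ℕ)) (h : ℕ) : column (renOps π l) h = key π l h := by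
  induction l generalizing h with
  | nil => rfl
  | cons p l ih => exact ih _

section
variable {V : Type*} [AddCommGroup V] [Module ℚ V] {μ : V →ₗ[ℚ] V →ₗ[ℚ] V} {g : ℕ → V}

lemma Tr.ev_of_isLeaf {t : Tr} (h : t.isLeaf = true) : t.ev μ g = g t.toNat := by
  cases t with
  | leaf i => rfl
  | nd => cases h

lemma Term.ev_of_ok (h : IsAlternative μ) {n π : ℕ} {t : Term} (ht : t.ok n = true)
    (hπ : ((List.range n).map (lt π)).Perm (List.range n)) :
    t.ev μ (fun i => g (lt π i)) = ((t.c * isgn (lt π t.word.x) (lt π t.word.y) (lt π t.word.z) : ℤ) : ℚ) •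
      wordEv μ g n (renOps π t.word.ops) := by
  simp only [Term.ok, Bool.and_eq_true, List.all_eq_true, decide_eq_true_eq] at ht
  obtain ⟨⟨⟨⟨ho, hx⟩, hy⟩, hz⟩, hp⟩ := ht
  have h1 : ∀ (l : List (Bool × Tr)) (m : V), (∀ p ∈ l, p.2.isLeaf = true) →
      opsEv μ (fun i => g (lt π i)) l m = lopsEv μ g (renOps π (l.map fun p => (p.1, p.2.toNat))) m := by
    intro l m hl
    induction l with
    | nil => rfl
    | cons p l ih =>
      rw [opsEv_cons, ih fun p hp => hl p (.tail _ hp), Tr.ev_of_isLeaf (hl p (.head _))]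
      rfl
  have h2 : ((renOps π t.word.ops).map Prod.snd ++ [lt π t.word.x, lt π t.word.y, lt π t.word.z]).Perm
      (List.range n) := by
    refine List.Perm.trans ?_ ((hp.map (lt π)).trans hπ)
    simp [Term.letters, renOps, Function.comp_def]
  rw [Term.ev, Tr.ev_of_isLeaf hx, Tr.ev_of_isLeaf hy, Tr.ev_of_isLeaf hz, h1 _ _ ho]
  have := wordEv_eq g h h2
  simp only [Term.word] at this ⊢
  rw [this, ← Int.cast_smul_eq_zsmul ℚ, smul_smul]
  push_cast
  rfl

/-- The relation holds under all substitutions of the letters. -/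
def Holds (μ : V →ₗ[ℚ] V →ₗ[ℚ] V) (l : List Term) : Prop :=
  ∀ g : ℕ → V, (l.map (Term.ev μ g)).sum = 0

lemma length_ops {n : ℕ} {t : Term} (ht : t.ok n = true) : t.word.ops.length = n - 3 := by
  simp only [Term.ok, Bool.and_eq_true, decide_eq_true_eq] at ht
  have := ht.2.length_eq
  simp [Term.letters] at this
  omega

lemma renOps_mem {n π : ℕ} {t : Term} (ht : t.ok n = true)
    (hπ : ((List.range n).map (lt π)).Perm (List.range n)) :
    renOps π t.word.ops ∈ opWords (n - 3) (Finset.range n) := by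
  have hlen := length_ops ht
  simp only [Term.ok, Bool.and_eq_true, decide_eq_true_eq] at ht
  have hp := (ht.2.map (lt π)).trans hπ
  have h2 : (renOps π t.word.ops).map Prod.snd = (t.word.ops.map Prod.snd).map (lt π) := by
    simp [renOps, Function.comp_def]
  rw [Term.letters, List.map_append] at hp
  rw [← hlen, ← List.length_map (as := t.word.ops) (f := fun p => (p.1, lt π p.2))]
  apply mem_opWords
  · rw [← renOps, h2]
    exact (List.nodup_append.1 (hp.nodup_iff.2 List.nodup_range)).1
  · intro a ha
    rw [← renOps, h2] at ha
    rw [Finset.mem_range, ← List.mem_range, ← hp.mem_iff]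
    exact List.mem_append_left _ ha

lemma sum_ite_list {R ι κ : Type*} [AddCommMonoid R] [DecidableEq κ] (S : Finset κ) (l : List ι)
    (f : ι → κ → R) (k : ι → κ) (hk : ∀ i ∈ l, k i ∈ S) :
    ∑ w : S, (l.map fun i => if k i = w then f i w else 0).sum = (l.map fun i => f i (k i)).sum := by
  induction l with
  | nil => simp
  | cons i l ih =>
    simp only [List.map_cons, List.sum_cons, Finset.sum_add_distrib]
    rw [ih fun i hi => hk i (.tail _ hi)]
    congr 1
    rw [Finset.sum_eq_single ⟨k i, hk i (.head _)⟩] <;> simp +contextual [Subtype.ext_iff, eq_comm]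

lemma sum_coef_smul (h : IsAlternative μ) {n π : ℕ} {l : List Term} (hl : (expand 3 l).all (Term.ok n) = true)
    (hπ : ((List.range n).map (lt π)).Perm (List.range n)) (h0 : Holds μ l) :
    ∑ w : opWords (n - 3) (Finset.range n), (coef l π w : ℚ) • wordEv μ g n w = 0 := by
  rw [List.all_eq_true] at hl
  have h1 := expand_ev (g := fun i => g (lt π i)) h 3 l
  rw [h0, smul_zero] at h1
  rw [← h1]
  have h2 := sum_ite_list (opWords (n - 3) (Finset.range n)) (expand 3 l)
    (fun t w => ((t.c * isgn (lt π t.word.x) (lt π t.word.y) (lt π t.word.z) : ℤ) : ℚ) • wordEv μ g n w)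
    (fun t => renOps π t.word.ops) (fun t ht => renOps_mem (hl t ht) hπ)
  rw [List.map_congr_left fun t ht => Term.ev_of_ok h (hl t ht) hπ, ← h2]
  refine Finset.sum_congr rfl fun w _ => ?_
  rw [coef, Int.cast_list_sum, List.sum_smul, List.map_map, List.map_map]
  congr 1
  refine List.map_congr_left fun t _ => ?_
  simp only [Function.comp]
  split <;> simp

lemma sum_coef_column {n π : ℕ} {l : List Term} (hl : (expand 3 l).all (Term.ok n) = true)
    (hπ : ((List.range n).map (lt π)).Perm (List.range n)) (c : ℕ) :
    ∑ w : opWords (n - 3) (Finset.range n), (if column w 0 = c then (coef l π w : ZMod 5) else 0) =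
      colVec l π c := by
  rw [List.all_eq_true] at hl
  have h2 := sum_ite_list (opWords (n - 3) (Finset.range n)) (expand 3 l)
    (fun t w => if column w 0 = c then
      ((t.c * isgn (lt π t.word.x) (lt π t.word.y) (lt π t.word.z) : ℤ) : ZMod 5) else 0)
    (fun t => renOps π t.word.ops) (fun t ht => renOps_mem (hl t ht) hπ)
  simp only [column_renOps] at h2
  rw [colVec]
  simp only [← isgn_cast, ← Int.cast_mul]
  rw [← h2]
  refine Finset.sum_congr rfl fun w _ => ?_
  split
  · rw [coef, Int.cast_list_sum, List.map_map]
    congr 1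
    refine List.map_congr_left fun t _ => ?_
    simp only [Function.comp]
    split <;> simp
  · symm
    refine List.sum_eq_zero fun x hx => ?_
    obtain ⟨t, -, rfl⟩ := List.mem_map.1 hx
    simp

/-- Independent instances of relations bound the dimension of the span of the words. -/
theorem finrank_wordEv_add_le (h : IsAlternative μ) {n k m K W : ℕ} {ss : List ℕ}
    {inst : List (List Term × List ℕ)} (hm : K = m + m) (hW : W = 16 * K) (hK : 751 ≤ K)
    (hc : (withMasks W m k fun M => rows W (indep M W ss) inst 0) = true)
    (hss : ss.length = (flat inst).length) (hk : ss.length = k) (hk' : k ≤ 600)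
    (hok : instOk n inst = true) (h0 : ∀ p ∈ inst, Holds μ p.1) :
    Module.finrank ℚ (Submodule.span ℚ
      (wordEv μ g n '' (opWords (n - 3) (Finset.range n) : Set (List (Bool × ℕ))))) + k ≤
      2 ^ (n - 3) * n.descFactorial (n - 3) := by
  have : Fact (Nat.Prime 5) := ⟨by norm_num⟩
  simp only [instOk, Bool.and_eq_true, List.all_eq_true (l := inst), decide_eq_true_eq] at hok
  have hflat : ∀ p ∈ flat inst, (expand 3 p.1).all (Term.ok n) = true ∧ Holds μ p.1 ∧
      ((List.range n).map (lt p.2)).Perm (List.range n) := by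
    simp only [flat, List.mem_flatMap, List.mem_map]
    rintro _ ⟨q, hq, π, hπ, rfl⟩
    have := hok q hq
    refine ⟨this.1, h0 q hq, ?_⟩
    have := List.all_eq_true.1 this.2.2 π hπ
    simpa using this
  have hli := linearIndependent_colVec hm hW hK hc hss hk.le hk' fun p hp => (hok p hp).2.1
  set R := (flat inst).reverse with hR
  have hRm : ∀ i : Fin (flat inst).length, R[i]'(by simp [hR]) ∈ flat inst := fun i =>
    List.mem_reverse.1 (List.getElem_mem _)
  have hlin : LinearIndependent ℚ fun (i : Fin (flat inst).length)
      (w : opWords (n - 3) (Finset.range n)) =>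
        ((coef (R[i]'(by simp [hR])).1 (R[i]'(by simp [hR])).2 w : ℤ) : ℚ) := by
    refine linearIndependent_rat_of_zmod (p := 5) _ ?_
    refine LinearIndependent.of_comp (LinearMap.pi fun c : ℕ =>
      ∑ w : opWords (n - 3) (Finset.range n), if column w 0 = c then LinearMap.proj w else 0) ?_
    refine (?_ : ∀ v w : Fin (flat inst).length → ℕ → ZMod 5, v = w → LinearIndependent (ZMod 5) v →
      LinearIndependent (ZMod 5) w) _ _ ?_ hli
    · rintro v _ rfl h; exact h
    · funext i c
      have := hflat _ (hRm i)
      rw [← sum_coef_column this.1 this.2.2]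
      simp only [Function.comp, LinearMap.pi_apply, LinearMap.sum_apply]
      refine Finset.sum_congr rfl fun w _ => ?_
      split <;> simp
  have := finrank_span_add_le _ (wordEv μ g n) _ hlin fun i =>
    sum_coef_smul h (hflat _ (hRm i)).1 (hflat _ (hRm i)).2.2 (hflat _ (hRm i)).2.1
  have h3 := card_opWords_le (n - 3) (Finset.range n)
  rw [Finset.card_range] at h3
  omega
end
end Alt

namespace Alt
section
variable {V : Type*} [AddCommGroup V] [Module ℚ V] {μ : V →ₗ[ℚ] V →ₗ[ℚ] V}

lemma holds_sw (h : IsAlternative μ) (ops : List (Bool × Tr)) (u v w : Tr) : Holds μ (sw ops u v w) := fun g => by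
  simp only [sw, List.map_cons, List.map_nil, List.sum_cons, List.sum_nil, Term.ev, one_smul, add_zero]
  rw [← opsEv_add, h.left]
  simpa using opsEv_smul (μ := μ) (g := g) ops 0 0

lemma IsAlternative.jacobian (h : IsAlternative μ) (a b c : V) :
    op μ false (op μ false a b) c + op μ false (op μ false b c) a + op μ false (op μ false c a) b =
      (6 : ℚ) • asc μ a b c := by
  obtain ⟨h1, h2, h3, h4, h5⟩ := h.perms a b c
  simp only [asc] at *
  simp only [op, Bool.false_eq_true, if_false, map_sub, LinearMap.sub_apply]
  linear_combination (norm := module) (-1 : ℚ) • h1 - h2 - h3 + h4 + h5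

lemma op_add_left (k : Bool) (a a' m : V) : op μ k (a + a') m = op μ k a m + op μ k a' m := by
  cases k <;> simp [op] <;> abel

lemma op_comm (k : Bool) (a m : V) : op μ k a m = cond k 1 (-1) • op μ k m a := by
  cases k <;> simp [op, add_comm]

lemma holds_jb (l : List (Bool × Tr)) (u v : Tr) (r : List (Bool × Tr)) (x y z : Tr) :
    Holds μ (jb l u v r x y z) := fun g => by
  simp only [jb, List.map_cons, List.map_nil, List.sum_cons, List.sum_nil, Term.ev, one_smul, add_zero,
    opsEv_append, opsEv_cons]
  rw [← opsEv_add, ← op_add_left]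
  have : (Tr.nd false u v).ev μ g + (Tr.nd false v u).ev μ g = 0 := by
    simp [Tr.ev, op]
  rw [this]
  simpa [op] using opsEv_smul (μ := μ) (g := g) l 0 0

lemma sum_jac (h : IsAlternative μ) (k : Bool) (a b c x y z : Tr) (e : ℤ) (g : ℕ → V) :
    ((jac k a b c x y z e).map (Term.ev μ g)).sum = e • (6 : ℚ) •
      op μ k (asc μ (a.ev μ g) (b.ev μ g) (c.ev μ g)) (asc μ (x.ev μ g) (y.ev μ g) (z.ev μ g)) := by
  have hs : ∀ (c : ℚ) (a m : V), op μ k (c • a) m = c • op μ k a m := fun c a m => by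
    rw [op_comm, op_smul, op_comm k a, smul_comm]
  rw [← hs, ← h.jacobian]
  simp [jac, Term.ev, Tr.ev, opsEv, op_add_left, add_assoc]

lemma holds_jac (h : IsAlternative μ) (k : Bool) (a b c x y z : Tr) :
    Holds μ (jac k a b c x y z 1 ++ jac k x y z a b c (cond k (-1) 1)) := fun g => by
  rw [List.map_append, List.sum_append, sum_jac h, sum_jac h, op_comm k (asc μ (x.ev μ g) _ _)]
  cases k <;> simp

theorem instances₅_holds (h : IsAlternative μ) : ∀ p ∈ instances₅, Holds μ p.1 := by
  simp only [instances₅, List.forall_mem_cons, List.not_mem_nil, false_imp_iff, implies_true, and_true,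
    holds_sw h, holds_jb]

theorem instances₆_holds (h : IsAlternative μ) : ∀ p ∈ instances₆, Holds μ p.1 := by
  simp only [instances₆, List.forall_mem_cons, List.not_mem_nil, false_imp_iff, implies_true, and_true,
    holds_sw h, holds_jb]
  exact ⟨holds_jac h true x0 x1 x2 x3 x4 x5, holds_jac h false x0 x1 x2 x3 x4 x5⟩

lemma finrank_words_le (h : IsAlternative μ) (g : ℕ → V) (n : ℕ) {k m K W : ℕ} {ss : List ℕ}
    {inst : List (List Term × List ℕ)} (hm : K = m + m) (hW : W = 16 * K) (hK : 751 ≤ K)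
    (hc : (withMasks W m k fun M => rows W (indep M W ss) inst 0) = true)
    (hss : ss.length = (flat inst).length) (hk : ss.length = k) (hk' : k ≤ 600)
    (hok : instOk n inst = true) (h0 : ∀ p ∈ inst, Holds μ p.1) :
    Module.finrank ℚ (Submodule.span ℚ
      (wordEv μ g n '' (opWords (n - 3) (Finset.range n) : Set (List (Bool × ℕ))))) ≤
      2 ^ (n - 3) * n.descFactorial (n - 3) - k :=
  Nat.le_sub_of_add_le (finrank_wordEv_add_le h hm hW hK hc hss hk hk' hok h0)

theorem indep₅ :
    (withMasks 12032 376 25 fun M => rows 12032 (indep M 12032 pivots₅) instances₅ 0) = true := by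
  decide +kernel

theorem indep₆ :
    (withMasks 12032 376 600 fun M => rows 12032 (indep M 12032 pivots₆) instances₆ 0) = true := by
  decide +kernel

end
end Alt

namespace Alt
section
lemma length_pivots₆ : pivots₆.length = 600 := by decide +kernel

lemma instOk₆ : instOk 6 instances₆ = true := by decide +kernel

variable {V : Type*} [AddCommGroup V] [Module ℚ V] {μ : V →ₗ[ℚ] V →ₗ[ℚ] V}

theorem finrank_words₅ (h : IsAlternative μ) (g : ℕ → V) : Module.finrank ℚ (Submodule.span ℚ
    (wordEv μ g 5 '' (opWords 2 (Finset.range 5) : Set (List (Bool × ℕ))))) ≤ 55 :=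
  finrank_words_le h g 5 (k := 25) (ss := pivots₅) (m := 376) (K := 752) (W := 12032) rfl rfl (by norm_num) indep₅ (by decide +kernel)
    rfl (by norm_num) (by decide +kernel) (instances₅_holds h)

theorem finrank_words₆ (h : IsAlternative μ) (g : ℕ → V) : Module.finrank ℚ (Submodule.span ℚ
    (wordEv μ g 6 '' (opWords 3 (Finset.range 6) : Set (List (Bool × ℕ))))) ≤ 360 :=
  finrank_words_le h g 6 (k := 600) (ss := pivots₆) (m := 376) (K := 752) (W := 12032) rfl rfl (by norm_num) indep₆ (by decide +kernel)
    length_pivots₆ (by norm_num) instOk₆ (instances₆_holds h)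
end
end Alt

namespace Alt
variable {V : Type*} [AddCommGroup V] [Module ℚ V] (μ : V →ₗ[ℚ] V →ₗ[ℚ] V) (g : ℕ → V)

/-- The value of a nonassociative monomial. -/
def mev : FreeMagma ℕ → V
  | .of a => g a
  | .mul a b => μ (mev a) (mev b)

/-- Operator words applied to associators of letters, with their multiset of letters. -/
inductive IsD : Multiset ℕ → V → Prop
  | asc (a b c : ℕ) : IsD {a, b, c} (asc μ (g a) (g b) (g c))
  | op (k : Bool) (a : ℕ) {s : Multiset ℕ} {m : V} : IsD s m → IsD (a ::ₘ s) (op μ k (g a) m)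

/-- Right-normed products of letters, with their multiset of letters. -/
inductive IsW : Multiset ℕ → V → Prop
  | of (a : ℕ) : IsW {a} (g a)
  | mul (a : ℕ) {s : Multiset ℕ} {m : V} : IsW s m → IsW (a ::ₘ s) (μ (g a) m)

def spanD (s : Multiset ℕ) : Submodule ℚ V := Submodule.span ℚ {m | IsD μ g s m}

def spanW (s : Multiset ℕ) : Submodule ℚ V := Submodule.span ℚ {m | IsW μ g s m}

variable {μ g}

lemma map_span_le_of {S : Set V} {T : Submodule ℚ V} (f : V →ₗ[ℚ] V) (hf : ∀ m ∈ S, f m ∈ T) {m : V}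
    (hm : m ∈ Submodule.span ℚ S) : f m ∈ T :=
  (Submodule.span_le (p := T.comap f)).2 hf hm

lemma IsW.exists_mev {s : Multiset ℕ} {m : V} (hm : IsW μ g s m) :
    ∃ t : FreeMagma ℕ, t.vars = s ∧ mev μ g t = m := by
  induction hm with
  | of a => exact ⟨.of a, rfl, rfl⟩
  | mul a _ ih =>
    obtain ⟨t, rfl, rfl⟩ := ih
    exact ⟨.mul (.of a) t, by simp [FreeMagma.vars], rfl⟩

lemma mul_mem_spanD (h : IsAlternative μ) (t : FreeMagma ℕ) : ∀ {s : Multiset ℕ} {m : V}, m ∈ spanD μ g s →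
    μ (mev μ g t) m ∈ spanD μ g (t.vars + s) ∧ μ m (mev μ g t) ∈ spanD μ g (t.vars + s) := by
  induction t with
  | ih1 a =>
    intro s m hm
    have key : ∀ k, ∀ m, IsD μ g s m → op μ k (g a) m ∈ spanD μ g ({a} + s) := fun k m hm =>
      Submodule.subset_span (by rw [Multiset.singleton_add]; exact hm.op k a)
    constructor
    · refine map_span_le_of (μ (g a)) (fun m hm => ?_) hm
      rw [mul_eq_op]
      exact Submodule.smul_mem _ _ (add_mem (key _ _ hm) (key _ _ hm))
    · refine map_span_le_of (μ.flip (g a)) (fun m hm => ?_) hm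
      rw [LinearMap.flip_apply, mul_eq_op']
      exact Submodule.smul_mem _ _ (sub_mem (key _ _ hm) (key _ _ hm))
  | ih2 a b iha ihb =>
    intro s m hm
    have e : (FreeMagma.mul a b).vars + s = a.vars + (b.vars + s) := by
      rw [FreeMagma.vars, add_assoc]
    have e' : (FreeMagma.mul a b).vars + s = b.vars + (a.vars + s) := by
      rw [FreeMagma.vars, add_assoc, add_left_comm]
    have hA : asc μ (mev μ g a) (mev μ g b) m ∈ spanD μ g ((FreeMagma.mul a b).vars + s) := by
      rw [h.swap₂₃, asc, neg_sub]
      refine sub_mem ?_ ?_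
      · rw [e]; exact (iha (ihb hm).2).1
      · rw [e']; exact (ihb (iha hm).1).2
    constructor
    · have : μ (mev μ g (.mul a b)) m = μ (mev μ g a) (μ (mev μ g b) m) +
          asc μ (mev μ g a) (mev μ g b) m := by rw [asc, mev]; abel
      change μ (mev μ g (.mul a b)) m ∈ spanD μ g ((FreeMagma.mul a b).vars + s)
      rw [this]
      refine add_mem ?_ hA
      rw [e]; exact (iha (ihb hm).1).1
    · have : μ m (mev μ g (.mul a b)) = μ (μ m (mev μ g a)) (mev μ g b) -
          asc μ (mev μ g a) (mev μ g b) m := by rw [← h.rotate, asc, mev]; abel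
      change μ m (mev μ g (.mul a b)) ∈ spanD μ g ((FreeMagma.mul a b).vars + s)
      rw [this]
      refine sub_mem ?_ hA
      rw [e']; exact (ihb (iha hm).2).2

lemma op_mem_spanD (h : IsAlternative μ) (k : Bool) (t : FreeMagma ℕ) {s : Multiset ℕ} {m : V} (hm : m ∈ spanD μ g s) :
    op μ k (mev μ g t) m ∈ spanD μ g (t.vars + s) := by
  have := mul_mem_spanD h t hm
  cases k
  · exact sub_mem this.1 this.2
  · exact add_mem this.1 this.2

lemma asc_mul_mem (h : IsAlternative μ) {a b y z : FreeMagma ℕ}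
    (ih : ∀ t u v : FreeMagma ℕ, t.length + u.length + v.length < a.length + b.length + y.length + z.length →
      asc μ (mev μ g t) (mev μ g u) (mev μ g v) ∈ spanD μ g (t.vars + u.vars + v.vars)) :
    asc μ (mev μ g (.mul a b)) (mev μ g y) (mev μ g z) ∈
      spanD μ g (a.vars + b.vars + y.vars + z.vars) := by
  have h1 := h.asc_dot (mev μ g a) (mev μ g b) (mev μ g y) (mev μ g z)
  have h2 := h.asc_brk (mev μ g a) (mev μ g b) (mev μ g y) (mev μ g z)
  have pa := a.length_pos
  have pb := b.length_pos
  have py := y.length_pos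
  have pz := z.length_pos
  have h3 : asc μ (mev μ g (.mul a b)) (mev μ g y) (mev μ g z) = (1 / 12 : ℚ) •
      ((6 : ℚ) • asc μ (μ (mev μ g a) (mev μ g b) + μ (mev μ g b) (mev μ g a)) (mev μ g y) (mev μ g z)
      + (6 : ℚ) • asc μ (μ (mev μ g a) (mev μ g b) - μ (mev μ g b) (mev μ g a)) (mev μ g y) (mev μ g z)) := by
    simp only [asc, mev, map_add, map_sub, LinearMap.add_apply, LinearMap.sub_apply]
    module
  rw [h3, h1, h2]
  have k1 := ih b y z (by omega)
  have k2 := ih a y z (by omega)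
  have k3 := ih a b z (by omega)
  have k4 := ih a b y (by omega)
  have e1 : a.vars + b.vars + y.vars + z.vars = a.vars + (b.vars + y.vars + z.vars) := by abel
  have e2 : a.vars + b.vars + y.vars + z.vars = b.vars + (a.vars + y.vars + z.vars) := by abel
  have e3 : a.vars + b.vars + y.vars + z.vars = y.vars + (a.vars + b.vars + z.vars) := by abel
  have e4 : a.vars + b.vars + y.vars + z.vars = z.vars + (a.vars + b.vars + y.vars) := by abel
  have m1 := fun k => op_mem_spanD h k a k1
  have m2 := fun k => op_mem_spanD h k b k2
  have m3 := fun k => op_mem_spanD h k y k3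
  have m4 := fun k => op_mem_spanD h k z k4
  rw [← e1] at m1
  rw [← e2] at m2
  rw [← e3] at m3
  rw [← e4] at m4
  exact Submodule.smul_mem _ _ (add_mem
    (add_mem (Submodule.smul_mem _ _ (m1 _)) (Submodule.smul_mem _ _ (m2 _)))
    (sub_mem (add_mem (add_mem (Submodule.smul_mem _ _ (m1 _)) (Submodule.smul_mem _ _ (m2 _)))
      (Submodule.smul_mem _ _ (m3 _))) (Submodule.smul_mem _ _ (m4 _))))

lemma asc_mem_spanD (h : IsAlternative μ) (t u v : FreeMagma ℕ) :
    asc μ (mev μ g t) (mev μ g u) (mev μ g v) ∈ spanD μ g (t.vars + u.vars + v.vars) := by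
  induction hN : t.length + u.length + v.length using Nat.strong_induction_on generalizing t u v with
  | _ N ih =>
    have ih' : ∀ t u v : FreeMagma ℕ, t.length + u.length + v.length < N →
        asc μ (mev μ g t) (mev μ g u) (mev μ g v) ∈ spanD μ g (t.vars + u.vars + v.vars) :=
      fun t u v hlt => ih _ hlt t u v rfl
    match t, u, v with
    | .mul a b, y, z =>
      refine asc_mul_mem h fun t u v hlt => ih' t u v ?_
      simp only [FreeMagma.length] at hN; omega
    | y, .mul a b, z =>
      rw [h.swap₁₂]
      have := asc_mul_mem h (a := a) (b := b) (y := y) (z := z) fun t u v hlt => ih' t u v (by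
        simp only [FreeMagma.length] at hN; omega)
      rw [show y.vars + (FreeMagma.mul a b).vars + z.vars = a.vars + b.vars + y.vars + z.vars by
        rw [FreeMagma.vars]; abel]
      exact neg_mem this
    | y, z, .mul a b =>
      rw [← h.rotate]
      have := asc_mul_mem h (a := a) (b := b) (y := y) (z := z) fun t u v hlt => ih' t u v (by
        simp only [FreeMagma.length] at hN; omega)
      rwa [show y.vars + z.vars + (FreeMagma.mul a b).vars = a.vars + b.vars + y.vars + z.vars by
        rw [FreeMagma.vars]; abel]
    | .of a, .of b, .of c =>
      exact Submodule.subset_span (IsD.asc a b c)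

lemma mul_mem_sup (h : IsAlternative μ) (t : FreeMagma ℕ) : ∀ {s : Multiset ℕ} {m : V}, m ∈ spanW μ g s ⊔ spanD μ g s →
    μ (mev μ g t) m ∈ spanW μ g (t.vars + s) ⊔ spanD μ g (t.vars + s) := by
  induction t with
  | ih1 a =>
    intro s m hm
    rw [Submodule.mem_sup] at hm
    obtain ⟨x, hx, y, hy, rfl⟩ := hm
    rw [map_add]
    refine Submodule.add_mem_sup (map_span_le_of (μ (g a)) (fun m hm => ?_) hx)
      (mul_mem_spanD h (.of a) hy).1
    exact Submodule.subset_span (by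
      rw [FreeMagma.vars, Multiset.singleton_add]; exact hm.mul a)
  | ih2 a b iha ihb =>
    intro s m hm
    rw [Submodule.mem_sup] at hm
    obtain ⟨x, hx, y, hy, rfl⟩ := hm
    rw [map_add]
    refine add_mem ?_ (Submodule.mem_sup_right (mul_mem_spanD h (.mul a b) hy).1)
    refine map_span_le_of (μ (mev μ g (.mul a b))) (fun m hm => ?_) hx
    obtain ⟨u, rfl, rfl⟩ := IsW.exists_mev hm
    have : μ (mev μ g (.mul a b)) (mev μ g u) = μ (mev μ g a) (μ (mev μ g b) (mev μ g u)) +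
        asc μ (mev μ g a) (mev μ g b) (mev μ g u) := by rw [asc, mev]; abel
    rw [this]
    have e : (a * b).vars + u.vars = a.vars + (b.vars + u.vars) := add_assoc _ _ _
    refine add_mem ?_ (Submodule.mem_sup_right (asc_mem_spanD h a b u))
    rw [e]
    exact iha (ihb (Submodule.mem_sup_left (Submodule.subset_span hm)))

theorem mev_mem_sup (h : IsAlternative μ) (t : FreeMagma ℕ) : mev μ g t ∈ spanW μ g t.vars ⊔ spanD μ g t.vars := by
  induction t with
  | ih1 a => exact Submodule.mem_sup_left (Submodule.subset_span (IsW.of a))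
  | ih2 a b iha ihb => exact mul_mem_sup h a ihb

lemma IsW.exists_list {s : Multiset ℕ} {m : V} (hm : IsW μ g s m) : ∃ l : List ℕ, l ≠ [] ∧ (l : Multiset ℕ) = s ∧
    l.dropLast.foldr (fun a m => μ (g a) m) (g (l.getLastD 0)) = m := by
  induction hm with
  | of a => exact ⟨[a], by simp, rfl, rfl⟩
  | mul a _ ih =>
    obtain ⟨_ | ⟨b, l⟩, h0, rfl, rfl⟩ := ih
    · exact absurd rfl h0
    · exact ⟨a :: b :: l, by simp, rfl, rfl⟩

lemma finrank_spanW_le (n : ℕ) : Module.Finite ℚ (spanW μ g (Multiset.range n)) ∧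
    Module.finrank ℚ (spanW μ g (Multiset.range n)) ≤ n.factorial := by
  classical
  let F : Finset V := ((List.range n).permutations.map fun l =>
    l.dropLast.foldr (fun a m => μ (g a) m) (g (l.getLastD 0))).toFinset
  have h1 : spanW μ g (Multiset.range n) ≤ Submodule.span ℚ (F : Set V) := by
    refine Submodule.span_mono fun m hm => ?_
    obtain ⟨l, -, hl, rfl⟩ := IsW.exists_list hm
    have : l.Perm (List.range n) := Multiset.coe_eq_coe.1 hl
    exact List.mem_toFinset.2 (List.mem_map.2 ⟨l, List.mem_permutations.2 this, rfl⟩)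
  have : Module.Finite ℚ (Submodule.span ℚ (F : Set V)) := FiniteDimensional.span_finset ℚ F
  refine ⟨Submodule.finiteDimensional_of_le h1, (Submodule.finrank_mono h1).trans ?_⟩
  refine (finrank_span_finset_le_card F).trans ((List.toFinset_card_le _).trans ?_)
  simp [List.length_permutations]

lemma IsD.exists_list {s : Multiset ℕ} {m : V} (hm : IsD μ g s m) : ∃ (l : List (Bool × ℕ)) (x y z : ℕ),
    ((l.map Prod.snd ++ [x, y, z] : List ℕ) : Multiset ℕ) = s ∧
      m = lopsEv μ g l (Alt.asc μ (g x) (g y) (g z)) := by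
  induction hm with
  | asc a b c => exact ⟨[], a, b, c, rfl, rfl⟩
  | op k a _ ih =>
    obtain ⟨l, x, y, z, rfl, rfl⟩ := ih
    exact ⟨(k, a) :: l, x, y, z, rfl, rfl⟩

lemma spanD_le (h : IsAlternative μ) (n : ℕ) : spanD μ g (Multiset.range n) ≤
    Submodule.span ℚ (wordEv μ g n '' (opWords (n - 3) (Finset.range n) : Set (List (Bool × ℕ)))) := by
  refine Submodule.span_le.2 fun m hm => ?_
  obtain ⟨l, x, y, z, hl, rfl⟩ := IsD.exists_list hm
  have hp : (l.map Prod.snd ++ [x, y, z]).Perm (List.range n) := Multiset.coe_eq_coe.1 hl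
  rw [wordEv_eq g h hp]
  refine Submodule.smul_mem _ _ (Submodule.subset_span ⟨l, ?_, rfl⟩)
  have hlen := hp.length_eq
  simp only [List.length_append, List.length_map, List.length_cons, List.length_nil, List.length_range] at hlen
  rw [show n - 3 = l.length by omega]
  refine mem_opWords (List.nodup_append.1 (hp.nodup_iff.2 List.nodup_range)).1 fun a ha => ?_
  rw [Finset.mem_range, ← List.mem_range, ← hp.mem_iff]
  exact List.mem_append_left _ ha

theorem finrank_le (h : IsAlternative μ) {n d : ℕ} (hd : Module.finrank ℚ (Submodule.span ℚ
      (wordEv μ g n '' (opWords (n - 3) (Finset.range n) : Set (List (Bool × ℕ))))) ≤ d)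
    {M : Submodule ℚ V}
    (hM : M ≤ Submodule.span ℚ {m | ∃ t : FreeMagma ℕ, t.vars = Multiset.range n ∧ m = mev μ g t}) :
    Module.Finite ℚ M ∧ Module.finrank ℚ M ≤ n.factorial + d := by
  have h1 : M ≤ spanW μ g (Multiset.range n) ⊔ Submodule.span ℚ
      (wordEv μ g n '' (opWords (n - 3) (Finset.range n) : Set (List (Bool × ℕ)))) := by
    refine hM.trans (Submodule.span_le.2 ?_)
    rintro _ ⟨t, ht, rfl⟩
    have := mev_mem_sup (g := g) h t
    rw [ht] at this
    exact sup_le_sup_left (spanD_le h n) _ this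
  obtain ⟨_, h2⟩ := finrank_spanW_le (μ := μ) (g := g) n
  have : Module.Finite ℚ (Submodule.span ℚ
      (wordEv μ g n '' (opWords (n - 3) (Finset.range n) : Set (List (Bool × ℕ))))) :=
    FiniteDimensional.span_of_finite ℚ ((Finset.finite_toSet _).image _)
  refine ⟨Submodule.finiteDimensional_of_le h1, (Submodule.finrank_mono h1).trans
    ((Submodule.finrank_add_le_finrank_add_finrank _ _).trans (add_le_add h2 hd))⟩
end Alt

namespace Alt
section
variable {n : ℕ} {B : Type*} [AddCommGroup B] [Module ℚ B]

/-- The letters of a nonassociative monomial, from left to right. -/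
def leaves : FreeMagma (Fin n) → List ℕ
  | .of a => [a.val]
  | .mul a b => leaves a ++ leaves b

/-- The value of a nonassociative monomial in the letters `X`. -/
def ev (μ : B →ₗ[ℚ] B →ₗ[ℚ] B) (X : ℕ → B) : FreeMagma (Fin n) → B
  | .of a => X a.val
  | .mul a b => μ (ev μ X a) (ev μ X b)

/-- The evaluation of polynomials in which every monomial is weighted by `ε` of its list of letters,
completed by `u` on the left and by `w` on the right. -/
noncomputable def twist (n : ℕ) (ε : List ℕ → ℚ) (μ : B →ₗ[ℚ] B →ₗ[ℚ] B) (X : ℕ → B) (u w : List ℕ) :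
    FreeNA n →ₗ[ℚ] B :=
  (Finsupp.linearCombination ℚ fun t => ε (u ++ leaves t ++ w) • ev μ X t) ∘ₗ
    (MonoidAlgebra.coeffLinearEquiv ℚ).toLinearMap

/-- The weighted evaluation satisfies the linearized alternative laws on monomials. -/
structure IsTwisted (n : ℕ) (ε : List ℕ → ℚ) (μ : B →ₗ[ℚ] B →ₗ[ℚ] B) (X : ℕ → B) : Prop where
  right : ∀ (u w : List ℕ) (a b c : FreeMagma (Fin n)),
    ε (u ++ (leaves a ++ leaves b ++ leaves c) ++ w) • asc μ (ev μ X a) (ev μ X b) (ev μ X c) +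
    ε (u ++ (leaves a ++ leaves c ++ leaves b) ++ w) • asc μ (ev μ X a) (ev μ X c) (ev μ X b) = 0
  left : ∀ (u w : List ℕ) (a b c : FreeMagma (Fin n)),
    ε (u ++ (leaves a ++ leaves b ++ leaves c) ++ w) • asc μ (ev μ X a) (ev μ X b) (ev μ X c) +
    ε (u ++ (leaves b ++ leaves a ++ leaves c) ++ w) • asc μ (ev μ X b) (ev μ X a) (ev μ X c) = 0

variable {ε : List ℕ → ℚ} {μ : B →ₗ[ℚ] B →ₗ[ℚ] B} {X : ℕ → B}

lemma twist_single (u w : List ℕ) (t : FreeMagma (Fin n)) (r : ℚ) :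
    twist n ε μ X u w (MonoidAlgebra.single t r) = r • ε (u ++ leaves t ++ w) • ev μ X t := by
  simp only [twist, LinearMap.comp_apply, LinearEquiv.coe_coe]
  exact Finsupp.linearCombination_single ℚ _ _

lemma leaves_mul (a b : FreeMagma (Fin n)) : leaves (a * b) = leaves a ++ leaves b := rfl

lemma ev_mul (a b : FreeMagma (Fin n)) : ev μ X (a * b) = μ (ev μ X a) (ev μ X b) := rfl

lemma twist_mul_left (u w : List ℕ) (t : FreeMagma (Fin n)) (r : ℚ) (x : FreeNA n) :
    twist n ε μ X u w (MonoidAlgebra.single t r * x) =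
      r • μ (ev μ X t) (twist n ε μ X (u ++ leaves t) w x) := by
  induction x using MonoidAlgebra.induction_linear with
  | zero => simp
  | add x y hx hy => simp only [mul_add, map_add, hx, hy, smul_add]
  | single s q =>
    simp only [MonoidAlgebra.single_mul_single, twist_single, map_smul, leaves_mul, ev_mul, List.append_assoc]
    module

lemma twist_mul_right (u w : List ℕ) (t : FreeMagma (Fin n)) (r : ℚ) (x : FreeNA n) :
    twist n ε μ X u w (x * MonoidAlgebra.single t r) =
      r • μ (twist n ε μ X u (leaves t ++ w) x) (ev μ X t) := by
  induction x using MonoidAlgebra.induction_linear with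
  | zero => simp
  | add x y hx hy => simp only [add_mul, map_add, hx, hy, smul_add, LinearMap.add_apply]
  | single s q =>
    simp only [MonoidAlgebra.single_mul_single, twist_single, map_smul, leaves_mul, ev_mul,
      List.append_assoc, LinearMap.smul_apply]
    module

lemma eq_zero_of_single {A : Type*} [AddCommGroup A] (E : FreeNA n → FreeNA n → FreeNA n → A)
    (h1 : ∀ x y b c, E (x + y) b c = E x b c + E y b c) (h2 : ∀ x y a c, E a (x + y) c = E a x c + E a y c)
    (h3 : ∀ x y a b, E a b (x + y) = E a b x + E a b y)
    (h : ∀ a b c r s q, E (MonoidAlgebra.single a r) (MonoidAlgebra.single b s) (MonoidAlgebra.single c q) = 0)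
    (a b c : FreeNA n) : E a b c = 0 := by
  induction a using MonoidAlgebra.induction_linear with
  | zero => simpa using h1 0 0 b c
  | add x y hx hy => rw [h1, hx, hy, add_zero]
  | single a r =>
    induction b using MonoidAlgebra.induction_linear with
    | zero => simpa using h2 0 0 (.single a r) c
    | add x y hx hy => rw [h2, hx, hy, add_zero]
    | single b s =>
      induction c using MonoidAlgebra.induction_linear with
      | zero => simpa using h3 0 0 (.single a r) (.single b s)
      | add x y hx hy => rw [h3, hx, hy, add_zero]
      | single c q => exact h a b c r s q

theorem altIdeal_le_ker_twist (h : IsTwisted n ε μ X) (u w : List ℕ) :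
    altIdeal n ≤ LinearMap.ker (twist n ε μ X u w) := by
  suffices altIdeal n ≤ ⨅ u, ⨅ w, LinearMap.ker (twist n ε μ X u w) from
    this.trans ((iInf_le _ u).trans (iInf_le _ w))
  refine sInf_le ⟨?_, fun a x hx => ?_⟩
  · rintro _ (⟨a, b, c, rfl⟩ | ⟨a, b, c, rfl⟩) <;>
      simp only [SetLike.mem_coe, Submodule.mem_iInf, LinearMap.mem_ker] <;> intro u w
    · refine eq_zero_of_single (fun a b c =>
        twist n ε μ X u w ((a * b) * c + (a * c) * b - a * (b * c) - a * (c * b))) ?_ ?_ ?_ ?_ a b c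
      iterate 3
        intro x y a b
        simp only [← map_add, add_mul, mul_add]
        congr 1; abel
      intro a b c r s q
      have := h.right u w a b c
      simp only [asc] at this
      simp only [map_add, map_sub, MonoidAlgebra.single_mul_single, twist_single, leaves_mul, ev_mul,
        List.append_assoc] at this ⊢
      refine Eq.trans ?_ ((congrArg ((r * s * q) • ·) this).trans (smul_zero _))
      module
    · refine eq_zero_of_single (fun a b c =>
        twist n ε μ X u w ((a * b) * c + (b * a) * c - a * (b * c) - b * (a * c))) ?_ ?_ ?_ ?_ a b c
      iterate 3
        intro x y a b
        simp only [← map_add, add_mul, mul_add]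
        congr 1; abel
      intro a b c r s q
      have := h.left u w a b c
      simp only [asc] at this
      simp only [map_add, map_sub, MonoidAlgebra.single_mul_single, twist_single, leaves_mul, ev_mul,
        List.append_assoc] at this ⊢
      refine Eq.trans ?_ ((congrArg ((r * s * q) • ·) this).trans (smul_zero _))
      module
  · simp only [Submodule.mem_iInf, LinearMap.mem_ker] at hx ⊢
    refine ⟨fun u w => ?_, fun u w => ?_⟩
    · induction a using MonoidAlgebra.induction_linear with
      | zero => simp
      | add a b ha hb => rw [add_mul, map_add, ha, hb, add_zero]
      | single t r => rw [twist_mul_left, hx, map_zero, smul_zero]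
    · induction a using MonoidAlgebra.induction_linear with
      | zero => simp
      | add a b ha hb => rw [mul_add, map_add, ha, hb, add_zero]
      | single t r => rw [twist_mul_right, hx, LinearMap.map_zero, LinearMap.zero_apply, smul_zero]

lemma mul_mem_altIdeal (a : FreeNA n) {x : FreeNA n} (hx : x ∈ altIdeal n) :
    a * x ∈ altIdeal n ∧ x * a ∈ altIdeal n := by
  simp only [altIdeal, idealClosure, Submodule.mem_sInf] at hx ⊢
  exact ⟨fun p hp => (hp.2 a x (hx p hp)).1, fun p hp => (hp.2 a x (hx p hp)).2⟩

lemma subset_altIdeal (n : ℕ) : ({w | ∃ a b c : FreeNA n, w = (a*b)*c + (a*c)*b - a*(b*c) - a*(c*b)} ∪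
    {w | ∃ a b c : FreeNA n, w = (a*b)*c + (b*a)*c - a*(b*c) - b*(a*c)}) ⊆ (altIdeal n : Set (FreeNA n)) := by
  intro w hw
  simp only [altIdeal, idealClosure, SetLike.mem_coe, Submodule.mem_sInf]
  exact fun p hp => hp.1 hw

/-- The product of the free alternative algebra. -/
noncomputable def freeMul (n : ℕ) :
    (FreeNA n ⧸ altIdeal n) →ₗ[ℚ] (FreeNA n ⧸ altIdeal n) →ₗ[ℚ] (FreeNA n ⧸ altIdeal n) :=
  (altIdeal n).liftQ ((altIdeal n).liftQ ((LinearMap.mul ℚ (FreeNA n)).compr₂ (altIdeal n).mkQ).flip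
    (fun _ hx => LinearMap.ext fun a =>
      (Submodule.Quotient.mk_eq_zero _).2 (mul_mem_altIdeal a hx).1)).flip fun x hx => by
    refine LinearMap.ext fun a => ?_
    obtain ⟨a, rfl⟩ := (altIdeal n).mkQ_surjective a
    exact (Submodule.Quotient.mk_eq_zero _).2 (mul_mem_altIdeal a hx).2

lemma freeMul_mk (a b : FreeNA n) :
    freeMul n ((altIdeal n).mkQ a) ((altIdeal n).mkQ b) = (altIdeal n).mkQ (a * b) := rfl

lemma isAlternative_freeMul (n : ℕ) : IsAlternative (freeMul n) := by
  constructor <;> intro a b c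
  all_goals
    obtain ⟨a, rfl⟩ := (altIdeal n).mkQ_surjective a
    obtain ⟨b, rfl⟩ := (altIdeal n).mkQ_surjective b
    obtain ⟨c, rfl⟩ := (altIdeal n).mkQ_surjective c
    simp only [asc, freeMul_mk, ← map_sub, ← map_add]
    rw [Submodule.mkQ_apply, Submodule.Quotient.mk_eq_zero]
  · convert subset_altIdeal n (Or.inl ⟨a, b, c, rfl⟩) using 1
    abel_nf; rfl
  · convert subset_altIdeal n (Or.inr ⟨a, b, c, rfl⟩) using 1
    abel_nf; rfl

/-- The generators of the free alternative algebra. -/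
noncomputable def gen (n i : ℕ) : FreeNA n ⧸ altIdeal n :=
  if h : i < n then (altIdeal n).mkQ (MonoidAlgebra.single (.of ⟨i, h⟩) 1) else 0

lemma gen_of_lt {i : ℕ} (h : i < n) :
    gen n i = (altIdeal n).mkQ (MonoidAlgebra.single (.of ⟨i, h⟩) 1) := dif_pos h

/-- The map induced by a weighted evaluation on the free alternative algebra. -/
noncomputable def IsTwisted.map (h : IsTwisted n ε μ X) (u w : List ℕ) : (FreeNA n ⧸ altIdeal n) →ₗ[ℚ] B :=
  (altIdeal n).liftQ _ (altIdeal_le_ker_twist h u w)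

namespace IsTwisted
variable (h : IsTwisted n ε μ X)

lemma map_single (u w : List ℕ) (t : FreeMagma (Fin n)) :
    h.map u w ((altIdeal n).mkQ (MonoidAlgebra.single t 1)) = ε (u ++ leaves t ++ w) • ev μ X t := by
  simp [map, twist_single]

lemma map_gen_mul (u w : List ℕ) {p : ℕ} (hp : p < n) (m : FreeNA n ⧸ altIdeal n) :
    h.map u w (freeMul n (gen n p) m) = μ (X p) (h.map (u ++ [p]) w m) := by
  obtain ⟨m, rfl⟩ := (altIdeal n).mkQ_surjective m
  rw [gen_of_lt hp, freeMul_mk]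
  simp [map, twist_mul_left, leaves, ev]

lemma map_mul_gen (u w : List ℕ) {p : ℕ} (hp : p < n) (m : FreeNA n ⧸ altIdeal n) :
    h.map u w (freeMul n m (gen n p)) = μ (h.map u (p :: w) m) (X p) := by
  obtain ⟨m, rfl⟩ := (altIdeal n).mkQ_surjective m
  rw [gen_of_lt hp, freeMul_mk]
  simp [map, twist_mul_right, leaves, ev]

lemma map_gen (u w : List ℕ) {p : ℕ} (hp : p < n) : h.map u w (gen n p) = ε (u ++ p :: w) • X p := by
  rw [gen_of_lt hp, map_single]
  simp [leaves, ev]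

lemma map_asc (u w : List ℕ) {x y z : ℕ} (hx : x < n) (hy : y < n) (hz : z < n) :
    h.map u w (asc (freeMul n) (gen n x) (gen n y) (gen n z)) =
      ε (u ++ x :: y :: z :: w) • asc μ (X x) (X y) (X z) := by
  simp only [asc, map_sub, map_gen_mul h _ _ hx, map_gen_mul h _ _ hy, map_mul_gen h _ _ hz,
    map_gen h _ _ hy, map_gen h _ _ hz]
  simp [smul_sub]

end IsTwisted
end
end Alt

namespace Alt
section
variable {B : Type*} [AddCommGroup B] [Module ℚ B]

/-- The associator as a trilinear map. -/
def ascMap (μ : B →ₗ[ℚ] B →ₗ[ℚ] B) : B →ₗ[ℚ] B →ₗ[ℚ] B →ₗ[ℚ] B :=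
  μ.compr₂ μ - LinearMap.lcomp ℚ (B →ₗ[ℚ] B) μ ∘ₗ LinearMap.llcomp ℚ B B B ∘ₗ μ

lemma eq_zero_of_mem_span (E : B →ₗ[ℚ] B →ₗ[ℚ] B →ₗ[ℚ] B) {S T U : Set B}
    (h : ∀ a ∈ S, ∀ b ∈ T, ∀ c ∈ U, E a b c = 0) {a b c : B} (ha : a ∈ Submodule.span ℚ S)
    (hb : b ∈ Submodule.span ℚ T) (hc : c ∈ Submodule.span ℚ U) : E a b c = 0 := by
  induction ha using Submodule.span_induction with
  | zero => simp
  | add x y _ _ hx hy => simp [hx, hy]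
  | smul r x _ hx => simp [hx]
  | mem a ha =>
    induction hb using Submodule.span_induction with
    | zero => simp
    | add x y _ _ hx hy => simp [hx, hy]
    | smul r x _ hx => simp [hx]
    | mem b hb =>
      induction hc using Submodule.span_induction with
      | zero => simp
      | add x y _ _ hx hy => simp [hx, hy]
      | smul r x _ hx => simp [hx]
      | mem c hc => exact h a ha b hb c hc

lemma asc_right_of_mem_span {μ : B →ₗ[ℚ] B →ₗ[ℚ] B} {κ : ℚ} {S T U : Set B}
    (h : ∀ a ∈ S, ∀ b ∈ T, ∀ c ∈ U, asc μ a b c + κ • asc μ a c b = 0) {a b c : B}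
    (ha : a ∈ Submodule.span ℚ S) (hb : b ∈ Submodule.span ℚ T) (hc : c ∈ Submodule.span ℚ U) :
    asc μ a b c + κ • asc μ a c b = 0 :=
  eq_zero_of_mem_span (ascMap μ + κ • ((LinearMap.lflip (R₀ := ℚ)).toLinearMap ∘ₗ ascMap μ)) h ha hb hc

lemma asc_left_of_mem_span {μ : B →ₗ[ℚ] B →ₗ[ℚ] B} {κ : ℚ} {S T U : Set B}
    (h : ∀ a ∈ S, ∀ b ∈ T, ∀ c ∈ U, asc μ a b c + κ • asc μ b a c = 0) {a b c : B}
    (ha : a ∈ Submodule.span ℚ S) (hb : b ∈ Submodule.span ℚ T) (hc : c ∈ Submodule.span ℚ U) :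
    asc μ a b c + κ • asc μ b a c = 0 :=
  eq_zero_of_mem_span (ascMap μ + κ • (ascMap μ).flip) h ha hb hc
end

/-- A coefficient of a sparse vector. -/
def coefAt (k : ℕ) : List (ℕ × ℤ) → ℤ
  | [] => 0
  | p :: l => cond (Nat.beq p.1 k) (Int.add p.2 (coefAt k l)) (coefAt k l)

/-- All coefficients of a sparse vector vanish. -/
def isZero (l : List (ℕ × ℤ)) : Bool := l.all fun p => decide (coefAt p.1 l = 0)

/-- Add a multiple of a basis vector to a sparse vector. -/
def insertAt (k : ℕ) (c : ℤ) : List (ℕ × ℤ) → List (ℕ × ℤ)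
  | [] => [(k, c)]
  | p :: l => cond (Nat.beq p.1 k) ((k, Int.add c p.2) :: l) (p :: insertAt k c l)

/-- Add a multiple of a sparse vector to a sparse vector. -/
def addTo (c : ℤ) : List (ℕ × ℤ) → List (ℕ × ℤ) → List (ℕ × ℤ)
  | [], r => r
  | p :: l, r => addTo c l (insertAt p.1 (Int.mul c p.2) r)

/-- Left multiplication by a basis vector, added to a sparse vector. -/
def lmul (T : ℕ → ℕ → List (ℕ × ℤ)) (c : ℤ) (i : ℕ) : List (ℕ × ℤ) → List (ℕ × ℤ) → List (ℕ × ℤ)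
  | [], r => r
  | p :: l, r => lmul T c i l (addTo (Int.mul c p.2) (T i p.1) r)

/-- Right multiplication by a basis vector, added to a sparse vector. -/
def rmul (T : ℕ → ℕ → List (ℕ × ℤ)) (c : ℤ) (i : ℕ) : List (ℕ × ℤ) → List (ℕ × ℤ) → List (ℕ × ℤ)
  | [], r => r
  | p :: l, r => rmul T c i l (addTo (Int.mul c p.2) (T p.1 i) r)

/-- A multiple of the associator of basis vectors, added to a sparse vector. -/
def ascAt (T : ℕ → ℕ → List (ℕ × ℤ)) (c : ℤ) (i j k : ℕ) (r : List (ℕ × ℤ)) : List (ℕ × ℤ) :=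
  lmul T (Int.neg c) i (T j k) (rmul T c k (T i j) r)

/-- The vector with the given coefficients. -/
noncomputable def val : List (ℕ × ℤ) → ℕ →₀ ℚ
  | [] => 0
  | p :: l => Finsupp.single p.1 (p.2 : ℚ) + val l

/-- The product with the given structure constants. -/
noncomputable def tmul (T : ℕ → ℕ → List (ℕ × ℤ)) : (ℕ →₀ ℚ) →ₗ[ℚ] (ℕ →₀ ℚ) →ₗ[ℚ] (ℕ →₀ ℚ) :=
  Finsupp.linearCombination ℚ fun i => Finsupp.linearCombination ℚ fun j => val (T i j)

/-- A basis vector. -/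
noncomputable def bas (i : ℕ) : ℕ →₀ ℚ := Finsupp.single i 1

lemma val_apply (k : ℕ) (l : List (ℕ × ℤ)) : val l k = coefAt k l := by
  induction l with
  | nil => simp [val, coefAt]
  | cons p l ih =>
    rw [val, coefAt, Finsupp.add_apply, ih, Finsupp.single_apply]
    by_cases h : p.1 = k
    · have hb : Nat.beq p.1 k = true := Nat.beq_eq ▸ h
      rw [if_pos h, hb]; exact (Int.cast_add _ _).symm
    · have hb : Nat.beq p.1 k = false := Bool.eq_false_iff.2 fun e => h (Nat.eq_of_beq_eq_true e)
      rw [if_neg h, hb, zero_add]; rfl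

lemma coefAt_eq_zero {k : ℕ} {l : List (ℕ × ℤ)} (h : ∀ p ∈ l, p.1 ≠ k) : coefAt k l = 0 := by
  induction l with
  | nil => rfl
  | cons p l ih =>
    have hb : Nat.beq p.1 k = false :=
      Bool.eq_false_iff.2 fun e => h p (.head _) (Nat.eq_of_beq_eq_true e)
    rw [coefAt, hb]
    exact ih fun q hq => h q (.tail _ hq)

lemma val_eq_zero {l : List (ℕ × ℤ)} (h : isZero l = true) : val l = 0 := by
  ext k
  rw [val_apply, Finsupp.zero_apply]
  by_cases hk : ∃ p ∈ l, p.1 = k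
  · obtain ⟨p, hp, rfl⟩ := hk
    rw [isZero, List.all_eq_true] at h
    rw [of_decide_eq_true (h p hp), Int.cast_zero]
  · push Not at hk
    rw [coefAt_eq_zero hk, Int.cast_zero]

lemma val_insertAt (k : ℕ) (c : ℤ) (l : List (ℕ × ℤ)) :
    val (insertAt k c l) = Finsupp.single k (c : ℚ) + val l := by
  induction l with
  | nil => rfl
  | cons p l ih =>
    rw [insertAt]
    cases hb : Nat.beq p.1 k with
    | false => rw [cond_false, val, val, ih]; abel
    | true =>
      rw [cond_true, val, val, Nat.eq_of_beq_eq_true hb, ← add_assoc, ← Finsupp.single_add]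
      congr 2
      exact Int.cast_add _ _

lemma val_addTo (c : ℤ) (l r : List (ℕ × ℤ)) : val (addTo c l r) = (c : ℚ) • val l + val r := by
  induction l generalizing r with
  | nil => simp [addTo, val]
  | cons p l ih =>
    rw [addTo, ih, val_insertAt, val, smul_add, Finsupp.smul_single, smul_eq_mul,
      show Int.mul c p.2 = c * p.2 from rfl, Int.cast_mul]
    abel

variable (T : ℕ → ℕ → List (ℕ × ℤ))

lemma tmul_bas (i j : ℕ) : tmul T (bas i) (bas j) = val (T i j) := by simp [tmul, bas]

lemma single_eq_smul_bas (k : ℕ) (c : ℚ) : Finsupp.single k c = c • bas k := by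
  rw [bas, Finsupp.smul_single, smul_eq_mul, mul_one]

lemma val_lmul (c : ℤ) (i : ℕ) (l r : List (ℕ × ℤ)) :
    val (lmul T c i l r) = (c : ℚ) • tmul T (bas i) (val l) + val r := by
  induction l generalizing r with
  | nil => simp [lmul, val]
  | cons p l ih =>
    rw [lmul, ih, val_addTo, val, single_eq_smul_bas, map_add, map_smul, tmul_bas,
      show Int.mul c p.2 = c * p.2 from rfl, Int.cast_mul]
    module

lemma val_rmul (c : ℤ) (i : ℕ) (l r : List (ℕ × ℤ)) :
    val (rmul T c i l r) = (c : ℚ) • tmul T (val l) (bas i) + val r := by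
  induction l generalizing r with
  | nil => simp [rmul, val]
  | cons p l ih =>
    rw [rmul, ih, val_addTo, val, single_eq_smul_bas, map_add, map_smul, LinearMap.add_apply,
      LinearMap.smul_apply, tmul_bas, show Int.mul c p.2 = c * p.2 from rfl, Int.cast_mul]
    module

lemma val_ascAt (c : ℤ) (i j k : ℕ) (r : List (ℕ × ℤ)) :
    val (ascAt T c i j k r) = (c : ℚ) • asc (tmul T) (bas i) (bas j) (bas k) + val r := by
  rw [ascAt, val_lmul, val_rmul, asc, tmul_bas, tmul_bas, show Int.neg c = -c from rfl, Int.cast_neg]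
  module

/-- A weight of words which changes by `κ` of the lengths when two adjacent blocks are exchanged. -/
def IsSign (ε : List ℕ → ℚ) (κ : ℕ → ℕ → ℤ) : Prop :=
  ∀ u a b w : List ℕ, ε (u ++ (b ++ (a ++ w))) = κ a.length b.length * ε (u ++ (a ++ (b ++ w)))

/-- The alternative laws, with signs, for basis vectors that occur in monomials of given degrees. -/
structure IsSuper (T : ℕ → ℕ → List (ℕ × ℤ)) (G : ℕ → ℕ → Prop) (κ : ℕ → ℕ → ℤ) : Prop where
  mem : ∀ {l m i j : ℕ}, G l i → G m j → ∀ p ∈ T i j, G (l + m) p.1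
  right : ∀ {l m q i j k : ℕ}, G l i → G m j → G q k →
    isZero (ascAt T 1 i j k (ascAt T (κ m q) i k j [])) = true
  left : ∀ {l m q i j k : ℕ}, G l i → G m j → G q k →
    isZero (ascAt T 1 i j k (ascAt T (κ l m) j i k [])) = true

variable {T} {G : ℕ → ℕ → Prop} {κ : ℕ → ℕ → ℤ} {n : ℕ} {ε : List ℕ → ℚ} {x : ℕ → ℕ}

lemma val_mem_span {S : ℕ → Prop} {l : List (ℕ × ℤ)} (h : ∀ p ∈ l, S p.1) :
    val l ∈ Submodule.span ℚ (bas '' {i | S i}) := by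
  induction l with
  | nil => exact zero_mem _
  | cons p l ih =>
    rw [val, single_eq_smul_bas]
    exact add_mem (Submodule.smul_mem _ _ (Submodule.subset_span ⟨_, h p (.head _), rfl⟩))
      (ih fun q hq => h q (.tail _ hq))

lemma IsSuper.ev_mem (h : IsSuper T G κ) (hx : ∀ p, G 1 (x p)) (t : FreeMagma (Fin n)) :
    ev (tmul T) (fun p => bas (x p)) t ∈ Submodule.span ℚ (bas '' {i | G (leaves t).length i}) := by
  induction t with
  | ih1 a => exact Submodule.subset_span ⟨_, hx _, rfl⟩
  | ih2 a b ha hb =>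
    rw [leaves_mul, List.length_append, ev_mul]
    have := Submodule.apply_mem_map₂ (tmul T) ha hb
    rw [Submodule.map₂_span_span] at this
    refine Submodule.span_le.2 ?_ this
    rintro _ ⟨_, ⟨i, hi, rfl⟩, _, ⟨j, hj, rfl⟩, rfl⟩
    change tmul T (bas i) (bas j) ∈ _
    rw [tmul_bas]
    exact val_mem_span (S := fun i => G _ i) (h.mem hi hj)

theorem IsSuper.isTwisted (h : IsSuper T G κ) (hx : ∀ p, G 1 (x p)) (hε : IsSign ε κ) :
    IsTwisted n ε (tmul T) fun p => bas (x p) := by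
  constructor <;> intro u w a b c
  · have := asc_right_of_mem_span (κ := κ (leaves b).length (leaves c).length)
      (by
        rintro _ ⟨i, hi, rfl⟩ _ ⟨j, hj, rfl⟩ _ ⟨k, hk, rfl⟩
        have := val_eq_zero (h.right hi hj hk)
        rwa [val_ascAt, val_ascAt, val, add_zero, Int.cast_one, one_smul] at this)
      (h.ev_mem hx a) (h.ev_mem hx b) (h.ev_mem hx c)
    have e := hε (u ++ leaves a) (leaves b) (leaves c) w
    simp only [List.append_assoc] at e ⊢
    rw [e, mul_comm, mul_smul, ← smul_add, this, smul_zero]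
  · have := asc_left_of_mem_span (κ := κ (leaves a).length (leaves b).length)
      (by
        rintro _ ⟨i, hi, rfl⟩ _ ⟨j, hj, rfl⟩ _ ⟨k, hk, rfl⟩
        have := val_eq_zero (h.left hi hj hk)
        rwa [val_ascAt, val_ascAt, val, add_zero, Int.cast_one, one_smul] at this)
      (h.ev_mem hx a) (h.ev_mem hx b) (h.ev_mem hx c)
    have e := hε u (leaves a) (leaves b) (leaves c ++ w)
    simp only [List.append_assoc] at e ⊢
    rw [e, mul_comm, mul_smul, ← smul_add, this, smul_zero]

/-- The letters of a word. -/
def Word.letters (y : Word) : List ℕ := y.ops.map Prod.snd ++ [y.x, y.y, y.z]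

/-- The value of a word. -/
def Word.ev {V : Type*} [AddCommGroup V] [Module ℚ V] (μ : V →ₗ[ℚ] V →ₗ[ℚ] V) (g : ℕ → V) (y : Word) : V :=
  lopsEv μ g y.ops (asc μ (g y.x) (g y.y) (g y.z))

/-- An operator with a basis vector, applied to a vector and added to a vector. -/
def omul (T : ℕ → ℕ → List (ℕ × ℤ)) (c : ℤ) (i : ℕ) : List (ℕ × ℤ) → List (ℕ × ℤ) → List (ℕ × ℤ)
  | [], r => r
  | p :: l, r => omul T c i l (addTo p.2 (T i p.1) (addTo (Int.mul c p.2) (T p.1 i) r))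

/-- Apply operators with basis vectors. -/
def opsAt (T : ℕ → ℕ → List (ℕ × ℤ)) (κ : ℕ → ℕ → ℤ) (x : ℕ → ℕ) (v : List (ℕ × ℤ)) :
    List (Bool × ℕ) → List (ℕ × ℤ)
  | [] => v
  | p :: l => omul T (cond p.1 (κ 1 (l.length + 3)) (Int.neg (κ 1 (l.length + 3)))) (x p.2)
      (opsAt T κ x v l) []

lemma val_omul (T : ℕ → ℕ → List (ℕ × ℤ)) (c : ℤ) (i : ℕ) (l r : List (ℕ × ℤ)) :
    val (omul T c i l r) = tmul T (bas i) (val l) + (c : ℚ) • tmul T (val l) (bas i) + val r := by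
  induction l generalizing r with
  | nil => simp [omul, val]
  | cons p l ih =>
    rw [omul, ih, val_addTo, val_addTo, val, single_eq_smul_bas, map_add, map_add, map_smul, map_smul,
      LinearMap.add_apply, LinearMap.smul_apply, tmul_bas, tmul_bas,
      show Int.mul c p.2 = c * p.2 from rfl, Int.cast_mul]
    module

lemma map_ops (h : IsTwisted n ε (tmul T) fun p => bas (x p)) (hε : IsSign ε κ) {l₀ : List ℕ}
    (hl₀ : l₀.length = 3) {m : FreeNA n ⧸ altIdeal n} {v : List (ℕ × ℤ)}
    (hm : ∀ u w, h.map u w m = ε (u ++ (l₀ ++ w)) • val v) (l : List (Bool × ℕ))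
    (hl : ∀ p ∈ l, p.2 < n) (u w : List ℕ) :
    h.map u w (lopsEv (freeMul n) (gen n) l m) =
      ε (u ++ (l.map Prod.snd ++ (l₀ ++ w))) • val (opsAt T κ x v l) := by
  induction l generalizing u w with
  | nil => exact hm u w
  | cons p l ih =>
    have hp := hl p (.head _)
    have ih := ih fun q hq => hl q (.tail _ hq)
    have e := hε u [p.2] (l.map Prod.snd ++ l₀) w
    simp only [List.append_assoc, List.length_append, List.length_map, hl₀, List.length_singleton,
      List.singleton_append] at e
    change h.map u w (op (freeMul n) p.1 (gen n p.2) (lopsEv (freeMul n) (gen n) l m)) = _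
    rw [opsAt, val_omul, val, add_zero, List.map_cons, List.cons_append]
    cases p.1
    all_goals
      simp only [op, map_sub, map_add, h.map_gen_mul _ _ hp, h.map_mul_gen _ _ hp, ih, e, map_smul,
        LinearMap.smul_apply, List.append_assoc, List.singleton_append, cond_true, cond_false, if_true, if_false,
        Bool.false_eq_true, show ∀ z, Int.neg z = -z from fun _ => rfl, Int.cast_neg]
      module

lemma map_word (h : IsTwisted n ε (tmul T) fun p => bas (x p)) (hε : IsSign ε κ) (y : Word)
    (hy : ∀ p ∈ y.letters, p < n) : h.map [] [] (y.ev (freeMul n) (gen n)) =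
      ε y.letters • val (opsAt T κ x (ascAt T 1 (x y.x) (x y.y) (x y.z) []) y.ops) := by
  simp only [Word.letters, List.mem_append, List.mem_map, List.mem_cons, List.not_mem_nil, or_false] at hy
  rw [Word.ev, map_ops (l₀ := [y.x, y.y, y.z]) h hε rfl (fun u w => ?_) y.ops
    fun p hp => hy _ (.inl ⟨p, hp, rfl⟩)]
  · rfl
  · rw [h.map_asc _ _ (hy _ (by simp)) (hy _ (by simp)) (hy _ (by simp)), val_ascAt, val, add_zero,
      Int.cast_one, one_smul]
    rfl

end Alt

namespace Alt

/-- The sign of the order of two letters. -/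
def ordSign (a b : ℕ) : ℤ := cond (Nat.blt a b) 1 (cond (Nat.blt b a) (-1) 0)

def crossSign₁ (a : ℕ) : List ℕ → ℤ
  | [] => 1
  | b :: l => Int.mul (ordSign a b) (crossSign₁ a l)

/-- The sign of the permutation that sorts a word, and zero if a letter is repeated. -/
def permSign : List ℕ → ℤ
  | [] => 1
  | a :: l => Int.mul (crossSign₁ a l) (permSign l)

def crossSign : List ℕ → List ℕ → ℤ
  | [], _ => 1
  | a :: l, m => crossSign₁ a m * crossSign l m

/-- The sign of the exchange of two adjacent blocks of odd letters. -/
def blockSign (m q : ℕ) : ℤ := cond (Nat.beq (Nat.mod (Nat.mul m q) 2) 0) 1 (-1)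

lemma blockSign_eq (m q : ℕ) : blockSign m q = (-1) ^ (m * q) := by
  rw [blockSign]
  rcases Nat.mod_two_eq_zero_or_one (m * q) with h | h
  · rw [(Nat.even_iff.2 h).neg_one_pow, show Nat.mod (Nat.mul m q) 2 = 0 from h]; rfl
  · rw [(Nat.odd_iff.2 h).neg_one_pow, show Nat.mod (Nat.mul m q) 2 = 1 from h]; rfl

lemma ordSign_swap (a b : ℕ) : ordSign b a = -ordSign a b := by
  unfold ordSign
  cases h : Nat.blt a b <;> cases h' : Nat.blt b a <;> try rfl
  rw [Nat.blt_eq] at h h'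
  omega

lemma crossSign₁_append (a : ℕ) (l m : List ℕ) :
    crossSign₁ a (l ++ m) = crossSign₁ a l * crossSign₁ a m := by
  induction l with
  | nil => exact (one_mul _).symm
  | cons b l ih =>
    change ordSign a b * crossSign₁ a (l ++ m) = ordSign a b * crossSign₁ a l * _
    rw [ih, mul_assoc]

lemma crossSign_append_right (u l m : List ℕ) :
    crossSign u (l ++ m) = crossSign u l * crossSign u m := by
  induction u with
  | nil => exact (one_mul _).symm
  | cons a u ih => rw [crossSign, ih, crossSign, crossSign, crossSign₁_append]; ring

lemma permSign_append (l m : List ℕ) :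
    permSign (l ++ m) = permSign l * permSign m * crossSign l m := by
  induction l with
  | nil => change _ = 1 * _ * 1; rw [mul_one, one_mul]; rfl
  | cons a l ih =>
    change crossSign₁ a (l ++ m) * permSign (l ++ m) = crossSign₁ a l * permSign l * _ * _
    rw [ih, crossSign₁_append, crossSign]; ring

lemma crossSign_singleton_right (l : List ℕ) (b : ℕ) :
    crossSign l [b] = (-1) ^ l.length * crossSign₁ b l := by
  induction l with
  | nil => rfl
  | cons a l ih =>
    rw [crossSign, ih, List.length_cons, pow_succ]
    change ordSign a b * 1 * _ = _ * (ordSign b a * _)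
    rw [ordSign_swap a b]; ring

lemma crossSign_swap (l m : List ℕ) : crossSign m l = (-1) ^ (l.length * m.length) * crossSign l m := by
  induction m with
  | nil =>
    induction l with
    | nil => rfl
    | cons a l ih => rw [crossSign, ← mul_one 1, crossSign, ← mul_assoc] at *; simpa [crossSign₁] using ih
  | cons b m ih =>
    rw [crossSign, ih, ← List.singleton_append, crossSign_append_right, crossSign_singleton_right,
      List.singleton_append, List.length_cons, Nat.mul_succ, pow_add]
    have : ((-1 : ℤ) ^ l.length) * (-1) ^ l.length = 1 := by rw [← mul_pow]; simp
    linear_combination -((-1 : ℤ) ^ (l.length * m.length) * crossSign₁ b l * crossSign l m) * this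

lemma isSign_permSign : IsSign (fun l => (permSign l : ℚ)) blockSign := by
  intro u a b w
  rw [← Int.cast_mul, Int.cast_inj, blockSign_eq]
  simp only [permSign_append, crossSign_append_right, crossSign_swap a b]
  ring

lemma isSign_one : IsSign (fun _ => 1) fun _ _ => 1 := fun u a b w => by simp

end Alt

namespace Alt

/-- Find the entry of a row of a sparse table. -/
def findAt (j : ℕ) : List (ℕ × List ℕ) → List ℕ
  | [] => []
  | p :: l => cond (Nat.beq p.1 j) p.2 (findAt j l)

/-- Find a row of a table. -/
def rowAt : ℕ → List (List (ℕ × List ℕ)) → List (ℕ × List ℕ)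
  | _, [] => []
  | 0, p :: _ => p
  | i + 1, _ :: l => rowAt i l

/-- Structure constants of a nilpotent superalgebra in compressed form: the entry `16 k + c + 8` of the
product of two basis vectors stands for the term `c` times the basis vector `k`. -/
def superRows : List (List (ℕ × List ℕ)) := [[(0, [41]), (1, [73]), (3, [121]), (4, [137]), (5,
  [201]), (10, [329]), (11, [279, 311, 329]), (12, [260, 297, 332, 341, 363]), (13, [345]), (14,
  [441]), (15, [457]), (25, [553, 567, 599]), (27, [551, 567, 585]), (28, [551, 567, 585, 601]),
  (30, [553, 569, 583, 601]), (31, [634, 650, 678, 698]), (32, [631, 647, 681, 694]), (33, [665]),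
  (38, [713]), (41, [729])],
 [(0, [57]), (1, [89]), (2, [105]), (3, [169]), (4, [185]), (5, [233]), (6, [265]), (7, [281]), (8,
  [297]), (9, [313]), (10, [425]), (11, [393]), (12, [409]), (13, [425]), (14, [505]), (15, [521]),
  (16, [553, 583]), (17, [551, 567, 586, 601]), (18, [554, 582]), (19, [553, 583, 599]), (20,
  [567]), (21, [567]), (23, [553]), (24, [617]), (25, [633, 649, 679, 697]), (27, [633, 647, 695]),
  (28, [647]), (29, [633]), (30, [649])],
 [(1, [103, 137, 153]), (5, [261, 297, 331, 342, 362]), (14, [554, 569, 582, 599]), (15, [569,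
  602]), (31, [742]), (32, [729, 745]), (33, [730])],
 [(0, [153]), (1, [167, 185, 217]), (3, [281, 313, 359]), (4, [263, 281, 297, 313, 375]), (5, [409,
  425, 471]), (11, [551]), (12, [569]), (13, [569, 601]), (14, [647, 681, 695]), (15, [615, 665,
  698]), (25, [743]), (27, [759]), (28, [711, 727, 759]), (29, [729]), (30, [713, 729, 761])],
 [(0, [103, 121, 153]), (1, [167, 201, 217]), (3, [313, 329, 359]), (4, [263, 329, 375]), (5, [425,
  441, 471]), (10, [569]), (11, [551, 585]), (12, [555, 569, 582, 599]), (13, [570, 601]), (14,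
  [633, 650, 679, 698]), (15, [615, 631, 665, 681]), (24, [713]), (25, [743]), (27, [759]), (28,
  [711, 727, 759]), (29, [729]), (30, [713, 729, 761])],
 [(0, [217]), (1, [249]), (2, [263, 281, 314, 329, 343, 375]), (3, [426, 441, 455, 471]), (4, [393,
  409, 487]), (5, [505, 521, 535]), (6, [549, 567, 587, 601]), (7, [553, 567, 585]), (8, [601]), (9,
  [551, 569, 585]), (10, [615]), (11, [617, 647]), (12, [615, 631, 665, 681]), (13, [615, 681]),
  (16, [743]), (17, [713, 729, 745]), (18, [742]), (19, [727, 743]), (20, [727, 743, 759]), (21,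
  [727, 743, 759]), (23, [713, 729, 761])],
 [(1, [265, 279, 297, 311, 327, 345, 377]), (5, [551, 567, 585, 599]), (14, [730, 743, 761]), (15,
  [729, 745, 761])],
 [(1, [279, 310, 345, 361]), (5, [567, 585, 599]), (14, [730, 745]), (15, [710])],
 [(1, [261, 279, 297, 311, 331, 342, 363, 377]), (5, [567, 599]), (14, [730, 743, 761]), (15, [729,
  745, 761])],
 [(1, [263, 281, 297, 314, 359, 375]), (5, [553, 569, 583]), (14, [726, 743, 759]), (15, [759])],
 [(0, [361]), (1, [393, 423, 439, 457, 473]), (3, [567, 585]), (4, [553, 566, 599]), (5, [663,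
  695]), (10, [711]), (12, [711, 729, 745]), (13, [711])],
 [(0, [377]), (1, [489]), (3, [583]), (4, [550, 567, 585]), (5, [617, 633, 663, 679]), (10, [729,
  745, 761]), (11, [713, 729, 745, 761]), (12, [729, 743, 761]), (13, [729, 745, 761])],
 [(0, [263, 329, 361]), (1, [423, 457, 473]), (3, [553, 583, 599]), (4, [551, 566, 586, 599]), (5,
  [633, 649, 663, 679]), (10, [711]), (11, [713]), (12, [711, 729, 745]), (13, [711])],
 [(0, [281, 314, 359, 375]), (1, [393, 409, 425, 471, 487]), (3, [567, 586]), (4, [553, 583]), (5,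
  [615, 631, 665, 681]), (10, [727, 743, 759]), (11, [711, 727, 743, 759]), (12, [727, 759]), (13,
  [727, 743, 759])],
 [(0, [473]), (1, [537]), (2, [551, 567, 585]), (3, [649, 665, 679, 697]), (4, [647, 665]), (6,
  [729, 743]), (7, [713, 729]), (8, [729]), (9, [727])],
 [(0, [427, 441, 455, 470]), (1, [505, 522, 534]), (2, [549, 567, 587]), (3, [615, 647, 663, 681,
  694]), (4, [618, 633, 663, 679, 697]), (6, [727]), (7, [745]), (8, [727, 742]), (9, [743])],
 [(1, [601]), (5, [727, 745])],
 [(1, [553, 583]), (5, [711, 727])],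
 [(1, [550, 586, 601]), (5, [727])],
 [(1, [551, 585]), (5, [729])],
 [(1, [569, 601]), (5, [727])],
 [(1, [585, 599]), (5, [711, 729])],
 [(1, [553, 567, 599]), (5, [711, 729, 745])],
 [(1, [549, 567, 586]), (5, [729, 743, 761])],
 [(0, [585]), (4, [711, 727, 743, 759])],
 [(0, [553, 569, 583]), (1, [615, 631, 646, 665, 682, 695]), (3, [713, 727, 743]), (4, [727, 745,
  759])],
 [(0, [569]), (1, [697]), (3, [713]), (4, [727, 743, 759])],
 [(0, [555, 570, 581, 599]), (1, [631, 665, 681]), (3, [727, 743]), (4, [727, 745, 759])],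
 [(0, [553, 570, 583]), (1, [615, 649, 663]), (4, [713, 727, 743, 759])],
 [(0, [554, 569, 582, 599]), (1, [631, 647, 665, 681]), (3, [713, 727, 743]), (4, [727, 745, 759])],
 [(0, [551]), (1, [617, 633, 647, 663, 679]), (3, [729, 745, 761])],
 [(0, [681]), (2, [726, 745, 759])],
 [(0, [615, 631, 649, 665, 697]), (2, [727, 743, 759])],
 [(0, [631, 649, 665, 697]), (2, [727, 759])],
 [(1, [711, 727, 759])],
 [(1, [727, 743, 759])],
 [(1, [711, 727, 743, 759])],
 [(1, [727])],
 [],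
 [(0, [727])],
 [(0, [711, 727, 759])],
 [],
 [(0, [726, 743, 759])],
 [(0, [713])]]

/-- Structure constants of a nilpotent alternative superalgebra on odd generators. -/
def superTable (i j : ℕ) : List (ℕ × ℤ) :=
  (findAt j (rowAt i superRows)).map fun e => (Nat.div e 16, Int.subNatNat (Nat.mod e 16) 8)

/-- The degrees of the basis vectors. -/
def superDeg (i : ℕ) : ℕ :=
  cond (Nat.blt i 2) 1 (cond (Nat.blt i 6) 2 (cond (Nat.blt i 16) 3 (cond (Nat.blt i 34) 4 (cond (Nat.blt i 44) 5 6))))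

def below : ℕ → List ℕ
  | 0 => []
  | n + 1 => n :: below n

lemma mem_below {i n : ℕ} (h : i < n) : i ∈ below n := by
  induction n with
  | zero => omega
  | succ n ih =>
    rw [below, List.mem_cons]
    rcases Nat.lt_succ_iff_lt_or_eq.1 h with h | h
    exacts [.inr (ih h), .inl h]

def superMem : Bool := (below 48).all fun i => (below 48).all fun j => (superTable i j).all fun p =>
  Nat.blt p.1 48 && Nat.beq (superDeg p.1) (Nat.add (superDeg i) (superDeg j))

def superLaws : Bool := (below 48).all fun i => (below 48).all fun j =>
  Nat.blt 5 (Nat.add (superDeg i) (superDeg j)) || (below 48).all fun k =>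
    Nat.blt 6 (Nat.add (Nat.add (superDeg i) (superDeg j)) (superDeg k)) ||
    (isZero (ascAt superTable 1 i j k (ascAt superTable (blockSign (superDeg j) (superDeg k)) i k j [])) &&
    isZero (ascAt superTable 1 i j k (ascAt superTable (blockSign (superDeg i) (superDeg j)) j i k [])))

lemma superMem_eq : superMem = true := by decide +kernel

lemma superLaws_eq : superLaws = true := by decide +kernel

lemma superDeg_le (i : ℕ) : superDeg i ≤ 6 := by
  unfold superDeg
  cases Nat.blt i 2 <;> cases Nat.blt i 6 <;> cases Nat.blt i 16 <;> cases Nat.blt i 34 <;>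
    cases Nat.blt i 44 <;> decide

lemma superDeg_pos (i : ℕ) : 1 ≤ superDeg i := by
  unfold superDeg
  cases Nat.blt i 2 <;> cases Nat.blt i 6 <;> cases Nat.blt i 16 <;> cases Nat.blt i 34 <;>
    cases Nat.blt i 44 <;> decide

lemma superTable_mem {i j : ℕ} (hi : i < 48) (hj : j < 48) {p : ℕ × ℤ} (hp : p ∈ superTable i j) :
    p.1 < 48 ∧ superDeg p.1 = superDeg i + superDeg j := by
  have := superMem_eq
  rw [superMem, List.all_eq_true] at this
  have := this i (mem_below hi)
  rw [List.all_eq_true] at this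
  have := this j (mem_below hj)
  rw [List.all_eq_true] at this
  have := this p hp
  rw [Bool.and_eq_true, Nat.blt_eq] at this
  exact ⟨this.1, Nat.eq_of_beq_eq_true this.2⟩

lemma superTable_eq_nil {i j : ℕ} (hi : i < 48) (hj : j < 48) (h : 6 < superDeg i + superDeg j) :
    superTable i j = [] :=
  List.eq_nil_iff_forall_not_mem.2 fun p hp => by
    have := superTable_mem hi hj hp
    have := superDeg_le p.1
    omega

lemma lmul_eq {T : ℕ → ℕ → List (ℕ × ℤ)} {i : ℕ} (c : ℤ) {l : List (ℕ × ℤ)}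
    (h : ∀ p ∈ l, T i p.1 = []) (r : List (ℕ × ℤ)) : lmul T c i l r = r := by
  induction l with
  | nil => rfl
  | cons p l ih => rw [lmul, h p (.head _), addTo, ih fun q hq => h q (.tail _ hq)]

lemma rmul_eq {T : ℕ → ℕ → List (ℕ × ℤ)} {i : ℕ} (c : ℤ) {l : List (ℕ × ℤ)}
    (h : ∀ p ∈ l, T p.1 i = []) (r : List (ℕ × ℤ)) : rmul T c i l r = r := by
  induction l with
  | nil => rfl
  | cons p l ih => rw [rmul, h p (.head _), addTo, ih fun q hq => h q (.tail _ hq)]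

lemma ascAt_superTable_eq {i j k : ℕ} (hi : i < 48) (hj : j < 48) (hk : k < 48)
    (h : 6 < superDeg i + superDeg j + superDeg k) (c : ℤ) (r : List (ℕ × ℤ)) :
    ascAt superTable c i j k r = r := by
  rw [ascAt, rmul_eq, lmul_eq]
  · intro p hp
    have := superTable_mem hj hk hp
    exact superTable_eq_nil hi this.1 (by omega)
  · intro p hp
    have := superTable_mem hi hj hp
    exact superTable_eq_nil this.1 hk (by omega)

lemma superTable_laws {i j k : ℕ} (hi : i < 48) (hj : j < 48) (hk : k < 48) :
    isZero (ascAt superTable 1 i j k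
      (ascAt superTable (blockSign (superDeg j) (superDeg k)) i k j [])) = true ∧
    isZero (ascAt superTable 1 i j k
      (ascAt superTable (blockSign (superDeg i) (superDeg j)) j i k [])) = true := by
  have := superDeg_pos k
  by_cases h : 6 < superDeg i + superDeg j + superDeg k
  · rw [ascAt_superTable_eq hi hj hk h, ascAt_superTable_eq hi hk hj (by omega),
      ascAt_superTable_eq hi hj hk h, ascAt_superTable_eq hj hi hk (by omega)]
    exact ⟨rfl, rfl⟩
  · have := superLaws_eq
    rw [superLaws, List.all_eq_true] at this
    have := this i (mem_below hi)
    rw [List.all_eq_true] at this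
    have := this j (mem_below hj)
    rw [Bool.or_eq_true, Nat.blt_eq, List.all_eq_true] at this
    have := (this.resolve_left (by change ¬ 5 < superDeg i + superDeg j; omega)) k (mem_below hk)
    rw [Bool.or_eq_true, Nat.blt_eq, Bool.and_eq_true] at this
    exact this.resolve_left (by change ¬ 6 < superDeg i + superDeg j + superDeg k; omega)

lemma isSuper_superTable : IsSuper superTable (fun l i => i < 48 ∧ superDeg i = l) blockSign where
  mem := by
    rintro _ _ i j ⟨hi, rfl⟩ ⟨hj, rfl⟩ p hp
    exact superTable_mem hi hj hp
  right := by
    rintro _ _ _ i j k ⟨hi, rfl⟩ ⟨hj, rfl⟩ ⟨hk, rfl⟩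
    exact (superTable_laws hi hj hk).1
  left := by
    rintro _ _ _ i j k ⟨hi, rfl⟩ ⟨hj, rfl⟩ ⟨hk, rfl⟩
    exact (superTable_laws hi hj hk).2

/-- The exponent of the sign of a product of octonion units. -/
def octExp (a b : Bool × Bool × Bool) : Bool :=
  xor (xor (xor (xor (a.1 && b.1) (a.1 && b.2.1)) (xor (a.1 && b.2.2) (a.2.1 && b.2.1)))
    (xor (a.2.1 && b.2.2) (a.2.2 && b.2.2)))
    (xor (xor (b.1 && a.2.1 && a.2.2) (a.1 && b.2.1 && a.2.2)) (a.1 && a.2.1 && b.2.2))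

/-- The bits of the number of an octonion unit. -/
def bits (i : ℕ) : Bool × Bool × Bool := (Nat.testBit i 0, Nat.testBit i 1, Nat.testBit i 2)

/-- Structure constants of the octonions. -/
def octTable (i j : ℕ) : List (ℕ × ℤ) :=
  [(Nat.xor i j, cond (octExp (bits i) (bits j)) (-1) 1)]

def octLaws : Bool := (below 8).all fun i => (below 8).all fun j => (below 8).all fun k =>
  isZero (ascAt octTable 1 i j k (ascAt octTable 1 i k j [])) &&
  isZero (ascAt octTable 1 i j k (ascAt octTable 1 j i k []))

lemma octLaws_eq : octLaws = true := by decide +kernel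

lemma octTable_laws {i j k : ℕ} (hi : i < 8) (hj : j < 8) (hk : k < 8) :
    isZero (ascAt octTable 1 i j k (ascAt octTable 1 i k j [])) = true ∧
    isZero (ascAt octTable 1 i j k (ascAt octTable 1 j i k [])) = true := by
  have := octLaws_eq
  rw [octLaws, List.all_eq_true] at this
  have := this i (mem_below hi)
  rw [List.all_eq_true] at this
  have := this j (mem_below hj)
  rw [List.all_eq_true] at this
  rw [← Bool.and_eq_true]
  exact this k (mem_below hk)

lemma isSuper_octTable : IsSuper octTable (fun _ i => i < 8) (fun _ _ => 1) where
  mem := by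
    rintro _ _ i j hi hj p hp
    rw [octTable, List.mem_singleton] at hp
    subst hp
    exact Nat.xor_lt_two_pow (n := 3) hi hj
  right := fun hi hj hk => (octTable_laws hi hj hk).1
  left := fun hi hj hk => (octTable_laws hi hj hk).2

end Alt

namespace Alt

/-- A multiple of an octonion unit: whether it is nonzero, its sign, and the unit. -/
structure OctState (α : Type) where
  nz : α
  neg : α
  unit : α × α × α

/-- The sum of two triples of bits. -/
def xor₃ (a b : Bool × Bool × Bool) : Bool × Bool × Bool :=
  (xor a.1 b.1, xor a.2.1 b.2.1, xor a.2.2 b.2.2)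

def octAsc (x y z : Bool × Bool × Bool) : OctState Bool :=
  ⟨xor (xor (octExp x y) (octExp (xor₃ x y) z)) (xor (octExp y z) (octExp x (xor₃ y z))),
    xor (octExp x y) (octExp (xor₃ x y) z), xor₃ (xor₃ x y) z⟩

def octOp (k : Bool) (x : Bool × Bool × Bool) (v : OctState Bool) : OctState Bool :=
  ⟨v.nz && xor k (xor (octExp x v.unit) (octExp v.unit x)), xor v.neg (octExp x v.unit), xor₃ x v.unit⟩

def octOps (x : ℕ → Bool × Bool × Bool) (v : OctState Bool) : List (Bool × ℕ) → OctState Bool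
  | [] => v
  | p :: l => octOp p.1 (x p.2) (octOps x v l)

/-- The number of an octonion unit. -/
def unbits (a : Bool × Bool × Bool) : ℕ := a.1.toNat + (2 * a.2.1.toNat + 4 * a.2.2.toNat)

lemma bits_unbits : ∀ a, bits (unbits a) = a := by decide

lemma unbits_xor : ∀ a b, Nat.xor (unbits a) (unbits b) = unbits (xor₃ a b) := by decide

lemma unbits_lt : ∀ a, unbits a < 8 := by decide

/-- The sign of an octonion unit. -/
def OctState.coef (v : OctState Bool) : ℤ := cond v.nz (cond v.neg (-1) 1) 0

noncomputable def OctState.vec (v : OctState Bool) : ℕ →₀ ℚ := (v.coef : ℚ) • bas (unbits v.unit)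

lemma tmul_octTable (a b : Bool × Bool × Bool) : tmul octTable (bas (unbits a)) (bas (unbits b)) =
    (((cond (octExp a b) (-1) 1 : ℤ)) : ℚ) • bas (unbits (xor₃ a b)) := by
  rw [tmul_bas, octTable, val, val, add_zero, bits_unbits, bits_unbits, unbits_xor, single_eq_smul_bas]

lemma xor₃_comm (a b : Bool × Bool × Bool) : xor₃ a b = xor₃ b a := by
  simp [xor₃, Bool.xor_comm]

lemma xor₃_assoc (a b c : Bool × Bool × Bool) : xor₃ (xor₃ a b) c = xor₃ a (xor₃ b c) := by
  simp [xor₃]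

lemma asc_octTable (a b c : Bool × Bool × Bool) :
    asc (tmul octTable) (bas (unbits a)) (bas (unbits b)) (bas (unbits c)) = (2 : ℚ) • (octAsc a b c).vec := by
  rw [asc, tmul_octTable, tmul_octTable, map_smul, map_smul, LinearMap.smul_apply, tmul_octTable,
    tmul_octTable, OctState.vec, OctState.coef, octAsc, xor₃_assoc]
  cases octExp a b <;> cases octExp (xor₃ a b) c <;> cases octExp b c <;> cases octExp a (xor₃ b c) <;>
    norm_num <;> module

lemma op_octTable (k : Bool) (x : Bool × Bool × Bool) (v : OctState Bool) :
    tmul octTable (bas (unbits x)) v.vec + ((cond k 1 (-1) : ℤ) : ℚ) • tmul octTable v.vec (bas (unbits x)) =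
      (2 : ℚ) • (octOp k x v).vec := by
  rw [OctState.vec, map_smul, map_smul, LinearMap.smul_apply, tmul_octTable, tmul_octTable,
    xor₃_comm v.unit, OctState.vec, OctState.coef, OctState.coef, octOp]
  cases octExp x v.unit <;> cases octExp v.unit x <;> cases v.nz <;> cases v.neg <;> cases k <;>
    norm_num <;> module

lemma val_opsAt_octTable (x : ℕ → Bool × Bool × Bool) {c : ℚ} {v : List (ℕ × ℤ)} {s : OctState Bool}
    (hv : val v = c • s.vec) (l : List (Bool × ℕ)) :
    val (opsAt octTable (fun _ _ => 1) (fun p => unbits (x p)) v l) = (2 ^ l.length * c) • (octOps x s l).vec := by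
  induction l with
  | nil => simpa [opsAt, octOps] using hv
  | cons p l ih =>
    have := op_octTable p.1 (x p.2) (octOps x s l)
    rw [opsAt, val_omul, ih, val, add_zero, octOps, List.length_cons, map_smul, map_smul, LinearMap.smul_apply,
      pow_succ, mul_right_comm, mul_smul _ (2 : ℚ), ← this, show Int.neg 1 = -1 from rfl]
    module

/-- The value of a word in octonion units, up to a power of two. -/
def octWord (x : ℕ → Bool × Bool × Bool) (y : Word) : OctState Bool :=
  octOps x (octAsc (x y.x) (x y.y) (x y.z)) y.ops

lemma map_word_octTable {n : ℕ} (x : ℕ → Bool × Bool × Bool)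
    (h : IsTwisted n (fun _ => 1) (tmul octTable) fun p => bas (unbits (x p))) (y : Word)
    (hy : ∀ p ∈ y.letters, p < n) :
    h.map [] [] (y.ev (freeMul n) (gen n)) = (2 ^ y.ops.length * 2 : ℚ) • (octWord x y).vec := by
  rw [map_word h isSign_one y hy, one_smul]
  refine val_opsAt_octTable x ?_ _
  rw [val_ascAt, val, add_zero, Int.cast_one, one_smul, asc_octTable]

/-- Bitwise version of `octExp`. -/
def octExpN (a b : ℕ × ℕ × ℕ) : ℕ :=
  Nat.xor (Nat.xor (Nat.xor (Nat.xor (Nat.land a.1 b.1) (Nat.land a.1 b.2.1))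
    (Nat.xor (Nat.land a.1 b.2.2) (Nat.land a.2.1 b.2.1)))
    (Nat.xor (Nat.land a.2.1 b.2.2) (Nat.land a.2.2 b.2.2)))
    (Nat.xor (Nat.xor (Nat.land (Nat.land b.1 a.2.1) a.2.2) (Nat.land (Nat.land a.1 b.2.1) a.2.2))
      (Nat.land (Nat.land a.1 a.2.1) b.2.2))

def xorN {α : Type} (a b : ℕ × ℕ × ℕ) (f : ℕ × ℕ × ℕ → α) : α :=
  force (Nat.xor a.1 b.1) fun u => force (Nat.xor a.2.1 b.2.1) fun v => force (Nat.xor a.2.2 b.2.2) fun w =>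
  f (u, v, w)

/-- Bitwise version of `octAsc`. -/
def octAscN {α : Type} (x y z : ℕ × ℕ × ℕ) (f : OctState ℕ → α) : α :=
  xorN x y fun a => xorN y z fun b => xorN a z fun c =>
  force (Nat.xor (octExpN x y) (octExpN a z)) fun s =>
  force (Nat.xor s (Nat.xor (octExpN y z) (octExpN x b))) fun t => f ⟨t, s, c⟩

/-- Bitwise version of `octOp`. -/
def octOpN {α : Type} (one : ℕ) (k : Bool) (x : ℕ × ℕ × ℕ) (v : OctState ℕ) (f : OctState ℕ → α) : α :=
  force (octExpN x v.unit) fun s => force (octExpN v.unit x) fun t => xorN x v.unit fun u =>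
  force (Nat.land v.nz (Nat.xor (cond k one 0) (Nat.xor s t))) fun nz => force (Nat.xor v.neg s) fun neg =>
  f ⟨nz, neg, u⟩

def octOpsN {α : Type} (one : ℕ) (x : ℕ → ℕ × ℕ × ℕ) (v : OctState ℕ) :
    List (Bool × ℕ) → (OctState ℕ → α) → α
  | [], f => f v
  | p :: l, f => octOpsN one x v l fun v => octOpN one p.1 (x p.2) v f

/-- The values modulo `5` of a word for the octonion units in several lanes. -/
def octRow {α : Type} (one : ℕ) (x : ℕ → ℕ × ℕ × ℕ) (y : Word) (f : ℕ → α) : α :=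
  octAscN (x y.x) (x y.y) (x y.z) fun v => octOpsN one x v y.ops fun v =>
  force (Nat.land v.nz one) fun a => force (Nat.add a (Nat.mul 3 (Nat.land a v.neg))) f

/-- The bits of the entries of a triple. -/
def lane (i : ℕ) (a : ℕ × ℕ × ℕ) : Bool × Bool × Bool := (a.1.testBit i, a.2.1.testBit i, a.2.2.testBit i)

def OctState.lane (i : ℕ) (v : OctState ℕ) : OctState Bool :=
  ⟨v.nz.testBit i, v.neg.testBit i, Alt.lane i v.unit⟩

lemma testBit_xor' (i a b : ℕ) : (Nat.xor a b).testBit i = xor (a.testBit i) (b.testBit i) := Nat.testBit_xor ..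

lemma testBit_and' (i a b : ℕ) : (Nat.land a b).testBit i = (a.testBit i && b.testBit i) := Nat.testBit_and ..

lemma testBit_octExpN (i : ℕ) (a b : ℕ × ℕ × ℕ) : (octExpN a b).testBit i = octExp (lane i a) (lane i b) := by
  simp only [octExpN, octExp, lane, testBit_xor', testBit_and']

lemma lane_xor (i : ℕ) (a b : ℕ × ℕ × ℕ) :
    lane i (Nat.xor a.1 b.1, Nat.xor a.2.1 b.2.1, Nat.xor a.2.2 b.2.2) = xor₃ (lane i a) (lane i b) := by
  simp only [lane, xor₃, testBit_xor']

variable {α : Type}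

lemma octAscN_eq (x y z : ℕ × ℕ × ℕ) (f : OctState ℕ → α) : octAscN x y z f = f (octAscN x y z id) := by
  simp only [octAscN, xorN, force_eq, id]

lemma octOpN_eq (one : ℕ) (k : Bool) (x : ℕ × ℕ × ℕ) (v : OctState ℕ) (f : OctState ℕ → α) :
    octOpN one k x v f = f (octOpN one k x v id) := by
  simp only [octOpN, xorN, force_eq, id]

lemma octOpsN_eq (one : ℕ) (x : ℕ → ℕ × ℕ × ℕ) (v : OctState ℕ) (l : List (Bool × ℕ)) (f : OctState ℕ → α) :
    octOpsN one x v l f = f (octOpsN one x v l id) := by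
  induction l generalizing α with
  | nil => rfl
  | cons p l ih =>
    rw [octOpsN, octOpsN, ih, octOpN_eq, ih fun v => octOpN one p.1 (x p.2) v id]

lemma lane_octAscN (i : ℕ) (x y z : ℕ × ℕ × ℕ) :
    (octAscN x y z id).lane i = octAsc (lane i x) (lane i y) (lane i z) := by
  simp only [octAscN, xorN, force_eq, id, OctState.lane, octAsc, testBit_xor', testBit_octExpN, lane_xor,
    OctState.mk.injEq, true_and]
  simp only [lane, xor₃, testBit_xor']

lemma lane_octOpN {i one : ℕ} (h1 : one.testBit i = true) (k : Bool) (x : ℕ × ℕ × ℕ) (v : OctState ℕ) :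
    (octOpN one k x v id).lane i = octOp k (lane i x) (v.lane i) := by
  cases k <;>
  simp only [octOpN, xorN, force_eq, id, OctState.lane, octOp, testBit_xor', testBit_octExpN, lane_xor,
    testBit_and', cond_true, cond_false, h1, Nat.zero_testBit]

lemma lane_octOpsN {i one : ℕ} (h1 : one.testBit i = true) (x : ℕ → ℕ × ℕ × ℕ) (v : OctState ℕ)
    (l : List (Bool × ℕ)) : (octOpsN one x v l id).lane i = octOps (fun p => lane i (x p)) (v.lane i) l := by
  induction l with
  | nil => rfl
  | cons p l ih => rw [octOpsN, octOpsN_eq, octOps, lane_octOpN h1, ih]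

lemma dg_one (L i : ℕ) : dg 16 (mask 16 1 L) i = if i < L then 1 else 0 := dg_mask (by norm_num) _ _

lemma dg_and_one (a L i : ℕ) :
    dg 16 (a &&& mask 16 1 L) i = if i < L then (a.testBit (16 * i)).toNat else 0 := by
  rw [dg_and, dg_one]
  split_ifs with h
  · rw [Nat.and_one_is_mod, dg_eq, Nat.mod_mod_of_dvd _ (by norm_num), Nat.toNat_testBit, Nat.shiftRight_eq_div_pow]
  · exact Nat.and_zero _

lemma testBit_one {L i : ℕ} (h : i < L) : (mask 16 1 L).testBit (16 * i) = true := by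
  have := dg_and_one (mask 16 1 L) L i
  rw [Nat.and_self, dg_one, if_pos h, if_pos h] at this
  cases hb : (mask 16 1 L).testBit (16 * i)
  · rw [hb] at this; exact absurd this (by decide)
  · rfl

lemma land_right_comm (a b c : ℕ) : a &&& b &&& c = a &&& c &&& b := by
  rw [Nat.land_assoc, Nat.land_comm b, Nat.land_assoc]

lemma octRow_eq (one : ℕ) (x : ℕ → ℕ × ℕ × ℕ) (y : Word) (f : ℕ → α) :
    octRow one x y f = f (octRow one x y id) := by
  simp only [octRow, force_eq, id]
  rw [octAscN_eq, octOpsN_eq]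
  conv_rhs => rw [octAscN_eq, octOpsN_eq]

lemma dg_octRow (L : ℕ) (x : ℕ → ℕ × ℕ × ℕ) (y : Word) (i : ℕ) : dg 16 (octRow (mask 16 1 L) x y id) i =
    if i < L then ((octWord (fun p => lane (16 * i) (x p)) y).coef % 5).toNat else 0 := by
  have e : octRow (mask 16 1 L) x y id = (fun v : OctState ℕ => (v.nz &&& mask 16 1 L) +
      3 * (v.nz &&& mask 16 1 L &&& v.neg)) (octOpsN (mask 16 1 L) x (octAscN (x y.x) (x y.y) (x y.z) id) y.ops id) := by
    rw [octRow, octAscN_eq, octOpsN_eq]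
    simp only [force_eq]
    rfl
  rw [e]
  generalize hv : octOpsN (mask 16 1 L) x (octAscN (x y.x) (x y.y) (x y.z) id) y.ops id = v
  have h3 : ∀ i, 3 * dg 16 (v.nz &&& mask 16 1 L &&& v.neg) i ≤ 3 := fun i => by
    rw [land_right_comm, dg_and_one]
    split_ifs
    · cases (v.nz &&& v.neg).testBit (16 * i) <;> simp
    · simp
  have h1 : ∀ i, dg 16 (v.nz &&& mask 16 1 L) i ≤ 1 := fun i => by
    rw [dg_and_one]
    split_ifs
    · cases v.nz.testBit (16 * i) <;> simp
    · simp
  have hm := dg_mul (w := 16) (c := 3) (a := v.nz &&& mask 16 1 L &&& v.neg) fun i => (h3 i).trans_lt (by norm_num)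
  change dg 16 (_ + _) i = _
  rw [dg_add (fun i => by rw [hm]; have := h3 i; have := h1 i; omega), hm, land_right_comm, dg_and_one, dg_and_one]
  split_ifs with h
  · have := lane_octOpsN (testBit_one h) x (octAscN (x y.x) (x y.y) (x y.z) id) y.ops
    rw [hv, lane_octAscN] at this
    rw [octWord, ← this, OctState.coef, OctState.lane, Nat.testBit_and]
    cases v.nz.testBit (16 * i) <;> cases v.neg.testBit (16 * i) <;> rfl
  · rfl

end Alt

namespace Alt

/-- `pack`, with values that are evaluated. -/
def packN {α : Type} (W : ℕ) : List ℕ → ℕ → (ℕ → α) → α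
  | [], r, f => f r
  | u :: l, r, f => force (Nat.add (Nat.shiftLeft r W) u) fun r => packN W l r f

/-- Successive triples of bit planes. -/
def planes {α : Type} : ℕ → ℕ → List (ℕ × ℕ × ℕ) → (List (ℕ × ℕ × ℕ) → α) → α
  | 0, _, l, f => f l
  | m + 1, a, l, f => force (Nat.shiftRight a 1) fun b => force (Nat.shiftRight a 2) fun c =>
      force (Nat.shiftRight a 3) fun a' => planes m a' ((a, b, c) :: l) f

/-- The bit planes of a list of six-digit octal numbers. -/
def lanePlanes {α : Type} (l : List ℕ) (f : List (ℕ × ℕ × ℕ) → α) : α :=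
  packN 16 (l.map fun c => Nat.mod c 512) 0 fun a => packN 16 (l.map fun c => Nat.div c 512) 0 fun b =>
  planes 3 a [] fun l => planes 3 b l f

/-- The entry of a list of triples. -/
def nth : ℕ → List (ℕ × ℕ × ℕ) → ℕ × ℕ × ℕ
  | _, [] => (0, 0, 0)
  | 0, a :: _ => a
  | i + 1, _ :: l => nth i l

/-- A complete binary tree. -/
inductive BinTree where
  | leaf (v : ℕ)
  | node (a b : BinTree)

/-- The table of a function of lists of bits of a given length. -/
def tabulate {α : Type} : ℕ → (List Bool → ℕ) → (BinTree → α) → α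
  | 0, f, k => force (f []) fun v => k (.leaf v)
  | m + 1, f, k => tabulate m (fun l => f (true :: l)) fun a => tabulate m (fun l => f (false :: l)) fun b =>
      k (.node a b)

noncomputable def lookup (t : BinTree) : List Bool → ℕ :=
  BinTree.rec (fun v _ => v) (fun _ _ f g l => List.rec 0 (fun k l _ => cond k (f l) (g l)) l) t

/-- The value of an operator word in the first two basis vectors, given by bits. -/
def bitWord : ℕ → List Bool → List (ℕ × ℤ)
  | 0, [a, b, c] => ascAt superTable 1 a.toNat b.toNat c.toNat []
  | m + 1, k :: a :: l => omul superTable (cond k (blockSign 1 (m + 3)) (Int.neg (blockSign 1 (m + 3)))) a.toNat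
      (bitWord m l) []
  | _, _ => []

/-- The bits of a word in which the letters are replaced by bits. -/
def wordBits (x : ℕ → Bool) (a b c : ℕ) (l : List (Bool × ℕ)) : List Bool :=
  List.rec [x a, x b, x c] (fun p _ l => p.1 :: x p.2 :: l) l

def digit (c : ℤ) : ℕ := Int.toNat (Int.emod c 5)

/-- The last five coefficients modulo `5` of the value of a word. -/
def superDigits (m : ℕ) (l : List Bool) : ℕ :=
  pack 3 ((below 5).map fun j => digit (coefAt (Nat.add 43 j) (bitWord m l))) 0

/-- `Nat.testBit` in terms of basic operations. -/
def bit (a i : ℕ) : Bool := Nat.beq (Nat.mod (Nat.shiftRight a i) 2) 1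

/-- An entry of a row for the superalgebra. -/
noncomputable def superEntry (t : BinTree) (p : ℕ × Word) (q : ℕ × ℕ) : ℕ :=
  Nat.mul p.1 (Nat.land (Nat.shiftRight
    (lookup t (wordBits (bit q.2) p.2.x p.2.y p.2.z p.2.ops)) (Nat.mul 3 q.1)) 7)

/-- The values of a word modulo `5`. -/
noncomputable def basisRow {α : Type} (one : ℕ) (x : ℕ → ℕ × ℕ × ℕ) (t : BinTree) (cols : List (ℕ × ℕ)) (p : ℕ × Word)
    (f : ℕ → α) : α :=
  octRow one x p.2 fun r => packN 16 (cols.map (superEntry t p)) r f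

noncomputable def basisRows (W one : ℕ) (x : ℕ → ℕ × ℕ × ℕ) (t : BinTree) (cols : List (ℕ × ℕ)) (f : ℕ → Bool) :
    List (ℕ × Word) → ℕ → Bool
  | [], r => f r
  | p :: l, r => basisRow one x t cols p fun u => force (Nat.add (Nat.shiftLeft r W) u)
      (basisRows W one x t cols f l)

/-- The operators of a word with a given code. -/
def codeOps (c i n : ℕ) : ℕ → List (Bool × ℕ)
  | 0 => []
  | m + 1 => (Nat.testBit c (Nat.add (Nat.mul 4 n) i), lt c i) :: codeOps c (i + 1) n m

/-- The word in `m + 3` letters with a given code. -/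
def codeWord (m c : ℕ) : Word := ⟨codeOps c 0 (m + 3) m, lt c m, lt c (m + 1), lt c (m + 2)⟩

/-- The words with given codes, with their signs modulo `5`. -/
def codeWords (m : ℕ) (l : List ℕ) : List (ℕ × Word) :=
  l.map fun c => (digit (permSign (codeWord m c).letters), codeWord m c)

noncomputable def isBasis (m K : ℕ) (lanes : List ℕ) (cols : List (ℕ × ℕ)) (words ss : List ℕ) : Bool :=
  withMasks (16 * K) (K / 2) ss.length fun M => force (mask 16 1 lanes.length) fun one =>
  lanePlanes lanes fun pl => tabulate (2 * m + 3) (superDigits m) fun t =>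
  forceTerms (codeWords m words) fun ws =>
  basisRows (16 * K) one (fun i => nth i pl) t cols (indep M (16 * K) ss) ws 0

lemma packN_eq {α : Type} (W : ℕ) (l : List ℕ) (r : ℕ) (f : ℕ → α) : packN W l r f = f (pack W l r) := by
  induction l generalizing r with
  | nil => rfl
  | cons u l ih => rw [packN, force_eq, ih]; rfl

lemma planes_eq {α : Type} (m a : ℕ) (l : List (ℕ × ℕ × ℕ)) (f : List (ℕ × ℕ × ℕ) → α) :
    planes m a l f = f (planes m a l id) := by
  induction m generalizing a l with
  | zero => rfl
  | succ m ih => simp only [planes, force_eq, ih _ _]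

lemma lanePlanes_eq {α : Type} (l : List ℕ) (f : List (ℕ × ℕ × ℕ) → α) :
    lanePlanes l f = f (lanePlanes l id) := by
  simp only [lanePlanes, packN_eq]
  rw [planes_eq, planes_eq, planes_eq (f := fun l => planes _ _ l id)]

noncomputable def tree : ℕ → (List Bool → ℕ) → BinTree
  | 0, f => .leaf (f [])
  | m + 1, f => .node (tree m fun l => f (true :: l)) (tree m fun l => f (false :: l))

lemma tabulate_eq {α : Type} (m : ℕ) (f : List Bool → ℕ) (k : BinTree → α) :
    tabulate m f k = k (tree m f) := by
  induction m generalizing f k with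
  | zero => rw [tabulate, force_eq, tree]
  | succ m ih => rw [tabulate, ih, ih, tree]

lemma lookup_tree {m : ℕ} (f : List Bool → ℕ) {l : List Bool} (hl : l.length = m) : lookup (tree m f) l = f l := by
  induction m generalizing f l with
  | zero => rw [List.length_eq_zero_iff.1 hl]; rfl
  | succ m ih =>
    obtain _ | ⟨k, l⟩ := l
    · simp at hl
    · have h : l.length = m := by simpa using hl
      change cond k (lookup (tree m _) l) (lookup (tree m _) l) = _
      rw [ih _ h, ih _ h]
      cases k <;> rfl

lemma length_wordBits (x : ℕ → Bool) (a b c : ℕ) (l : List (Bool × ℕ)) :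
    (wordBits x a b c l).length = 2 * l.length + 3 := by
  induction l with
  | nil => rfl
  | cons p l ih =>
    change (p.1 :: x p.2 :: wordBits x a b c l).length = _
    rw [List.length_cons, List.length_cons, List.length_cons, ih]
    omega

lemma bitWord_wordBits (x : ℕ → Bool) (a b c : ℕ) (l : List (Bool × ℕ)) :
    bitWord l.length (wordBits x a b c l) = opsAt superTable blockSign (fun p => (x p).toNat)
      (ascAt superTable 1 (x a).toNat (x b).toNat (x c).toNat []) l := by
  induction l with
  | nil => rfl
  | cons p l ih =>
    change bitWord (l.length + 1) (p.1 :: x p.2 :: wordBits x a b c l) = _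
    rw [bitWord, ih, opsAt]

lemma digit_le (c : ℤ) : digit c ≤ 4 := by
  have : digit c = (c % 5).toNat := rfl
  omega

lemma digit_cast (c : ℤ) : (digit c : ZMod 5) = c := by
  have h : ((digit c : ℤ)) = c % 5 := Int.toNat_of_nonneg (Int.emod_nonneg c (by norm_num))
  rw [← Int.cast_natCast, h]
  exact ZMod.intCast_mod c 5

/-- The coefficient of a basis vector in the value of a word in the first two basis vectors. -/
def superWord (x : ℕ → Bool) (y : Word) (i : ℕ) : ℤ := coefAt i (opsAt superTable blockSign (fun p => (x p).toNat)
  (ascAt superTable 1 (x y.x).toNat (x y.y).toNat (x y.z).toNat []) y.ops)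

lemma superEntry_eq {m : ℕ} {p : ℕ × Word} (hp : p.2.ops.length = m) {q : ℕ × ℕ} (hq : q.1 < 5) :
    superEntry (tree (2 * m + 3) (superDigits m)) p q = p.1 * digit (superWord (bit q.2) p.2 (43 + q.1)) := by
  subst hp
  rw [superEntry, lookup_tree _ (length_wordBits _ _ _ _ _)]
  change p.1 * ((_ >>> (3 * q.1)) &&& (2 ^ 3 - 1)) = _
  rw [Nat.and_two_pow_sub_one_eq_mod, ← dg_eq, superDigits, bitWord_wordBits, dg_pack, dif_pos (by simpa [below] using hq)]
  · congr 1
    obtain ⟨j, S⟩ := q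
    interval_cases j <;> rfl
  · intro u hu
    obtain ⟨j, -, rfl⟩ := List.mem_map.1 hu
    exact (digit_le _).trans_lt (by norm_num)

lemma basisRow_eq {α : Type} (one : ℕ) (x : ℕ → ℕ × ℕ × ℕ) (t : BinTree) (cols : List (ℕ × ℕ)) (p : ℕ × Word)
    (f : ℕ → α) : basisRow one x t cols p f = f (pack 16 (cols.map (superEntry t p)) (octRow one x p.2 id)) := by
  rw [basisRow, octRow_eq, packN_eq]

lemma basisRows_eq (W one : ℕ) (x : ℕ → ℕ × ℕ × ℕ) (t : BinTree) (cols : List (ℕ × ℕ)) (f : ℕ → Bool)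
    (l : List (ℕ × Word)) (r : ℕ) : basisRows W one x t cols f l r =
      f (pack W (l.map fun p => pack 16 (cols.map (superEntry t p)) (octRow one x p.2 id)) r) := by
  induction l generalizing r with
  | nil => rfl
  | cons p l ih => rw [basisRows, basisRow_eq, force_eq, ih]; rfl

/-- The values of a word in units of the octonions and in basis vectors of the superalgebra. -/
def entryAt (L : ℕ) (x : ℕ → ℕ × ℕ × ℕ) (cols : List (ℕ × ℕ)) (y : Word) (c : ℕ) : ℤ :=
  if h : c < cols.length then
    permSign y.letters * superWord (bit (cols.reverse[c]'(by simpa)).2) y (43 + (cols.reverse[c]'(by simpa)).1)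
  else if c - cols.length < L then (octWord (fun p => lane (16 * (c - cols.length)) (x p)) y).coef else 0

lemma dg_basisRow {m L : ℕ} (x : ℕ → ℕ × ℕ × ℕ) {cols : List (ℕ × ℕ)} (hc : ∀ q ∈ cols, q.1 < 5) {y : Word}
    (hy : y.ops.length = m) (c : ℕ) :
    ∃ d, dg 16 (pack 16 (cols.map (superEntry (tree (2 * m + 3) (superDigits m)) (digit (permSign y.letters), y)))
      (octRow (mask 16 1 L) x y id)) c = d ∧ d ≤ 16 ∧ (cols.length + L ≤ c → d = 0) ∧
      (d : ZMod 5) = entryAt L x cols y c := by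
  refine ⟨_, rfl, ?_⟩
  have hs : ∀ q ∈ cols, superEntry (tree (2 * m + 3) (superDigits m)) (digit (permSign y.letters), y) q =
      digit (permSign y.letters) * digit (superWord (bit q.2) y (43 + q.1)) := fun q hq =>
    superEntry_eq (p := (digit (permSign y.letters), y)) hy (hc q hq)
  have hle : ∀ a b : ℤ, digit a * digit b ≤ 16 := fun a b => Nat.mul_le_mul (digit_le a) (digit_le b)
  rw [dg_pack]
  · simp only [List.length_map, dg_octRow, entryAt]
    split_ifs with h1 h2
    · have h3 : cols.length - 1 - c < cols.length := by omega
      simp only [List.getElem_reverse, List.length_map, List.getElem_map, hs _ (List.getElem_mem h3)]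
      refine ⟨hle _ _, fun h => absurd h1 (by omega), ?_⟩
      rw [Nat.cast_mul, digit_cast, digit_cast, Int.cast_mul]
    · exact ⟨(digit_le _).trans (by norm_num), fun h => absurd h2 (by omega), digit_cast _⟩
    · simp
  · intro u hu
    obtain ⟨q, hq, rfl⟩ := List.mem_map.1 hu
    rw [hs q hq]
    exact (hle _ _).trans_lt (by norm_num)

theorem linearIndependent_entryAt {m K : ℕ} {lanes : List ℕ} {cols : List (ℕ × ℕ)} {words ss : List ℕ}
    (h : isBasis m K lanes cols words ss = true) (hK : 2 ≤ K) (hK' : 2 * (K / 2) = K) (hk : K ≤ 1000)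
    (hc : ∀ q ∈ cols, q.1 < 5) (hL : cols.length + lanes.length ≤ K)
    (hw : words.length = ss.length) (hs : ss.length ≤ K) (hm : ∀ c ∈ words, (codeWord m c).ops.length = m) :
    ∃ x : ℕ → ℕ × ℕ × ℕ, LinearIndependent ℚ fun (r : Fin words.length) (c : ℕ) =>
      (entryAt lanes.length x cols (codeWord m (words.reverse[r]'(by simp))) c : ℚ) := by
  obtain ⟨M, hM, h⟩ := withMasks_spec (K := K) (by omega) rfl h
  refine ⟨fun i => nth i (lanePlanes lanes id), ?_⟩
  generalize hx : (fun i => nth i (lanePlanes lanes id)) = x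
  rw [force_eq, lanePlanes_eq, tabulate_eq, forceTerms_eq, basisRows_eq, hx, codeWords, List.map_map] at h
  set R := words.map _ with hR
  have hdg : ∀ c ∈ words, ∀ i, ∃ d, _ := fun c hc' i => dg_basisRow (m := m) (L := lanes.length) x hc (hm c hc') i
  have hlt : ∀ u ∈ R, u < 2 ^ (16 * K) := by
    intro u hu
    obtain ⟨c, hc', rfl⟩ := List.mem_map.1 hu
    rw [pow_mul]
    refine lt_pow_of_dg (by norm_num) fun i hi => ?_
    obtain ⟨d, h1, -, h2, -⟩ := hdg c hc' i
    exact h1.trans (h2 (by omega))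
  have hpack := dg_pack R hlt 0
  have hlen : R.length = words.length := by simp [hR]
  have hrow : ∀ r (hr : r < words.length), ∃ c ∈ words, c = words.reverse[r]'(by simpa) ∧
      dg (16 * K) (pack (16 * K) R 0) r = pack 16 (cols.map (superEntry (tree (2 * m + 3) (superDigits m))
        (digit (permSign (codeWord m c).letters), codeWord m c)))
        (octRow (mask 16 1 lanes.length) x (codeWord m c) id) := fun r hr => by
    refine ⟨_, List.mem_reverse.1 (List.getElem_mem (by simpa)), rfl, ?_⟩
    rw [hpack, dif_pos (by rwa [hlen])]
    simp [hR]
  have key := linearIndependent_of_indep (m := 60000) hM hK ss _ h le_rfl (fun r c => by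
    have : dg 16 (dg (16 * K) (pack (16 * K) R 0) r) c ≤ 16 := by
      by_cases hr : r < words.length
      · obtain ⟨a, ha, -, e⟩ := hrow r hr
        obtain ⟨d, h1, h2, -⟩ := hdg a ha c
        rw [e]
        exact h1.trans_le h2
      · rw [hpack, dif_neg (by rwa [hlen]), dg_of_zero, dg_of_zero]
        norm_num
    omega) (by norm_num)
  rw [← hw] at key
  have : Fact (Nat.Prime 5) := ⟨by norm_num⟩
  refine linearIndependent_rat_of_zmod (p := 5) _ ?_
  have e : (fun (r : Fin words.length) (c : ℕ) => ((entryAt lanes.length x cols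
      (codeWord m (words.reverse[r]'(by simp))) c : ℤ) : ZMod 5)) =
      fun r : Fin words.length => row (16 * K) (pack (16 * K) R 0) r := by
    funext r c
    obtain ⟨a, ha, e0, e⟩ := hrow r r.2
    obtain ⟨d, h1, -, -, h2⟩ := hdg _ ha c
    rw [row, e, h1, h2, e0]
    rfl
  rw [e]
  exact key

end Alt

namespace Alt

lemma length_codeOps (c i n m : ℕ) : (codeOps c i n m).length = m := by
  induction m generalizing i with
  | zero => rfl
  | succ m ih => rw [codeOps, List.length_cons, ih]

lemma exists_entryAt (n m L : ℕ) (x : ℕ → ℕ × ℕ × ℕ) (cols : List (ℕ × ℕ)) (c : ℕ) :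
    ∃ φ : (FreeNA n ⧸ altIdeal n) →ₗ[ℚ] ℚ, ∀ y : Word, y.ops.length = m → (∀ p ∈ y.letters, p < n) →
      φ (y.ev (freeMul n) (gen n)) = entryAt L x cols y c := by
  by_cases h1 : c < cols.length
  · let q := cols.reverse[c]'(by simpa)
    have h := isSuper_superTable.isTwisted (n := n) (x := fun p => (bit q.2 p).toNat)
      (fun p => by cases bit q.2 p <;> decide) isSign_permSign
    refine ⟨Finsupp.lapply (43 + q.1) ∘ₗ h.map [] [], fun y _ hy => ?_⟩
    rw [LinearMap.comp_apply, map_word h isSign_permSign y hy, map_smul, Finsupp.lapply_apply, val_apply,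
      entryAt, dif_pos h1, Int.cast_mul]
    rfl
  · by_cases h2 : c - cols.length < L
    · have h := isSuper_octTable.isTwisted (n := n) (x := fun p => unbits (lane (16 * (c - cols.length)) (x p)))
        (fun p => unbits_lt _) isSign_one
      refine ⟨(2 ^ m * 2 : ℚ)⁻¹ • Finsupp.linearCombination ℚ (fun _ => (1 : ℚ)) ∘ₗ h.map [] [], fun y hm hy => ?_⟩
      rw [LinearMap.smul_apply, LinearMap.comp_apply,
        map_word_octTable (fun p => lane (16 * (c - cols.length)) (x p)) h y hy, entryAt, dif_neg h1, if_pos h2,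
        map_smul, hm, smul_smul, inv_mul_cancel₀ (by positivity), one_smul, OctState.vec, map_smul, bas,
        Finsupp.linearCombination_single, one_smul, smul_eq_mul, mul_one]
    · exact ⟨0, fun y _ _ => by rw [entryAt, dif_neg h1, if_neg h2]; simp⟩

/-- Every word contains all letters. -/
def isMultilinear (m : ℕ) (words : List ℕ) : Bool :=
  words.all fun c => (List.range (m + 3)).all fun i => (codeWord m c).letters.any (Nat.beq i)

lemma letters_perm {m : ℕ} {words : List ℕ} (h : isMultilinear m words = true) {c : ℕ} (hc : c ∈ words) :
    (codeWord m c).letters.Perm (List.range (m + 3)) := by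
  have hs : List.range (m + 3) ⊆ (codeWord m c).letters := fun i hi => by
    obtain ⟨j, hj, e⟩ := List.any_eq_true.1 (List.all_eq_true.1 (List.all_eq_true.1 h c hc) i hi)
    rwa [Nat.eq_of_beq_eq_true e]
  refine ((List.nodup_range.subperm hs).perm_of_length_le ?_).symm
  simp [Word.letters, codeWord, length_codeOps]

theorem linearIndependent_ev {m K : ℕ} {lanes : List ℕ} {cols : List (ℕ × ℕ)} {words ss : List ℕ}
    (h : isBasis m K lanes cols words ss = true) (hK : 2 ≤ K) (hK' : 2 * (K / 2) = K) (hk : K ≤ 1000)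
    (hc : ∀ q ∈ cols, q.1 < 5) (hL : cols.length + lanes.length ≤ K)
    (hw : words.length = ss.length) (hs : ss.length ≤ K) (hm : isMultilinear m words = true) :
    LinearIndependent ℚ fun r : Fin words.length =>
      (codeWord m (words.reverse[r]'(by simp))).ev (freeMul (m + 3)) (gen (m + 3)) := by
  obtain ⟨x, hx⟩ := linearIndependent_entryAt h hK hK' hk hc hL hw hs fun c _ => length_codeOps ..
  choose φ hφ using exists_entryAt (m + 3) m lanes.length x cols
  refine LinearIndependent.of_comp (LinearMap.pi φ) ?_
  convert hx using 1
  · funext r c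
    refine hφ c _ (length_codeOps ..) fun p hp => ?_
    exact List.mem_range.1 ((letters_perm hm (List.mem_reverse.1 (List.getElem_mem (by simp)))).mem_iff.1 hp)
  · rfl

end Alt

namespace Alt
section
variable {n : ℕ}

/-- The span of the monomials with given letters. -/
noncomputable def spanMonomials (n : ℕ) (s : Multiset ℕ) : Submodule ℚ (FreeNA n ⧸ altIdeal n) :=
  Submodule.span ℚ {m | ∃ t : FreeMagma ℕ, t.vars = s ∧ m = mev (freeMul n) (gen n) t}

lemma exists_mev_eq (t : FreeMagma (Fin n)) : ∃ s : FreeMagma ℕ, s.vars = t.vars.map Fin.val ∧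
    mev (freeMul n) (gen n) s = (altIdeal n).mkQ (MonoidAlgebra.single t 1) := by
  induction t with
  | ih1 a => exact ⟨.of a, rfl, gen_of_lt a.2⟩
  | ih2 a b ha hb =>
    obtain ⟨s, hs, es⟩ := ha
    obtain ⟨t, ht, et⟩ := hb
    refine ⟨.mul s t, ?_, ?_⟩
    · change s.vars + t.vars = (a.vars + b.vars).map _
      rw [hs, ht, Multiset.map_add]
    · rw [mev, es, et, freeMul_mk, MonoidAlgebra.single_mul_single, one_mul]

lemma exists_eq_mev (s : FreeMagma ℕ) (h : ∀ i ∈ s.vars, i < n) : ∃ t : FreeMagma (Fin n),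
    t.vars.map Fin.val = s.vars ∧ (altIdeal n).mkQ (MonoidAlgebra.single t 1) = mev (freeMul n) (gen n) s := by
  induction s with
  | ih1 a =>
    have ha : a < n := h a (Multiset.mem_singleton_self a)
    exact ⟨.of ⟨a, ha⟩, rfl, (gen_of_lt ha).symm⟩
  | ih2 a b ha hb =>
    obtain ⟨s, hs, es⟩ := ha fun i hi => h i (Multiset.mem_add.2 (.inl hi))
    obtain ⟨t, ht, et⟩ := hb fun i hi => h i (Multiset.mem_add.2 (.inr hi))
    refine ⟨.mul s t, ?_, ?_⟩
    · change (s.vars + t.vars).map _ = a.vars + b.vars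
      rw [← hs, ← ht, Multiset.map_add]
    · change _ = freeMul n (mev (freeMul n) (gen n) a) (mev (freeMul n) (gen n) b)
      rw [← es, ← et, freeMul_mk, MonoidAlgebra.single_mul_single, one_mul]
      rfl

lemma map_val_univ (n : ℕ) : (Finset.univ.val : Multiset (Fin n)).map Fin.val = Multiset.range n :=
  congrArg Finset.val (Fin.map_valEmbedding_univ.trans (Nat.Iio_eq_range n))

theorem altMultilinSpace_eq (n : ℕ) : altMultilinSpace n = spanMonomials n (Multiset.range n) := by
  refine le_antisymm (Submodule.span_mono ?_) (Submodule.span_mono ?_)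
  · rintro _ ⟨_, ⟨t, ht, rfl⟩, rfl⟩
    obtain ⟨s, hs, es⟩ := exists_mev_eq t
    exact ⟨s, by rw [hs, ht, map_val_univ], es.symm⟩
  · rintro _ ⟨s, hs, rfl⟩
    obtain ⟨t, ht, et⟩ := exists_eq_mev s (n := n) fun i hi => Multiset.mem_range.1 (hs ▸ hi)
    refine ⟨_, ⟨t, Multiset.map_injective Fin.val_injective ?_, rfl⟩, et⟩
    rw [ht, hs, map_val_univ]

lemma mul_mem_spanMonomials {s t : Multiset ℕ} {a b : FreeNA n ⧸ altIdeal n} (ha : a ∈ spanMonomials n s)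
    (hb : b ∈ spanMonomials n t) : freeMul n a b ∈ spanMonomials n (s + t) := by
  have := Submodule.apply_mem_map₂ (freeMul n) ha hb
  rw [spanMonomials, spanMonomials, Submodule.map₂_span_span] at this
  refine Submodule.span_mono ?_ this
  rintro _ ⟨_, ⟨a, rfl, rfl⟩, _, ⟨b, rfl, rfl⟩, rfl⟩
  exact ⟨.mul a b, rfl, rfl⟩

lemma gen_mem_spanMonomials (i : ℕ) : gen n i ∈ spanMonomials n {i} :=
  Submodule.subset_span ⟨.of i, rfl, rfl⟩

lemma asc_mem_spanMonomials (a b c : ℕ) :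
    asc (freeMul n) (gen n a) (gen n b) (gen n c) ∈ spanMonomials n ({a} + ({b} + {c})) := by
  have ha := gen_mem_spanMonomials (n := n) a
  have hb := gen_mem_spanMonomials (n := n) b
  have hc := gen_mem_spanMonomials (n := n) c
  have h := mul_mem_spanMonomials (mul_mem_spanMonomials ha hb) hc
  rw [add_assoc] at h
  exact sub_mem h (mul_mem_spanMonomials ha (mul_mem_spanMonomials hb hc))

lemma op_mem_spanMonomials (k : Bool) (i : ℕ) {s : Multiset ℕ} {m : FreeNA n ⧸ altIdeal n}
    (hm : m ∈ spanMonomials n s) : op (freeMul n) k (gen n i) m ∈ spanMonomials n ({i} + s) := by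
  have h1 := mul_mem_spanMonomials (gen_mem_spanMonomials i) hm
  have h2 := mul_mem_spanMonomials hm (gen_mem_spanMonomials i)
  rw [add_comm] at h2
  cases k
  · exact sub_mem h1 h2
  · exact add_mem h1 h2

lemma Word.ev_cons {V : Type*} [AddCommGroup V] [Module ℚ V] (μ : V →ₗ[ℚ] V →ₗ[ℚ] V) (g : ℕ → V)
    (p : Bool × ℕ) (l : List (Bool × ℕ)) (a b c : ℕ) :
    Word.ev μ g ⟨p :: l, a, b, c⟩ = op μ p.1 (g p.2) (Word.ev μ g ⟨l, a, b, c⟩) := rfl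

lemma Word.ev_mem (y : Word) : y.ev (freeMul n) (gen n) ∈ spanMonomials n y.letters := by
  obtain ⟨l, a, b, c⟩ := y
  induction l with
  | nil => exact asc_mem_spanMonomials a b c
  | cons p l ih =>
    have := op_mem_spanMonomials p.1 p.2 ih
    rw [Multiset.singleton_add] at this
    rw [Word.ev_cons]
    exact this

lemma ev_mul_one (t : FreeMagma (Fin n)) : ev (LinearMap.mul ℚ ℚ) (fun _ => 1) t = 1 := by
  induction t with
  | ih1 a => rfl
  | ih2 a b ha hb => rw [ev_mul, ha, hb, LinearMap.mul_apply', one_mul]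

lemma isTwisted_mul (n : ℕ) (ε : List ℕ → ℚ) : IsTwisted n ε (LinearMap.mul ℚ ℚ) fun _ => 1 := by
  constructor <;> intros <;> simp [asc, ev_mul_one]

lemma isTwisted_mul_word {ε : List ℕ → ℚ} (y : Word) (hy : ∀ p ∈ y.letters, p < n) :
    (isTwisted_mul n ε).map [] [] (y.ev (freeMul n) (gen n)) = 0 := by
  obtain ⟨l, a, b, c⟩ := y
  simp only [Word.letters, List.mem_append, List.mem_cons, List.not_mem_nil, or_false] at hy
  suffices ∀ u w, (isTwisted_mul n ε).map u w (lopsEv (freeMul n) (gen n) l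
      (asc (freeMul n) (gen n a) (gen n b) (gen n c))) = 0 from this _ _
  induction l with
  | nil =>
    intro u w
    change IsTwisted.map _ _ _ (asc _ _ _ _) = 0
    rw [IsTwisted.map_asc _ _ _ (hy _ (by simp)) (hy _ (by simp)) (hy _ (by simp))]
    simp [asc]
  | cons p l ih =>
    intro u w
    have ih := ih fun q hq => hy q (by rcases hq with hq | hq <;> simp_all)
    have hp : p.2 < n := hy _ (by simp)
    change IsTwisted.map _ _ _ (op _ p.1 _ (lopsEv _ _ l _)) = 0
    generalize lopsEv (freeMul n) (gen n) l _ = m at ih ⊢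
    cases p.1 <;>
      simp [op, IsTwisted.map_gen_mul _ _ _ hp, IsTwisted.map_mul_gen _ _ _ hp, ih]

/-- The right-normed product of a list of letters. -/
def listMonomial (a : Fin n) : List (Fin n) → FreeMagma (Fin n)
  | [] => .of a
  | b :: l => .mul (.of a) (listMonomial b l)

lemma vars_listMonomial (a : Fin n) (l : List (Fin n)) : (listMonomial a l).vars = (a :: l : List (Fin n)) := by
  induction l generalizing a with
  | nil => rfl
  | cons b l ih => rw [listMonomial, FreeMagma.vars, ih]; rfl

lemma leaves_listMonomial (a : Fin n) (l : List (Fin n)) : leaves (listMonomial a l) = (a :: l).map Fin.val := by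
  induction l generalizing a with
  | nil => rfl
  | cons b l ih => rw [listMonomial, leaves, ih]; rfl

/-- The right-normed monomial of a permutation. -/
def permMonomial {n : ℕ} (σ : Equiv.Perm (Fin (n + 1))) : FreeMagma (Fin (n + 1)) :=
  listMonomial (σ 0) (List.ofFn fun i : Fin n => σ i.succ)

lemma leaves_permMonomial (σ : Equiv.Perm (Fin (n + 1))) : leaves (permMonomial σ) = (List.ofFn σ).map Fin.val := by
  rw [permMonomial, leaves_listMonomial, List.ofFn_succ]

lemma permMonomial_mem (σ : Equiv.Perm (Fin (n + 1))) :
    (altIdeal (n + 1)).mkQ (MonoidAlgebra.single (permMonomial σ) 1) ∈ altMultilinSpace (n + 1) := by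
  refine Submodule.subset_span ⟨_, ⟨_, ?_, rfl⟩, rfl⟩
  rw [permMonomial, vars_listMonomial, ← List.ofFn_succ (f := σ)]
  refine (Multiset.Nodup.ext (Multiset.coe_nodup.2 (List.nodup_ofFn.2 σ.injective)) Finset.univ.nodup).2
    fun i => ?_
  rw [Multiset.mem_coe, List.mem_ofFn]
  exact iff_of_true (σ.surjective i) (Finset.mem_univ i)

/-- The coefficients of a multilinear polynomial in the free associative algebra. -/
noncomputable def assocPart (n : ℕ) : (FreeNA (n + 1) ⧸ altIdeal (n + 1)) →ₗ[ℚ] Equiv.Perm (Fin (n + 1)) → ℚ :=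
  LinearMap.pi fun σ => (isTwisted_mul (n + 1) fun l => if l = (List.ofFn σ).map Fin.val then 1 else 0).map [] []

lemma assocPart_permMonomial (σ : Equiv.Perm (Fin (n + 1))) :
    assocPart n ((altIdeal (n + 1)).mkQ (MonoidAlgebra.single (permMonomial σ) 1)) = Pi.single σ 1 := by
  funext τ
  have h : (List.ofFn σ).map Fin.val = (List.ofFn τ).map Fin.val ↔ τ = σ := by
    rw [(List.map_injective_iff.2 Fin.val_injective).eq_iff, List.ofFn_inj, DFunLike.coe_fn_eq, eq_comm]
  rw [assocPart, LinearMap.pi_apply, IsTwisted.map_single, ev_mul_one, leaves_permMonomial, List.nil_append,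
    List.append_nil, Pi.single_apply]
  simp only [h, smul_eq_mul, mul_one]

theorem factorial_add_le_finrank {k : ℕ} [Module.Finite ℚ (altMultilinSpace (n + 1))] (y : Fin k → Word)
    (hy : ∀ r, (y r).letters.Perm (List.range (n + 1)))
    (h : LinearIndependent ℚ fun r => (y r).ev (freeMul (n + 1)) (gen (n + 1))) :
    (n + 1).factorial + k ≤ Module.finrank ℚ (altMultilinSpace (n + 1)) := by
  let f : Fin k → LinearMap.ker (assocPart n) := fun r => ⟨(y r).ev (freeMul (n + 1)) (gen (n + 1)), by
    refine funext fun σ => isTwisted_mul_word (y r) fun p hp => ?_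
    exact List.mem_range.1 ((hy r).mem_iff.1 hp)⟩
  let v : Equiv.Perm (Fin (n + 1)) → FreeNA (n + 1) ⧸ altIdeal (n + 1) := fun σ =>
    (altIdeal (n + 1)).mkQ (MonoidAlgebra.single (permMonomial σ) 1)
  have hf : LinearIndependent ℚ f := LinearIndependent.of_comp (Submodule.subtype _) h
  have hv : LinearIndependent ℚ (Submodule.Quotient.mk (p := LinearMap.ker (assocPart n)) ∘ v) := by
    refine LinearIndependent.of_comp ((LinearMap.ker (assocPart n)).liftQ (assocPart n) le_rfl) ?_
    have e := (Pi.basisFun ℚ (Equiv.Perm (Fin (n + 1)))).linearIndependent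
    rwa [show ⇑(Pi.basisFun ℚ (Equiv.Perm (Fin (n + 1)))) = assocPart n ∘ v from funext fun σ =>
      (Pi.basisFun_apply ..).trans (assocPart_permMonomial σ).symm] at e
  have hfv := hf.sumElim_of_quotient v hv
  have hmem : ∀ i, Sum.elim (fun r => (f r : FreeNA (n + 1) ⧸ altIdeal (n + 1))) v i ∈ altMultilinSpace (n + 1) := by
    rintro (r | σ)
    · have := (y r).ev_mem (n := n + 1)
      rw [Multiset.coe_eq_coe.2 (hy r)] at this
      rw [altMultilinSpace_eq]
      exact this
    · exact permMonomial_mem σ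
  have hM : LinearIndependent ℚ fun i => (⟨_, hmem i⟩ : altMultilinSpace (n + 1)) :=
    LinearIndependent.of_comp (altMultilinSpace (n + 1)).subtype hfv
  have := hM.fintype_card_le_finrank
  rw [Fintype.card_sum, Fintype.card_fin, Fintype.card_perm, Fintype.card_fin, add_comm] at this
  exact this

end
end Alt

namespace Alt

def octLanes₄ : List ℕ :=
  [183808, 151936, 169728, 11968, 240192, 206464, 36608, 109504]

def superCols₄ : List (ℕ × ℕ) := []

def basisWords₄ : List ℕ :=
  [73987, 8451, 78082, 12546, 78337, 12801, 78352, 12816]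

def basisPivots₄ : List ℕ :=
  [3, 4, 0, 1, 2, 6, 5, 7]

def octLanes₅ : List ℕ :=
  [130064, 129856, 143376, 74184, 184880, 105944, 242880, 168328, 48376, 177088, 94720, 95960,
    77008, 247656, 246856, 193104, 204552, 86792, 235504, 21896, 30408, 83624, 65488, 240784, 7968,
    205128, 168400, 68448, 138480, 225496, 24432, 195632, 25216, 121936, 223584, 174696, 200512,
    198880, 115768, 85544, 24680, 49856, 31064, 102296, 162720, 54688, 120104, 247360, 238424,
    146096, 34072, 186672, 152912, 2872]

def superCols₅ : List (ℕ × ℕ) :=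
  [(0, 30)]

def basisWords₅ : List ℕ :=
  [2302212, 3280963, 1183811, 2232387, 135235, 266275, 270355, 3416323, 2367747, 270595, 3346498,
    1249346, 2297922, 200770, 3412018, 1314866, 2363442, 266290, 3420178, 2371602, 274450, 3420418,
    2371842, 274690, 3350593, 1253441, 2302017, 204865, 3416113, 1318961, 2367537, 270385, 3420193,
    1323041, 2371617, 274465, 3420673, 2372097, 274945, 3350848, 1253696, 2302272, 205120, 3416368,
    1319216, 2367792, 270640, 3420448, 1323296, 2371872, 274720, 3420688, 1323536, 2372112, 274960]

def basisPivots₅ : List ℕ :=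
  [0, 4, 5, 1, 3, 12, 24, 10, 8, 15, 28, 14, 9, 7, 30, 22, 6, 34, 35, 2, 46, 11, 29, 19, 16, 27,
    42, 21, 13, 17, 18, 20, 39, 26, 32, 47, 54, 31, 23, 25, 52, 33, 48, 49, 45, 36, 41, 37, 38, 43,
    40, 51, 50, 44, 53]

def octLanes₆ : List ℕ :=
  [73256, 17832, 196924, 53594, 38406, 193472, 6173, 169192, 246280, 2370, 33142, 253985, 43204,
    66967, 7786, 251720, 134697, 210436, 33989, 160794, 133840, 4340, 219708, 3850, 13950, 2168,
    79744, 133678, 258215, 21764, 266, 200436, 113796, 229836, 221626, 21611, 16733, 24635, 2518,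
    26417, 245783, 34864, 108545, 10962, 36669, 100923, 185678, 131473, 12461, 199438, 131152,
    102765, 68725, 213079, 232007, 27892, 96761, 240193, 85528, 114966, 86062, 66085, 25982, 249910,
    123619, 88432, 172000, 26279, 18964, 96390, 197859, 98326, 79170, 122117, 40387, 197335, 26703,
    58488, 138773, 35839, 123931, 17704, 156681, 109336, 213880, 94408, 254193, 227351, 181817,
    20670, 29506, 210060, 43752, 180426, 119956, 252959, 237968, 66410, 166084, 72784, 61460,
    209443, 47832, 32043, 179024, 198717, 63768, 215910, 44576, 181310, 157545, 34722, 33624, 72145,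
    30848, 67726, 165059, 121857, 103475, 168028, 13726, 12698, 175300, 250089, 82164, 941, 21763,
    110028, 6824, 18309, 7516, 218230, 258936, 235394, 69320, 108124, 253824, 210404, 91074, 258800,
    119041, 239569, 99225, 193171, 34120, 11214, 13566, 18709, 132750, 100815, 41367, 135100,
    170677, 5402, 19287, 149042, 109272, 211624, 79832, 207996, 244804, 155688, 1917, 37617, 194379,
    244795, 43140, 172314, 195557, 231898, 123462, 246466, 51961, 17961, 92912, 82313, 106471,
    39908, 117614, 23135, 242024, 60638, 256862, 7235, 234845, 207203, 63607, 153805, 90239, 137095,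
    247353, 142966, 111719, 191227, 118579, 69700, 184132, 125945, 121508, 146221, 75519, 201833,
    3692, 158059, 109387, 192906, 256436, 244288, 235781, 72167, 252484, 170534, 151775, 257741,
    75376, 209316, 244080, 7250, 182065, 41468, 203980, 20739, 237226, 129257, 236263, 195429,
    198432, 121546, 177290, 45660, 249614, 174794, 124245, 209743, 15224, 201291, 161178, 131823,
    250096, 107853, 69049, 136384, 130702, 223713, 213833, 191974, 73943, 112572, 236813, 208139,
    87660, 27685, 82471, 260173, 230637, 48265, 44934, 105628, 17375, 42334, 74187, 198441, 75516,
    238415, 4890, 179609, 44481, 188482, 242489, 190833, 94952, 143267, 18770, 242246, 210668,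
    51995, 150933, 123629, 92593, 247487, 80410, 179564, 93059, 105509, 72758, 158024, 187582,
    15011, 43768, 45389, 260587, 160098, 176687, 79820, 80032, 136190, 105007, 92662, 185641,
    195820, 84058, 207863, 151747, 230127, 137752, 253502, 164241, 152387, 140882, 228165, 194975,
    241162, 219199, 118889, 34154, 223969, 244041, 134435, 177790, 51938, 198868, 105243, 48349,
    190051, 192773, 206071, 38678, 12977]

def superCols₆ : List (ℕ × ℕ) :=
  [(1, 57), (1, 30), (1, 46), (1, 54), (1, 58), (1, 60), (2, 57), (2, 30), (2, 46), (2, 54),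
    (2, 58), (2, 60), (3, 23), (3, 39), (3, 27), (3, 43), (3, 51), (3, 29), (3, 45), (3, 53),
    (3, 57), (3, 30), (3, 46), (3, 54), (3, 58), (3, 60), (4, 57), (4, 30), (4, 46), (4, 54),
    (4, 58), (4, 60)]

def basisWords₆ : List ℕ :=
  [87167060, 103945476, 70391044, 5378820, 5444100, 106111236, 39002372, 72556804, 5447940,
    88215635, 71438419, 119604547, 52495683, 86050115, 18941251, 102827331, 35718467, 69272899,
    2164035, 22086211, 5308995, 22151491, 5374275, 122818627, 89264195, 22155331, 106041411,
    72486979, 5378115, 71370019, 4261155, 38863907, 72418339, 5309475, 71435539, 4326675, 38929427,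
    72483859, 5374995, 72622099, 121771267, 54662403, 104994051, 37885187, 71439619, 4330755,
    122819587, 55710723, 106042371, 38933507, 72487939, 5379075, 106172931, 39064067, 72618499,
    5509635, 106176771, 39067907, 72622339, 5513475, 88281170, 71503954, 120653122, 53544258,
    87098690, 19989826, 103875906, 36767042, 70321474, 3212610, 22086466, 5309250, 22217026,
    5439810, 122884162, 89329730, 22220866, 106106946, 72552514, 5443650, 121701682, 54592818,
    88147250, 21038386, 104924466, 37815602, 71370034, 4261170, 122750002, 55641138, 89195570,
    22086706, 105972786, 38863922, 72418354, 5309490, 122945842, 89391410, 22282546, 5505330,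
    122949682, 89395250, 22286386, 106172466, 72618034, 5509170, 121832722, 54723858, 105055506,
    37946642, 71501074, 4392210, 122881042, 55772178, 106103826, 38994962, 72549394, 5440530,
    122946322, 55837458, 106169106, 39060242, 72614674, 5505810, 72626194, 5517330, 121836802,
    54727938, 105059586, 37950722, 71505154, 4396290, 122885122, 55776258, 106107906, 38999042,
    72553474, 5444610, 122950402, 55841538, 106173186, 39064322, 72618754, 5509890, 106180866,
    39072002, 72626434, 5517570, 88285265, 71508049, 120718657, 53609793, 87164225, 20055361,
    103941441, 36832577, 70387009, 3278145, 22152001, 5374785, 22217281, 5440065, 122888257,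
    89333825, 22224961, 106111041, 72556609, 5447745, 121767217, 54658353, 88212785, 21103921,
    104990001, 37881137, 71435569, 4326705, 122815537, 55706673, 89261105, 22152241, 106038321,
    38929457, 72483889, 5375025, 122946097, 89391665, 22282801, 106168881, 72614449, 5505585,
    122953777, 89399345, 22290481, 106176561, 72622129, 5513265, 121832737, 54723873, 88278305,
    21169441, 105055521, 37946657, 71501089, 4392225, 122881057, 55772193, 89326625, 22217761,
    106103841, 38994977, 72549409, 5440545, 122946337, 55837473, 89391905, 22283041, 106169121,
    39060257, 72614689, 5505825, 122957857, 89403425, 22294561, 106180641, 72626209, 5517345,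
    121840897, 54732033, 105063681, 37954817, 71509249, 4400385, 122889217, 55780353, 106112001,
    39003137, 72557569, 5448705, 122954497, 55845633, 106177281, 39068417, 72622849, 5513985,
    122958337, 55849473, 106181121, 39072257, 72626689, 5517825, 88285520, 71508304, 120722752,
    53613888, 87168320, 20059456, 103945536, 36836672, 70391104, 3282240, 22156096, 5378880,
    22221376, 5444160, 122888512, 89334080, 22225216, 106111296, 72556864, 5448000, 121771312,
    54662448, 88216880, 21108016, 104994096, 37885232, 71439664, 4330800, 122819632, 55710768,
    89265200, 22156336, 106042416, 38933552, 72487984, 5379120, 122950192, 89395760, 22286896,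
    106172976, 72618544, 5509680, 122954032, 89399600, 22290736, 106176816, 72622384, 5513520,
    121836832, 54727968, 88282400, 21173536, 105059616, 37950752, 71505184, 4396320, 122885152,
    55776288, 89330720, 22221856, 106107936, 38999072, 72553504, 5444640, 122950432, 55841568,
    89396000, 22287136, 106173216, 39064352, 72618784, 5509920, 122958112, 89403680, 22294816,
    106180896, 72626464, 5517600, 121840912, 54732048, 88286480, 21177616, 105063696, 37954832,
    71509264, 4400400, 122889232, 55780368, 89334800, 22225936, 106112016, 39003152, 72557584,
    5448720, 122954512, 55845648, 89400080, 22291216, 106177296, 39068432, 72622864, 5514000,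
    122958352, 55849488, 89403920, 22295056, 106181136, 39072272, 72626704, 5517840]

def basisPivots₆ : List ℕ :=
  [2, 6, 7, 21, 20, 22, 25, 32, 1, 8, 23, 27, 28, 31, 33, 48, 3, 9, 24, 42, 29, 44, 38, 52, 4, 10,
    26, 36, 30, 34, 73, 53, 39, 11, 40, 41, 49, 56, 0, 12, 54, 61, 62, 66, 67, 68, 43, 13, 70, 35,
    71, 87, 72, 92, 58, 65, 86, 215, 88, 89, 108, 254, 60, 14, 69, 95, 105, 125, 83, 98, 312, 101,
    157, 158, 78, 16, 47, 242, 114, 93, 176, 259, 81, 74, 76, 55, 111, 113, 180, 251, 80, 15, 99,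
    142, 167, 168, 126, 184, 82, 205, 110, 129, 103, 223, 186, 197, 199, 152, 140, 212, 18, 85, 154,
    134, 90, 143, 17, 94, 107, 200, 102, 204, 19, 84, 206, 209, 106, 213, 116, 145, 216, 221, 120,
    226, 97, 228, 117, 207, 229, 230, 5, 37, 46, 63, 45, 231, 233, 214, 51, 77, 144, 164, 119, 234,
    235, 138, 59, 185, 192, 121, 122, 238, 239, 288, 91, 247, 109, 190, 249, 211, 123, 260, 261,
    159, 264, 309, 96, 151, 79, 269, 208, 243, 265, 270, 112, 201, 148, 272, 217, 133, 274, 318,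
    100, 285, 104, 210, 323, 248, 115, 299, 127, 278, 131, 220, 163, 118, 256, 225, 280, 245, 291,
    301, 130, 284, 289, 294, 128, 169, 222, 297, 137, 194, 135, 237, 244, 277, 146, 287, 136, 227,
    283, 267, 160, 275, 304, 310, 64, 302, 252, 298, 311, 321, 139, 149, 262, 305, 315, 350, 161,
    202, 295, 314, 319, 334, 124, 337, 150, 171, 306, 303, 132, 240, 326, 336, 141, 50, 75, 317,
    147, 57, 296, 322, 153, 203, 250, 324, 236, 179, 327, 198, 155, 332, 156, 266, 328, 268, 162,
    273, 165, 292, 166, 255, 170, 333, 308, 263, 219, 329, 351, 349, 172, 313, 325, 338, 173, 300,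
    340, 357, 174, 188, 320, 330, 175, 290, 177, 253, 341, 293, 181, 335, 342, 178, 189, 307, 182,
    257, 187, 193, 316, 183, 276, 191, 343, 195, 241, 345, 258, 196, 271, 232, 281, 346, 282, 286,
    344, 279, 347, 348, 339, 352, 353, 218, 331, 354, 356, 224, 246, 358, 359, 355]

lemma isBasis₄ : isBasis 1 8 octLanes₄ superCols₄ basisWords₄ basisPivots₄ = true := by decide +kernel

lemma isBasis₅ : isBasis 2 56 octLanes₅ superCols₅ basisWords₅ basisPivots₅ = true := by decide +kernel

lemma isBasis₆ : isBasis 3 360 octLanes₆ superCols₆ basisWords₆ basisPivots₆ = true := by decide +kernel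

lemma finrank_altMultilinSpace {m K d : ℕ} {lanes : List ℕ} {cols : List (ℕ × ℕ)} {words ss : List ℕ}
    (h : isBasis m K lanes cols words ss = true) (hK : 2 ≤ K) (hK' : 2 * (K / 2) = K) (hk : K ≤ 1000)
    (hc : ∀ q ∈ cols, q.1 < 5) (hL : cols.length + lanes.length ≤ K)
    (hw : words.length = ss.length) (hs : ss.length ≤ K) (hm : isMultilinear m words = true)
    (hd : words.length = d)
    (hle : Module.finrank ℚ (Submodule.span ℚ (wordEv (freeMul (m + 3)) (gen (m + 3)) (m + 3) ''
      (opWords m (Finset.range (m + 3)) : Set (List (Bool × ℕ))))) ≤ d) :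
    Module.finrank ℚ (altMultilinSpace (m + 3)) = (m + 3).factorial + d := by
  obtain ⟨_, h1⟩ := finrank_le (isAlternative_freeMul (m + 3)) hle (altMultilinSpace_eq (m + 3)).le
  subst hd
  exact le_antisymm h1 (factorial_add_le_finrank _
    (fun r => letters_perm hm (List.mem_reverse.1 (List.getElem_mem _)))
    (linearIndependent_ev h hK hK' hk hc hL hw hs hm))

lemma finrank_words₄ : Module.finrank ℚ (Submodule.span ℚ (wordEv (freeMul 4) (gen 4) 4 ''
    (opWords 1 (Finset.range 4) : Set (List (Bool × ℕ))))) ≤ 8 := by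
  classical
  rw [← Finset.coe_image]
  refine (finrank_span_finset_le_card _).trans (Finset.card_image_le.trans ((card_opWords_le _ _).trans ?_))
  decide

end Alt

/-- `dim Alt(4) = 32`, `dim Alt(5) = 175` and `dim Alt(6) = 1080`. -/
theorem alt_dimensions_four_five_six :
    Module.finrank ℚ (altMultilinSpace 4) = 32 ∧
    Module.finrank ℚ (altMultilinSpace 5) = 175 ∧
    Module.finrank ℚ (altMultilinSpace 6) = 1080 :=
  ⟨Alt.finrank_altMultilinSpace Alt.isBasis₄ (by norm_num) rfl (by norm_num) (by decide) (by decide) rfl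
      (by decide) (by decide +kernel) rfl Alt.finrank_words₄,
    Alt.finrank_altMultilinSpace (d := 55) Alt.isBasis₅ (by norm_num) rfl (by norm_num) (by decide +kernel)
      (by decide +kernel) (by decide +kernel) (by decide +kernel) (by decide +kernel) (by decide +kernel)
      (Alt.finrank_words₅ (Alt.isAlternative_freeMul 5) _),
    Alt.finrank_altMultilinSpace (d := 360) Alt.isBasis₆ (by norm_num) rfl (by norm_num) (by decide +kernel)
      (by decide +kernel) (by decide +kernel) (by decide +kernel) (by decide +kernel) (by decide +kernel)
      (Alt.finrank_words₆ (Alt.isAlternative_freeMul 6) _)⟩
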